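/- Let n ≥ 1 and let (X,x₀) be a well-pointed path-connected space. Then there is a weak homotopy equivalence (the 'scanning' or electric field map) from the labelled configuration space C⁰(ℝ^n;X) to the n-fold loop space Ω^n Σ^n X of the n-fold reduced suspension of X. -/

import Mathlib

open scoped unitInterval Topology
open Metric Set

noncomputable section

universe uWP

/-! ### Ordered configuration spaces -/

/-- The ordered configuration space `C⁰_k(M)`: `k`-tuples of pairwise distinct points of `M`,
topologized as a subspace of `M^k`. -/
def OrdConfig (M : Type*) [TopologicalSpace M] (k : ℕ) : Type _ :=
  {p : Fin k → M // Function.Injective p}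

instance (M : Type*) [TopologicalSpace M] (k : ℕ) : TopologicalSpace (OrdConfig M k) :=
  inferInstanceAs (TopologicalSpace {p : Fin k → M // Function.Injective p})

/-- The action of the symmetric group `Σ_k` on the ordered configuration space,
permuting the coordinates. -/
def OrdConfig.perm {M : Type*} [TopologicalSpace M] {k : ℕ} (e : Equiv.Perm (Fin k))
    (p : OrdConfig M k) : OrdConfig M k :=
  ⟨p.1 ∘ e, p.2.comp e.injective⟩

/-! ### Labelled configuration spaces -/

/-- The "pre-configuration space": disjoint union over `k` of `C⁰_k(M) × X^k`. -/
def LabelPre (M X : Type*) [TopologicalSpace M] [TopologicalSpace X] : Type _ :=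
  Σ k : ℕ, OrdConfig M k × (Fin k → X)

instance (M X : Type*) [TopologicalSpace M] [TopologicalSpace X] :
    TopologicalSpace (LabelPre M X) :=
  inferInstanceAs (TopologicalSpace (Σ k : ℕ, OrdConfig M k × (Fin k → X)))

/-- The relation generating the equivalence defining `C⁰(M;X)`: permuting points together
with their labels, and deleting points labelled by the base point `x₀`. -/
inductive LabelRel (M X : Type*) [TopologicalSpace M] [TopologicalSpace X] (x₀ : X) :
    LabelPre M X → LabelPre M X → Prop
  | perm {k : ℕ} (c : OrdConfig M k) (l : Fin k → X) (e : Equiv.Perm (Fin k)) :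
      LabelRel M X x₀ ⟨k, c, l⟩ ⟨k, OrdConfig.perm e c, l ∘ e⟩
  | delete {k : ℕ} (c : OrdConfig M (k + 1)) (l : Fin (k + 1) → X) (i : Fin (k + 1))
      (h : l i = x₀) :
      LabelRel M X x₀ ⟨k + 1, c, l⟩
        ⟨k, ⟨c.1 ∘ i.succAbove, c.2.comp Fin.succAbove_right_injective⟩, l ∘ i.succAbove⟩

/-- The labelled configuration space `C⁰(M;X)`, with the quotient topology. -/
def LabeledConfig (M X : Type*) [TopologicalSpace M] [TopologicalSpace X] (x₀ : X) :=
  Quot (LabelRel M X x₀)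

instance (M X : Type*) [TopologicalSpace M] [TopologicalSpace X] (x₀ : X) :
    TopologicalSpace (LabeledConfig M X x₀) :=
  inferInstanceAs (TopologicalSpace (Quot (LabelRel M X x₀)))

/-- The empty configuration. -/
def LabelPre.empty (M X : Type*) [TopologicalSpace M] [TopologicalSpace X] : LabelPre M X :=
  ⟨0, ⟨Fin.elim0, fun i => i.elim0⟩, Fin.elim0⟩

/-- The class of the empty configuration; the base point of `C⁰(M;X)`. -/
def LabeledConfig.empty (M X : Type*) [TopologicalSpace M] [TopologicalSpace X] (x₀ : X) :
    LabeledConfig M X x₀ :=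
  Quot.mk _ (LabelPre.empty M X)

/-- The label of a pre-configuration `a` at a point `m` of `M`: the label of the point of the
configuration located at `m`, if there is one, and the base point `x₀` otherwise. -/
noncomputable def labelAt {M X : Type*} [TopologicalSpace M] [TopologicalSpace X] (x₀ : X)
    (a : LabelPre M X) (m : M) : X :=
  haveI := Classical.propDecidable (∃ i, a.2.1.1 i = m)
  if h : ∃ i, a.2.1.1 i = m then a.2.2 h.choose else x₀

/-- Two labelled configurations agree off `N` if they have representatives whose labelled points
outside of `N` coincide. -/
def AgreeOff {M X : Type*} [TopologicalSpace M] [TopologicalSpace X] (x₀ : X) (N : Set M)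
    (a b : LabeledConfig M X x₀) : Prop :=
  ∃ a' b' : LabelPre M X, a = Quot.mk _ a' ∧ b = Quot.mk _ b' ∧
    ∀ m ∉ N, labelAt x₀ a' m = labelAt x₀ b' m

/-- The relative labelled configuration space `C⁰(M,N;X)`: the quotient of `C⁰(M;X)`
identifying two labelled configurations whenever they agree on `M ∖ N`. -/
def RelConfig (M : Type*) [TopologicalSpace M] (N : Set M) (X : Type*) [TopologicalSpace X]
    (x₀ : X) : Type _ :=
  Quot (AgreeOff (M := M) (X := X) x₀ N)

instance (M : Type*) [TopologicalSpace M] (N : Set M) (X : Type*) [TopologicalSpace X] (x₀ : X) :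
    TopologicalSpace (RelConfig M N X x₀) :=
  inferInstanceAs (TopologicalSpace (Quot _))

/-- The base point of `C⁰(M,N;X)`: the class of the empty configuration. -/
def RelConfig.base (M : Type*) [TopologicalSpace M] (N : Set M) (X : Type*) [TopologicalSpace X]
    (x₀ : X) : RelConfig M N X x₀ :=
  Quot.mk _ (LabeledConfig.empty M X x₀)

/-! ### Well-pointedness -/

/-- `(X, x₀)` is well-pointed if the inclusion `{x₀} ↪ X` is a cofibration, i.e. satisfies the
homotopy extension property. -/
def IsWellPointed (X : Type uWP) [TopologicalSpace X] (x₀ : X) : Prop :=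
  ∀ (Y : Type uWP) (_ : TopologicalSpace Y) (f : C(X, Y)) (p : C(I, Y)),
    p 0 = f x₀ → ∃ G : C(I × X, Y), (∀ x, G (0, x) = f x) ∧ ∀ t, G (t, x₀) = p t

/-! ### Cubes, suspensions and loop spaces -/

/-- The `n`-cube `I^n`. -/
def NCube (n : ℕ) : Type :=
  Fin n → I

instance (n : ℕ) : TopologicalSpace (NCube n) :=
  inferInstanceAs (TopologicalSpace (Fin n → I))

/-- The boundary `∂I^n` of the `n`-cube. -/
def NCube.boundary (n : ℕ) : Set (NCube n) :=
  {t | ∃ i, t i = 0 ∨ t i = 1}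

/-- The subset of `I^n × X` collapsed in the definition of the reduced suspension:
`(∂I^n × X) ∪ (I^n × {x₀})`. -/
def SuspCollapse (n : ℕ) (X : Type*) [TopologicalSpace X] (x₀ : X) : Set (NCube n × X) :=
  (NCube.boundary n ×ˢ (univ : Set X)) ∪ ((univ : Set (NCube n)) ×ˢ ({x₀} : Set X))

/-- The `n`-fold reduced suspension `Σⁿ X = (I^n × X)/((∂I^n × X) ∪ (I^n × {x₀}))`. -/
def Susp (n : ℕ) (X : Type*) [TopologicalSpace X] (x₀ : X) :=
  Quot (fun a b : NCube n × X => a ∈ SuspCollapse n X x₀ ∧ b ∈ SuspCollapse n X x₀)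

instance (n : ℕ) (X : Type*) [TopologicalSpace X] (x₀ : X) : TopologicalSpace (Susp n X x₀) :=
  inferInstanceAs (TopologicalSpace (Quot _))

/-- The base point of the reduced suspension: the class of the collapsed subset. -/
def Susp.base (n : ℕ) (X : Type*) [TopologicalSpace X] (x₀ : X) : Susp n X x₀ :=
  Quot.mk _ (fun _ => 0, x₀)

/-- The `n`-fold based loop space `Ωⁿ(Y,y₀)`, modelled as the space of continuous maps
`I^n → Y` sending `∂I^n` to the base point, with the compact-open topology. -/
def NLoop (n : ℕ) (Y : Type*) [TopologicalSpace Y] (y₀ : Y) :=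
  {f : C(NCube n, Y) // ∀ t ∈ NCube.boundary n, f t = y₀}

instance (n : ℕ) (Y : Type*) [TopologicalSpace Y] (y₀ : Y) : TopologicalSpace (NLoop n Y y₀) :=
  inferInstanceAs (TopologicalSpace {f : C(NCube n, Y) // ∀ t ∈ NCube.boundary n, f t = y₀})

/-! ### Weak homotopy equivalences -/

/-- The map induced on path components by a continuous map. -/
def ZerothHomotopy.inducedMap {X Y : Type*} [TopologicalSpace X] [TopologicalSpace Y]
    (f : C(X, Y)) : ZerothHomotopy X → ZerothHomotopy Y :=
  @Quotient.map _ _ (pathSetoid X) (pathSetoid Y) f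
    (fun _ _ h => Nonempty.map (fun p => p.map f.continuous) h)

/-- The map induced by a continuous map on generalized loops. -/
def GenLoop.inducedMap {N X Y : Type*} [TopologicalSpace X] [TopologicalSpace Y] {x : X}
    (f : C(X, Y)) (p : GenLoop N X x) : GenLoop N Y (f x) :=
  ⟨f.comp p.1, fun y hy => by
    simp only [ContinuousMap.comp_apply]
    rw [p.2 y hy]⟩

/-- The map induced by a continuous map on homotopy groups. -/
def HomotopyGroup.inducedMap (N : Type*) {X Y : Type*} [TopologicalSpace X] [TopologicalSpace Y]
    (x : X) (f : C(X, Y)) : HomotopyGroup N X x → HomotopyGroup N Y (f x) :=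
  Quotient.map (GenLoop.inducedMap f)
    (fun _ _ h => Nonempty.map (fun H => H.compContinuousMap f) h)

/-- A continuous map is a weak homotopy equivalence if it induces a bijection on path
components and isomorphisms on all homotopy groups at every base point. -/
def IsWeakHomotopyEquiv {X Y : Type*} [TopologicalSpace X] [TopologicalSpace Y]
    (f : C(X, Y)) : Prop :=
  Function.Bijective (ZerothHomotopy.inducedMap f) ∧
    ∀ (n : ℕ) (x : X), Function.Bijective (HomotopyGroup.inducedMap (Fin n) x f)

/-! ### Configuration spaces with a visibility weight -/

namespace Scan

open Filter

/-- Finite configurations of points of `P` labelled in `L`, all of whose points are visible,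
i.e. have positive weight. -/
def Conf {P L : Type*} (ω : P × L → ℝ) : Type _ :=
  {c : Set (P × L) // c.Finite ∧ InjOn Prod.fst c ∧ ∀ y ∈ c, 0 < ω y}

namespace Conf

section Basic

variable {P L : Type*} {ω : P × L → ℝ}

instance : SetLike (Conf ω) (P × L) := ⟨Subtype.val, Subtype.val_injective⟩

lemma finite (c : Conf ω) : (c : Set (P × L)).Finite := c.2.1

lemma injOn (c : Conf ω) : InjOn Prod.fst (c : Set (P × L)) := c.2.2.1

lemma pos (c : Conf ω) {y : P × L} (hy : y ∈ c) : 0 < ω y := c.2.2.2 y hy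

lemma eq_of_fst (c : Conf ω) {y y' : P × L} (hy : y ∈ c) (hy' : y' ∈ c) (h : y.1 = y'.1) :
    y = y' := c.injOn hy hy' h

@[ext] lemma ext {c c' : Conf ω} (h : ∀ y, y ∈ c ↔ y ∈ c') : c = c' := SetLike.ext h

/-- Constructor for configurations. -/
def mk (s : Set (P × L)) (hf : s.Finite) (hi : InjOn Prod.fst s) (hp : ∀ y ∈ s, 0 < ω y) :
    Conf ω := ⟨s, hf, hi, hp⟩

@[simp] lemma mem_mk {s : Set (P × L)} (hf hi hp) {y : P × L} :
    y ∈ (mk s hf hi hp : Conf ω) ↔ y ∈ s := Iff.rfl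

instance : EmptyCollection (Conf ω) := ⟨⟨∅, by simp⟩⟩

@[simp] lemma notMem_empty (y : P × L) : y ∉ (∅ : Conf ω) := fun h => h

lemma eq_empty_iff {c : Conf ω} : c = ∅ ↔ ∀ y, y ∉ c := by
  constructor
  · rintro rfl y; simp
  · intro h; ext y; simp [h y]

end Basic

section Top

variable {P L : Type*} [MetricSpace P] [TopologicalSpace L] {ω : P × L → ℝ}

/-- Points may move, disappear where the weight tends to `0`, but may not collide in the visible
region. -/
instance : TopologicalSpace (Conf ω) := TopologicalSpace.generateFrom
  ({V | ∃ O : Set (P × L), IsOpen O ∧ V = {c | ∃ y ∈ c, y ∈ O}} ∪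
   {V | ∃ D : Set (P × L), IsClosed D ∧ (∃ θ > 0, ∀ y ∈ D, θ ≤ ω y) ∧
      (V = {c | ∀ y ∈ c, y ∉ D} ∨ V = {c | ∀ y ∈ c, ∀ y' ∈ c, y ∈ D → y' ∈ D → y = y'})})

lemma tendsto_iff_basic {K : Type*} {l : Filter K} {f : K → Conf ω} {c : Conf ω} :
    Tendsto f l (𝓝 c) ↔
      (∀ O : Set (P × L), IsOpen O → (∃ y ∈ c, y ∈ O) → ∀ᶠ k in l, ∃ y ∈ f k, y ∈ O) ∧
      (∀ D : Set (P × L), IsClosed D → (∃ θ > 0, ∀ y ∈ D, θ ≤ ω y) →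
        ((∀ y ∈ c, y ∉ D) → ∀ᶠ k in l, ∀ y ∈ f k, y ∉ D) ∧
        ((∀ y ∈ c, ∀ y' ∈ c, y ∈ D → y' ∈ D → y = y') →
          ∀ᶠ k in l, ∀ y ∈ f k, ∀ y' ∈ f k, y ∈ D → y' ∈ D → y = y')) := by
  rw [TopologicalSpace.tendsto_nhds_generateFrom_iff]
  constructor
  · intro h
    refine ⟨fun O hO hc => h _ (Or.inl ⟨O, hO, rfl⟩) hc, fun D hD hθ => ⟨fun hc => ?_, fun hc => ?_⟩⟩
    · exact h _ (Or.inr ⟨D, hD, hθ, Or.inl rfl⟩) hc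
    · exact h _ (Or.inr ⟨D, hD, hθ, Or.inr rfl⟩) hc
  · rintro ⟨h1, h2⟩ s (⟨O, hO, rfl⟩ | ⟨D, hD, hθ, rfl | rfl⟩) hc
    · exact h1 O hO hc
    · exact (h2 D hD hθ).1 hc
    · exact (h2 D hD hθ).2 hc

lemma tendsto_of_sections {K : Type*} {l : Filter K} {f : K → Conf ω} {c : Conf ω}
    (η : P × L → K → P × L)
    (h1 : ∀ y ∈ c, Tendsto (η y) l (𝓝 y) ∧ ∀ᶠ k in l, η y k ∈ f k)
    (h2 : ∀ θ > 0, ∀ᶠ k in l, ∀ y' ∈ f k, θ ≤ ω y' → ∃ y ∈ c, y' = η y k) :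
    Tendsto f l (𝓝 c) := by
  have key : ∀ D : Set (P × L), IsClosed D →
      ∀ᶠ k in l, ∀ y ∈ (c : Set (P × L)), η y k ∈ D → y ∈ D := by
    intro D hD
    rw [eventually_all_finite c.finite]
    intro y hy
    by_cases hyD : y ∈ D
    · exact Eventually.of_forall fun _ _ => hyD
    · filter_upwards [(h1 y hy).1 (hD.isOpen_compl.mem_nhds hyD)] with k hk h
      exact absurd h hk
  rw [tendsto_iff_basic]
  refine ⟨?_, fun D hD ⟨θ, hθ, hθD⟩ => ⟨fun hc => ?_, fun hc => ?_⟩⟩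
  · rintro O hO ⟨y, hy, hyO⟩
    filter_upwards [(h1 y hy).1 (hO.mem_nhds hyO), (h1 y hy).2] with k hk hk'
    exact ⟨_, hk', hk⟩
  · filter_upwards [key D hD, h2 θ hθ] with k hk hk' y' hy' hD'
    obtain ⟨y, hy, rfl⟩ := hk' y' hy' (hθD _ hD')
    exact hc y hy (hk y hy hD')
  · filter_upwards [key D hD, h2 θ hθ] with k hk hk' y1 hy1 y2 hy2 hD1 hD2
    obtain ⟨y, hy, rfl⟩ := hk' y1 hy1 (hθD _ hD1)
    obtain ⟨y', hy', rfl⟩ := hk' y2 hy2 (hθD _ hD2)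
    rw [hc y hy y' hy' (hk y hy hD1) (hk y' hy' hD2)]

lemma exists_sections (hω : Continuous ω) {K : Type*} {l : Filter K} {f : K → Conf ω} {c : Conf ω}
    (hf : Tendsto f l (𝓝 c)) : ∃ η : P × L → K → P × L,
      (∀ y ∈ c, Tendsto (η y) l (𝓝 y) ∧ ∀ᶠ k in l, η y k ∈ f k) ∧
      ∀ θ > 0, ∀ᶠ k in l, ∀ y' ∈ f k, θ ≤ ω y' → ∃ y ∈ c, y' = η y k := by
  classical
  rw [tendsto_iff_basic] at hf
  obtain ⟨hO, hD⟩ := hf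
  obtain ⟨r, hr, hsep⟩ : ∃ r > 0, ∀ y ∈ c, ∀ y' ∈ c, dist y'.1 y.1 ≤ r → y' = y := by
    have : ∀ y ∈ (c : Set (P × L)), ∀ᶠ r in 𝓝[>] (0 : ℝ),
        ∀ y' ∈ (c : Set (P × L)), dist y'.1 y.1 ≤ r → y' = y := by
      intro y hy
      rw [eventually_all_finite c.finite]
      intro y' hy'
      by_cases h : y' = y
      · exact Eventually.of_forall fun _ _ => h
      · have : 0 < dist y'.1 y.1 := dist_pos.2 fun h' => h (c.eq_of_fst hy' hy h')
        filter_upwards [mem_nhdsWithin_of_mem_nhds (Iio_mem_nhds this)] with r hr h'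
        exact absurd h' (not_le.2 hr)
    rw [← eventually_all_finite c.finite] at this
    obtain ⟨r, h, hr⟩ := (this.and self_mem_nhdsWithin).exists
    exact ⟨r, hr, h⟩
  let D : P × L → Set (P × L) := fun y => {y' | ω y / 2 ≤ ω y' ∧ dist y'.1 y.1 ≤ r}
  let U : P × L → Set (P × L) := fun y => {y' | ω y / 2 < ω y' ∧ dist y'.1 y.1 < r}
  have hUD : ∀ y, U y ⊆ D y := fun y y' h => ⟨h.1.le, h.2.le⟩
  have hUo : ∀ y, IsOpen (U y) := fun y =>
    (isOpen_lt continuous_const hω).inter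
      (isOpen_lt (continuous_fst.dist continuous_const) continuous_const)
  have hDc : ∀ y, IsClosed (D y) := fun y =>
    (isClosed_le continuous_const hω).inter
      (isClosed_le (continuous_fst.dist continuous_const) continuous_const)
  have hyU : ∀ y ∈ c, y ∈ U y := fun y hy => ⟨half_lt_self (c.pos hy), by simpa using hr⟩
  have hsub : ∀ y ∈ c, ∀ᶠ k in l, ∀ y1 ∈ f k, ∀ y2 ∈ f k, y1 ∈ D y → y2 ∈ D y → y1 = y2 := by
    intro y hy
    refine (hD (D y) (hDc y) ⟨ω y / 2, half_pos (c.pos hy), fun _ h => h.1⟩).2 ?_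
    intro y1 hy1 y2 hy2 h1 h2
    rw [hsep y hy y1 hy1 h1.2, hsep y hy y2 hy2 h2.2]
  let η : P × L → K → P × L := fun y k => if h : ∃ y' ∈ f k, y' ∈ D y then h.choose else y
  have hη : ∀ y k, (∃ y' ∈ f k, y' ∈ D y) → η y k ∈ f k ∧ η y k ∈ D y := by
    intro y k h
    simp only [η, dif_pos h]
    exact h.choose_spec
  have hev : ∀ y ∈ c, ∀ O, IsOpen O → y ∈ O → ∀ᶠ k in l, η y k ∈ f k ∧ η y k ∈ O := by
    intro y hy O hO' hyO
    filter_upwards [hO (O ∩ U y) (hO'.inter (hUo y)) ⟨y, hy, hyO, hyU y hy⟩, hsub y hy]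
      with k ⟨y', hy', h1, h2⟩ hk
    have := hη y k ⟨y', hy', hUD _ h2⟩
    refine ⟨this.1, ?_⟩
    rwa [hk _ this.1 y' hy' this.2 (hUD _ h2)]
  refine ⟨η, fun y hy => ⟨?_, ?_⟩, fun θ hθ => ?_⟩
  · rw [_root_.tendsto_nhds]
    intro O hO' hyO
    exact (hev y hy O hO' hyO).mono fun k h => h.2
  · exact (hev y hy univ isOpen_univ trivial).mono fun k h => h.1
  · have h1 := (hD ({y' | θ ≤ ω y'} \ ⋃ y ∈ (c : Set (P × L)), U y)
      ((isClosed_le continuous_const hω).sdiff (isOpen_biUnion fun y _ => hUo y))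
      ⟨θ, hθ, fun y h => h.1⟩).1
      (fun y hy h => h.2 (mem_biUnion hy (hyU y hy)))
    have h2 : ∀ᶠ k in l, ∀ y ∈ (c : Set (P × L)),
        ∀ y1 ∈ f k, ∀ y2 ∈ f k, y1 ∈ D y → y2 ∈ D y → y1 = y2 := by
      rw [eventually_all_finite c.finite]; exact hsub
    filter_upwards [h1, h2] with k hk1 hk2 y' hy' hθ'
    have : y' ∈ ⋃ y ∈ (c : Set (P × L)), U y := by
      by_contra h; exact hk1 y' hy' ⟨hθ', h⟩
    obtain ⟨y, hy, hyU'⟩ := mem_iUnion₂.1 this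
    have h := hη y k ⟨y', hy', hUD _ hyU'⟩
    exact ⟨y, hy, hk2 y hy _ hy' _ h.1 (hUD _ hyU') h.2⟩

variable {P' L' : Type*} [MetricSpace P'] [TopologicalSpace L'] {ω' : P' × L' → ℝ}

lemma tendsto_image (hω : Continuous ω) (hω' : Continuous ω') {K : Type*} {l : Filter K}
    {f : K → Conf ω} {c : Conf ω} (hf : Tendsto f l (𝓝 c)) {f' : K → Conf ω'} {c' : Conf ω'}
    (Φ : K → P × L → P' × L') (Φ₀ : P × L → P' × L') (D : K → P × L → Prop) (D₀ : P × L → Prop)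
    (hf' : ∀ᶠ k in l, ∀ y', y' ∈ f' k ↔ ∃ y ∈ f k, D k y ∧ Φ k y = y' ∧ 0 < ω' y')
    (hc' : ∀ y', y' ∈ c' ↔ ∃ y ∈ c, D₀ y ∧ Φ₀ y = y' ∧ 0 < ω' y')
    (hinj : ∀ y ∈ c, ∀ y' ∈ c, D₀ y → D₀ y' → Φ₀ y = Φ₀ y' → y = y')
    (h1 : ∀ y ∈ c, D₀ y → Tendsto (fun q : K × (P × L) => Φ q.1 q.2) (l ×ˢ 𝓝 y) (𝓝 (Φ₀ y)) ∧
      ∀ᶠ q in l ×ˢ 𝓝 y, D q.1 q.2)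
    (h2 : ∀ y ∈ c, ¬ D₀ y → ∀ θ > 0, ∀ᶠ q : K × (P × L) in l ×ˢ 𝓝 y, D q.1 q.2 →
      ω' (Φ q.1 q.2) < θ)
    (h3 : ∀ θ' > 0, ∃ θ > 0, ∀ᶠ k in l, ∀ y ∈ f k, D k y → θ' ≤ ω' (Φ k y) → θ ≤ ω y) :
    Tendsto f' l (𝓝 c') := by
  classical
  obtain ⟨η, hη, hcov⟩ := exists_sections hω hf
  have hpair : ∀ y ∈ c, Tendsto (fun k => (k, η y k)) l (l ×ˢ 𝓝 y) := fun y hy =>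
    tendsto_id.prodMk (hη y hy).1
  rcases isEmpty_or_nonempty (P × L) with hemp | hne
  · refine tendsto_of_sections (fun y' _ => y') (fun y' hy' => ?_) (fun θ _ => ?_)
    · obtain ⟨y, -⟩ := (hc' y').1 hy'
      exact isEmptyElim y
    · filter_upwards [hf'] with k hk y' hy'
      obtain ⟨y, -⟩ := (hk y').1 hy'
      exact isEmptyElim y
  choose! s hs using fun y' => (hc' y').1
  refine tendsto_of_sections (fun y' k => Φ k (η (s y') k)) ?_ ?_
  · intro y' hy'
    obtain ⟨hsc, hsD, hsΦ, hpos⟩ := hs y' hy'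
    have ht := (h1 _ hsc hsD).1.comp (hpair _ hsc)
    rw [hsΦ] at ht
    refine ⟨ht, ?_⟩
    filter_upwards [(hpair _ hsc).eventually (h1 _ hsc hsD).2, (hη _ hsc).2, hf',
      ((hω'.tendsto _).comp ht).eventually (lt_mem_nhds hpos)] with k hD hk hfk hp
    exact (hfk _).2 ⟨_, hk, hD, rfl, hp⟩
  · intro θ' hθ'
    obtain ⟨θ, hθ, h3⟩ := h3 θ' hθ'
    have : ∀ᶠ k in l, ∀ y ∈ (c : Set (P × L)), D k (η y k) → θ' ≤ ω' (Φ k (η y k)) →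
        D₀ y ∧ 0 < ω' (Φ₀ y) := by
      rw [eventually_all_finite c.finite]
      intro y hy
      by_cases hD : D₀ y
      · by_cases hp : 0 < ω' (Φ₀ y)
        · exact Eventually.of_forall fun k _ _ => ⟨hD, hp⟩
        · have ht := (hω'.tendsto _).comp ((h1 _ hy hD).1.comp (hpair _ hy))
          filter_upwards [ht.eventually (gt_mem_nhds (lt_of_le_of_lt (not_lt.1 hp) hθ'))]
            with k hk _ hk'
          exact absurd hk' (not_le.2 hk)
      · filter_upwards [(hpair _ hy).eventually (h2 y hy hD θ' hθ')] with k hk hD' hk'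
        exact absurd hk' (not_le.2 (hk hD'))
    filter_upwards [this, h3, hcov θ hθ, hf'] with k hk h3k hcovk hfk y' hy' hle
    obtain ⟨y, hy, hD, rfl, hp⟩ := (hfk _).1 hy'
    obtain ⟨y0, hy0, rfl⟩ := hcovk y hy (h3k y hy hD hle)
    obtain ⟨hD0, hp0⟩ := hk y0 hy0 hD hle
    have hmem : Φ₀ y0 ∈ c' := (hc' _).2 ⟨y0, hy0, hD0, rfl, hp0⟩
    refine ⟨_, hmem, ?_⟩
    obtain ⟨hsc, hsD, hsΦ, hpos⟩ := hs _ hmem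
    rw [hinj _ hsc _ hy0 hsD hD0 hsΦ]

/-- Unions of disjoint limits. -/
lemma tendsto_union (hω : Continuous ω) {K : Type*} {l : Filter K}
    {f f₁ f₂ : K → Conf ω} {c c₁ c₂ : Conf ω} (hf₁ : Tendsto f₁ l (𝓝 c₁))
    (hf₂ : Tendsto f₂ l (𝓝 c₂)) (hf : ∀ᶠ k in l, ∀ y, y ∈ f k ↔ y ∈ f₁ k ∨ y ∈ f₂ k)
    (hc : ∀ y, y ∈ c ↔ y ∈ c₁ ∨ y ∈ c₂) (hdisj : ∀ y ∈ c₁, y ∉ c₂) : Tendsto f l (𝓝 c) := by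
  classical
  obtain ⟨η₁, h₁, hcov₁⟩ := exists_sections hω hf₁
  obtain ⟨η₂, h₂, hcov₂⟩ := exists_sections hω hf₂
  refine tendsto_of_sections (fun y => if y ∈ c₁ then η₁ y else η₂ y) ?_ ?_
  · intro y hy
    by_cases hy1 : y ∈ c₁
    · simp only [if_pos hy1]
      refine ⟨(h₁ y hy1).1, ?_⟩
      filter_upwards [(h₁ y hy1).2, hf] with k hk hfk
      exact (hfk _).2 (Or.inl hk)
    · have hy2 := ((hc y).1 hy).resolve_left hy1
      simp only [if_neg hy1]
      refine ⟨(h₂ y hy2).1, ?_⟩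
      filter_upwards [(h₂ y hy2).2, hf] with k hk hfk
      exact (hfk _).2 (Or.inr hk)
  · intro θ hθ
    filter_upwards [hcov₁ θ hθ, hcov₂ θ hθ, hf] with k hk1 hk2 hfk y' hy' hle
    rcases (hfk _).1 hy' with h | h
    · obtain ⟨y, hy, rfl⟩ := hk1 _ h hle
      exact ⟨y, (hc _).2 (Or.inl hy), by simp [hy]⟩
    · obtain ⟨y, hy, rfl⟩ := hk2 _ h hle
      exact ⟨y, (hc _).2 (Or.inr hy), by rw [if_neg fun hy₁ => hdisj y hy₁ hy]⟩

/-- Configurations given by a finite list of moving points. -/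
lemma tendsto_list (hω : Continuous ω) {ι : Type*} [Finite ι] {K : Type*} {l : Filter K}
    {f : K → Conf ω} {c : Conf ω} {y : ι → K → P × L} {y₀ : ι → P × L}
    (hy : ∀ i, 0 < ω (y₀ i) → Tendsto (y i) l (𝓝 (y₀ i)))
    (hy' : ∀ i, ω (y₀ i) ≤ 0 → ∀ θ > 0, ∀ᶠ k in l, ω (y i k) < θ)
    (hinj : ∀ i j, 0 < ω (y₀ i) → 0 < ω (y₀ j) → y₀ i = y₀ j → i = j)
    (hf : ∀ᶠ k in l, ∀ z, z ∈ f k ↔ ∃ i, y i k = z ∧ 0 < ω z)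
    (hc : ∀ z, z ∈ c ↔ ∃ i, y₀ i = z ∧ 0 < ω z) : Tendsto f l (𝓝 c) := by
  classical
  rcases isEmpty_or_nonempty ι with hemp | hne
  · refine tendsto_of_sections (fun y' _ => y') (fun y' hy' => ?_) (fun θ _ => ?_)
    · obtain ⟨i, -⟩ := (hc y').1 hy'
      exact isEmptyElim i
    · filter_upwards [hf] with k hk y' hy'
      obtain ⟨i, -⟩ := (hk y').1 hy'
      exact isEmptyElim i
  choose! s hs using fun z => (hc z).1
  refine tendsto_of_sections (fun z k => y (s z) k) ?_ ?_
  · intro z hz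
    obtain ⟨h1, h2⟩ := hs z hz
    have ht := hy (s z) (by rwa [h1])
    rw [h1] at ht
    refine ⟨ht, ?_⟩
    filter_upwards [hf, ((hω.tendsto _).comp ht).eventually (lt_mem_nhds h2)] with k hfk hp
    exact (hfk _).2 ⟨_, rfl, hp⟩
  · intro θ hθ
    have : ∀ᶠ k in l, ∀ i, θ ≤ ω (y i k) → 0 < ω (y₀ i) := by
      rw [eventually_all]
      intro i
      by_cases hp : 0 < ω (y₀ i)
      · exact Eventually.of_forall fun _ _ => hp
      · filter_upwards [hy' i (not_lt.1 hp) θ hθ] with k hk h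
        exact absurd h (not_le.2 hk)
    filter_upwards [this, hf] with k hk hfk z hz hle
    obtain ⟨i, rfl, hp⟩ := (hfk _).1 hz
    have hmem : y₀ i ∈ c := (hc _).2 ⟨i, rfl, hk i hle⟩
    refine ⟨_, hmem, ?_⟩
    obtain ⟨h1, h2⟩ := hs _ hmem
    rw [hinj _ _ (by rw [h1]; exact h2) (hk i hle) h1]

end Top

end Conf

end Scan

/-! ### Cells and the homotopy extension property -/

namespace Scan

section Cells

open Classical in
lemma continuousOn_ite_of_isClosed {α β : Type*} [TopologicalSpace α] [TopologicalSpace β]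
    {S T U : Set α} {f g : α → β} {p : α → Prop} (hS : IsClosed S) (hT : IsClosed T)
    (hf : ContinuousOn f (S ∩ U)) (hg : ContinuousOn g (T ∩ U)) (hpS : ∀ x ∈ U, p x → x ∈ S)
    (hpT : ∀ x ∈ U, ¬ p x → x ∈ T) (hfg : ∀ x ∈ U, x ∈ S → x ∈ T → f x = g x) :
    ContinuousOn (fun x => if p x then f x else g x) U := by
  have hU : U = (S ∩ U) ∪ (T ∩ U) := by
    ext x
    constructor
    · intro hx
      by_cases h : p x
      · exact Or.inl ⟨hpS x hx h, hx⟩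
      · exact Or.inr ⟨hpT x hx h, hx⟩
    · rintro (h | h) <;> exact h.2
  intro x hx
  rw [hU]
  refine .union ?_ ?_
  · by_cases h : x ∈ S
    · refine (hf x ⟨h, hx⟩).congr (fun y hy => ?_) ?_
      · by_cases hp : p y
        · simp [hp]
        · simp [hp, hfg y hy.2 hy.1 (hpT y hy.2 hp)]
      · by_cases hp : p x
        · simp [hp]
        · simp [hp, hfg x hx h (hpT x hx hp)]
    · refine continuousWithinAt_of_notMem_closure fun h' => h ?_
      exact (closure_minimal inter_subset_left hS) h'
  · by_cases h : x ∈ T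
    · refine (hg x ⟨h, hx⟩).congr (fun y hy => ?_) ?_
      · by_cases hp : p y
        · simp [hp, hfg y hy.2 (hpS y hy.2 hp) hy.1]
        · simp [hp]
      · by_cases hp : p x
        · simp [hp, hfg x hx (hpS x hx hp) h]
        · simp [hp]
    · refine continuousWithinAt_of_notMem_closure fun h' => h ?_
      exact (closure_minimal inter_subset_left hT) h'

open Classical in
lemma continuousOn_ite_le {α β : Type*} [TopologicalSpace α] [TopologicalSpace β] {φ : α → ℝ}
    (hφ : Continuous φ) {r : ℝ} {U : Set α} {f g : α → β}
    (hf : ContinuousOn f {x | x ∈ U ∧ φ x ≤ r}) (hg : ContinuousOn g {x | x ∈ U ∧ r ≤ φ x})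
    (hfg : ∀ x ∈ U, φ x = r → f x = g x) :
    ContinuousOn (fun x => if φ x ≤ r then f x else g x) U :=
  continuousOn_ite_of_isClosed (S := {x : α | φ x ≤ r}) (T := {x : α | r ≤ φ x})
    (isClosed_le hφ continuous_const) (isClosed_le continuous_const hφ)
    (hf.mono fun _ h => ⟨h.2, h.1⟩) (hg.mono fun _ h => ⟨h.2, h.1⟩) (fun _ _ h => h)
    (fun _ _ h => (not_le.1 h).le) fun x hx h1 h2 => hfg x hx (le_antisymm h1 h2)

variable {V V' : Type} [TopologicalSpace V'] [TopologicalSpace V]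

/-- `(K, A)` is homeomorphic to a closed unit ball and its boundary sphere in the sup norm,
inside an ambient space homeomorphic to `ℝ^d`. -/
def IsCell (K A : Set V) : Prop :=
  ∃ (d : ℕ) (h : V ≃ₜ (Fin d → ℝ)), K = h ⁻¹' closedBall 0 1 ∧ A = h ⁻¹' sphere 0 1

lemma IsCell.isClosed {K A : Set V} (hK : IsCell K A) : IsClosed K := by
  obtain ⟨d, h, rfl, rfl⟩ := hK
  exact isClosed_closedBall.preimage h.continuous

lemma IsCell.isClosed_bdry {K A : Set V} (hK : IsCell K A) : IsClosed A := by
  obtain ⟨d, h, rfl, rfl⟩ := hK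
  exact isClosed_sphere.preimage h.continuous

lemma IsCell.subset {K A : Set V} (hK : IsCell K A) : A ⊆ K := by
  obtain ⟨d, h, rfl, rfl⟩ := hK
  exact preimage_mono sphere_subset_closedBall

lemma IsCell.prod {K A : Set V} {K' A' : Set V'} (hK : IsCell K A) (hK' : IsCell K' A') :
    IsCell (K ×ˢ K') (A ×ˢ K' ∪ K ×ˢ A') := by
  obtain ⟨d, h, rfl, rfl⟩ := hK
  obtain ⟨d', h', rfl, rfl⟩ := hK'
  refine ⟨d + d', (h.prodCongr h').trans (Fin.appendIsometry (α := ℝ) d d').toHomeomorph, ?_, ?_⟩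
  all_goals
    ext ⟨x, y⟩
    have hn : ‖Fin.appendIsometry (α := ℝ) d d' (h x, h' y)‖ = max ‖h x‖ ‖h' y‖ := by
      have h0 : Fin.appendIsometry (α := ℝ) d d' (0, 0) = 0 := by
        funext i
        refine Fin.addCases (fun i => ?_) (fun i => ?_) i
        · exact Fin.append_left (α := ℝ) 0 0 i
        · exact Fin.append_right (α := ℝ) 0 0 i
      have := (Fin.appendIsometry (α := ℝ) d d').dist_eq (h x, h' y) (0, 0)
      rw [h0, dist_zero_right] at this
      rw [this, Prod.dist_eq, dist_zero_right, dist_zero_right]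
    have hn' : ∀ r, (h.prodCongr h').trans (Fin.appendIsometry (α := ℝ) d d').toHomeomorph (x, y)
        ∈ closedBall 0 r ↔ max ‖h x‖ ‖h' y‖ ≤ r := by
      intro r; rw [← hn, mem_closedBall, dist_zero_right]; rfl
    have hn'' : ∀ r, (h.prodCongr h').trans (Fin.appendIsometry (α := ℝ) d d').toHomeomorph (x, y)
        ∈ sphere 0 r ↔ max ‖h x‖ ‖h' y‖ = r := by
      intro r; rw [← hn, mem_sphere, dist_zero_right]; rfl
    rw [mem_preimage]
    first
    | rw [hn', mem_prod, mem_preimage, mem_preimage, mem_closedBall, mem_closedBall,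
        dist_zero_right, dist_zero_right, max_le_iff]
    | rw [hn'', mem_union, mem_prod, mem_prod]
      simp only [mem_preimage, mem_closedBall, mem_sphere, dist_zero_right]
      symm
      constructor
      · intro hm
        rcases max_choice ‖h x‖ ‖h' y‖ with hc | hc
        · left; exact ⟨by rw [← hc, hm], by rw [← hm]; exact le_max_right _ _⟩
        · right; exact ⟨by rw [← hm]; exact le_max_left _ _, by rw [← hc, hm]⟩
      · rintro (⟨h1, h2⟩ | ⟨h1, h2⟩)
        · rw [h1]; exact max_eq_left h2
        · rw [h2]; exact max_eq_right h1

/-- The union of the faces of a box. -/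
def boxBdry {d : ℕ} (a b : Fin d → ℝ) : Set (Fin d → ℝ) :=
  {x | x ∈ Icc a b ∧ ∃ i, x i = a i ∨ x i = b i}

lemma isCell_box {d : ℕ} {a b : Fin d → ℝ} (hab : ∀ i, a i < b i) :
    IsCell (Icc a b) (boxBdry a b) := by
  have hpos : ∀ i, 0 < b i - a i := fun i => sub_pos.2 (hab i)
  let h : (Fin d → ℝ) ≃ₜ (Fin d → ℝ) :=
    { toFun := fun x i => (2 * x i - a i - b i) / (b i - a i)
      invFun := fun y i => (y i * (b i - a i) + a i + b i) / 2
      left_inv := fun x => by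
        funext i
        have := (hpos i).ne'
        field_simp; ring
      right_inv := fun x => by
        funext i
        have := (hpos i).ne'
        field_simp; ring
      continuous_toFun := by fun_prop
      continuous_invFun := by fun_prop }
  have hh : ∀ x i, h x i = (2 * x i - a i - b i) / (b i - a i) := fun x i => rfl
  have e1 : ∀ x i, |h x i| ≤ 1 ↔ a i ≤ x i ∧ x i ≤ b i := by
    intro x i
    rw [hh, abs_le, div_le_one (hpos i), le_div_iff₀ (hpos i)]
    constructor <;> rintro ⟨h1, h2⟩ <;> constructor <;> linarith
  have e2 : ∀ x i, |h x i| = 1 ↔ x i = a i ∨ x i = b i := by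
    intro x i
    rw [hh, abs_eq zero_le_one, div_eq_iff (hpos i).ne', div_eq_iff (hpos i).ne']
    constructor
    · rintro (h | h)
      · right; linarith
      · left; linarith
    · rintro (h | h)
      · right; linarith
      · left; linarith
  have e3 : ∀ x, x ∈ Icc a b ↔ ‖h x‖ ≤ 1 := by
    intro x
    rw [pi_norm_le_iff_of_nonneg zero_le_one]
    simp only [Real.norm_eq_abs, e1]
    exact ⟨fun h i => ⟨h.1 i, h.2 i⟩, fun h => ⟨fun i => (h i).1, fun i => (h i).2⟩⟩
  refine ⟨d, h, ?_, ?_⟩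
  · ext x; simp [e3 x]
  · ext x
    simp only [boxBdry, mem_ofPred_eq, mem_preimage, mem_sphere, dist_zero_right, e3]
    constructor
    · rintro ⟨h1, i, hi⟩
      refine le_antisymm h1 ?_
      rw [← (e2 x i).2 hi]
      exact norm_le_pi_norm (h x) i
    · intro hx
      refine ⟨hx.le, ?_⟩
      by_contra hcon
      push Not at hcon
      have : ‖h x‖ < 1 := by
        rw [pi_norm_lt_iff zero_lt_one]
        intro i
        have h1 : |h x i| ≤ 1 := by
          have := norm_le_pi_norm (h x) i; rw [hx] at this; exact this
        exact lt_of_le_of_ne h1 fun h2 => by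
          rcases (e2 x i).1 h2 with h3 | h3
          · exact (hcon i).1 h3
          · exact (hcon i).2 h3
      exact absurd hx this.ne

lemma isCell_ball (d : ℕ) : IsCell (closedBall (0 : Fin d → ℝ) 1) (sphere 0 1) :=
  ⟨d, Homeomorph.refl _, rfl, rfl⟩

lemma IsCell.preimage {K A : Set V} (hK : IsCell K A) (h : V' ≃ₜ V) :
    IsCell (h ⁻¹' K) (h ⁻¹' A) := by
  obtain ⟨d, h', rfl, rfl⟩ := hK
  exact ⟨d, h.trans h', rfl, rfl⟩

lemma isCell_Icc {p q : ℝ} (h : p < q) : IsCell (Icc p q) {p, q} := by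
  have := (isCell_box (d := 1) (a := fun _ => p) (b := fun _ => q) (fun _ => h)).preimage
    (Homeomorph.funUnique (Fin 1) ℝ).symm
  convert this using 1
  · ext x
    simp [Pi.le_def]
  · ext x
    simp only [mem_insert_iff, mem_singleton_iff, boxBdry, mem_preimage, mem_ofPred_eq, mem_Icc,
      Pi.le_def]
    simp
    rintro (rfl | rfl)
    · exact ⟨le_rfl, h.le⟩
    · exact ⟨h.le, le_rfl⟩

section HEP

variable {Z Z' : Type*} [TopologicalSpace Z'] [TopologicalSpace Z]

/-- The homotopy extension property of the pair `(K, A)`. -/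
lemma IsCell.hep {K A : Set V} (hK : IsCell K A) {b : V → Z} {H : V × ℝ → Z} {S : Set Z}
    (hb : ContinuousOn b K) (hH : ContinuousOn H (A ×ˢ Icc 0 1)) (h0 : ∀ x ∈ A, H (x, 0) = b x)
    (hbS : ∀ x ∈ K, b x ∈ S) (hHS : ∀ x ∈ A, ∀ t ∈ Icc (0 : ℝ) 1, H (x, t) ∈ S) :
    ∃ E : V × ℝ → Z, ContinuousOn E (K ×ˢ Icc 0 1) ∧ (∀ x ∈ K, E (x, 0) = b x) ∧
      (∀ x ∈ A, ∀ t ∈ Icc (0 : ℝ) 1, E (x, t) = H (x, t)) ∧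
      ∀ x ∈ K, ∀ t ∈ Icc (0 : ℝ) 1, E (x, t) ∈ S := by
  classical
  obtain ⟨d, h, rfl, rfl⟩ := hK
  let m : V × ℝ → ℝ := fun q => max 1 (‖h q.1‖ * (1 + q.2))
  have hm1 : ∀ q, 1 ≤ m q := fun q => le_max_left _ _
  have hmc : Continuous m := by
    have := h.continuous
    fun_prop
  let R : V × ℝ → V := fun q => h.symm (((1 + q.2) / m q) • h q.1)
  have hRc : ContinuousOn R univ := by
    have h1 := h.continuous
    have h2 : Continuous fun q : V × ℝ => (1 + q.2) / m q :=
      Continuous.div (by fun_prop) hmc fun q => (lt_of_lt_of_le one_pos (hm1 q)).ne'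
    exact (h.symm.continuous.comp (h2.smul (h1.comp continuous_fst))).continuousOn
  have hnorm : ∀ q : V × ℝ, 0 ≤ q.2 → ‖h (R q)‖ = ‖h q.1‖ * (1 + q.2) / m q := by
    intro q hq
    simp only [R, Homeomorph.apply_symm_apply, norm_smul, Real.norm_eq_abs]
    rw [abs_of_nonneg (div_nonneg (by linarith) (zero_le_one.trans (hm1 q)))]
    ring
  set T1 : Set (V × ℝ) := {q | ‖h q.1‖ * (1 + q.2) ≤ 1}
  set T2 : Set (V × ℝ) := {q | 1 ≤ ‖h q.1‖ * (1 + q.2)}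
  have hc0 : Continuous fun q : V × ℝ => ‖h q.1‖ * (1 + q.2) := by
    have := h.continuous
    fun_prop
  have hm_T1 : ∀ q ∈ T1, m q = 1 := fun q hq => max_eq_left hq
  have hm_T2 : ∀ q ∈ T2, m q = ‖h q.1‖ * (1 + q.2) := fun q hq => max_eq_right hq
  have hR1 : ∀ q ∈ T1, 0 ≤ q.2 → R q ∈ h ⁻¹' closedBall 0 1 := by
    intro q hq h2
    simp only [mem_preimage, mem_closedBall, dist_zero_right, hnorm q h2, hm_T1 q hq, div_one]
    exact hq
  have hR2 : ∀ q ∈ T2, 0 ≤ q.2 → R q ∈ h ⁻¹' sphere 0 1 := by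
    intro q hq h2
    simp only [mem_preimage, mem_sphere, dist_zero_right, hnorm q h2, hm_T2 q hq]
    refine div_self (ne_of_gt (lt_of_lt_of_le one_pos hq))
  have hmI : ∀ q ∈ (h ⁻¹' closedBall 0 1) ×ˢ Icc (0 : ℝ) 1, m q - 1 ∈ Icc (0 : ℝ) 1 := by
    rintro ⟨x, t⟩ ⟨hx, ht⟩
    have hx' : ‖h x‖ ≤ 1 := by simpa using hx
    refine ⟨by linarith [hm1 (x, t)], ?_⟩
    have : m (x, t) ≤ 2 := max_le (by norm_num) (by
      have := mul_le_mul hx' (show 1 + t ≤ 2 by linarith [ht.2]) (by linarith [ht.1]) zero_le_one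
      simpa using this)
    linarith
  refine ⟨fun q => if q ∈ T1 then b (R q) else H (R q, m q - 1), ?_, ?_, ?_, ?_⟩
  · refine continuousOn_ite_of_isClosed (S := T1) (T := T2)
      (isClosed_le hc0 continuous_const) (isClosed_le continuous_const hc0) ?_ ?_
      (fun x _ hx => hx)
      (fun x _ hx => show 1 ≤ ‖h x.1‖ * (1 + x.2) from (not_le.1 hx).le) ?_
    · exact hb.comp (hRc.mono (subset_univ _)) fun q hq => hR1 q hq.1 hq.2.2.1
    · refine hH.comp ((hRc.mono (subset_univ _)).prodMk
        ((hmc.sub continuous_const).continuousOn)) fun q hq => ?_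
      exact ⟨hR2 q hq.1 hq.2.2.1, hmI q hq.2⟩
    · intro q hq h1 h2
      rw [hm_T1 q h1, sub_self, h0 _ (hR2 q h2 hq.2.1)]
  · intro x hx
    have h1 : (x, (0 : ℝ)) ∈ T1 := by simpa [T1] using hx
    have : R (x, 0) = x := by simp [R, hm_T1 _ h1]
    simp only [if_pos h1, this]
  · intro x hx t ht
    have hx1 : ‖h x‖ = 1 := by simpa using hx
    have hm : m (x, t) = 1 + t := by
      simp only [m, hx1, one_mul]; exact max_eq_right (by linarith [ht.1])
    have hR : R (x, t) = x := by
      simp only [R, hm]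
      rw [div_self (by linarith [ht.1]), one_smul, Homeomorph.symm_apply_apply]
    by_cases h1 : (x, t) ∈ T1
    · have : t = 0 := by
        have : ‖h x‖ * (1 + t) ≤ 1 := h1
        rw [hx1] at this; linarith [ht.1]
      simp only [if_pos h1, hR]
      rw [this, h0 x hx]
    · simp only [if_neg h1, hR, hm, add_sub_cancel_left]
  · intro x hx t ht
    by_cases h1 : (x, t) ∈ T1
    · simp only [if_pos h1]
      exact hbS _ (hR1 _ h1 ht.1)
    · simp only [if_neg h1]
      exact hHS _ (hR2 _ (show 1 ≤ ‖h x‖ * (1 + t) from (not_le.1 h1).le) ht.1) _ (hmI _ ⟨hx, ht⟩)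

/-- Homotopies on `K` relative to `A` through maps with values in `S`. -/
def HRel (S : Set Z) (K A : Set V) (a b : V → Z) : Prop :=
  ∃ H : V × ℝ → Z, ContinuousOn H (K ×ˢ Icc 0 1) ∧ (∀ x ∈ K, H (x, 0) = a x) ∧
    (∀ x ∈ K, H (x, 1) = b x) ∧ (∀ x ∈ A, ∀ t ∈ Icc (0 : ℝ) 1, H (x, t) = a x) ∧
    ∀ x ∈ K, ∀ t ∈ Icc (0 : ℝ) 1, H (x, t) ∈ S

namespace HRel

variable {S : Set Z} {K A : Set V} {a b c : V → Z}

lemma refl_of (ha : ContinuousOn a K) (hS : ∀ x ∈ K, a x ∈ S) (hab : ∀ x ∈ K, a x = b x) :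
    HRel S K A a b :=
  ⟨fun q => a q.1, ha.comp continuousOn_fst fun _ hq => hq.1, fun _ _ => rfl, hab,
    fun _ _ _ _ => rfl, fun x hx _ _ => hS x hx⟩

lemma symm (h : HRel S K A a b) (hA : A ⊆ K) : HRel S K A b a := by
  obtain ⟨H, hH, h0, h1, hA', hS⟩ := h
  have hI : ∀ t ∈ Icc (0 : ℝ) 1, 1 - t ∈ Icc (0 : ℝ) 1 := fun t ht =>
    ⟨by linarith [ht.2], by linarith [ht.1]⟩
  refine ⟨fun q => H (q.1, 1 - q.2), ?_, fun x hx => by simpa using h1 x hx,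
    fun x hx => by simpa using h0 x hx, fun x hx t ht => ?_, fun x hx t ht => hS x hx _ (hI t ht)⟩
  · exact hH.comp (by fun_prop) fun q hq => ⟨hq.1, hI _ hq.2⟩
  · simp only
    rw [hA' x hx _ (hI t ht), ← h1 x (hA hx), hA' x hx 1 (by simp)]

lemma eq_on (h : HRel S K A a b) (hA : A ⊆ K) {x : V} (hx : x ∈ A) : a x = b x := by
  obtain ⟨H, hH, h0, h1, hA', hS⟩ := h
  rw [← h1 x (hA hx), hA' x hx 1 (by simp)]

lemma trans (h : HRel S K A a b) (h' : HRel S K A b c) (hA : A ⊆ K) : HRel S K A a c := by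
  classical
  have hab := fun x (hx : x ∈ A) => h.eq_on hA hx
  obtain ⟨H, hH, h0, h1, hA', hS⟩ := h
  obtain ⟨H', hH', h0', h1', hA'', hS'⟩ := h'
  have hI : ∀ t ∈ Icc (0 : ℝ) 1, t ≤ 1 / 2 → 2 * t ∈ Icc (0 : ℝ) 1 := fun t ht h =>
    ⟨by linarith [ht.1], by linarith⟩
  have hI' : ∀ t ∈ Icc (0 : ℝ) 1, 1 / 2 ≤ t → 2 * t - 1 ∈ Icc (0 : ℝ) 1 := fun t ht h =>
    ⟨by linarith, by linarith [ht.2]⟩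
  refine ⟨fun q => if q.2 ≤ 1 / 2 then H (q.1, 2 * q.2) else H' (q.1, 2 * q.2 - 1),
    ?_, ?_, ?_, ?_, ?_⟩
  · refine continuousOn_ite_le (r := 1 / 2) continuous_snd ?_ ?_ ?_
    · exact hH.comp (by fun_prop) fun q hq => ⟨hq.1.1, hI _ hq.1.2 hq.2⟩
    · exact hH'.comp (by fun_prop) fun q hq => ⟨hq.1.1, hI' _ hq.1.2 hq.2⟩
    · intro q hq this
      rw [this]; norm_num
      rw [h1 _ hq.1, h0' _ hq.1]
  · intro x hx
    simp [h0 x hx]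
  · intro x hx
    norm_num
    exact h1' x hx
  · intro x hx t ht
    by_cases h : t ≤ 1 / 2
    · simp only [if_pos h]; exact hA' x hx _ (hI t ht h)
    · simp only [if_neg h]; rw [hA'' x hx _ (hI' t ht (not_le.1 h).le), hab x hx]
  · intro x hx t ht
    by_cases h : t ≤ 1 / 2
    · simp only [if_pos h]; exact hS x hx _ (hI t ht h)
    · simp only [if_neg h]; exact hS' x hx _ (hI' t ht (not_le.1 h).le)

lemma map (h : HRel S K A a b) {f : Z → Z'} {S' : Set Z'} (hf : ContinuousOn f S)
    (hfS : ∀ z ∈ S, f z ∈ S') : HRel S' K A (f ∘ a) (f ∘ b) := by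
  obtain ⟨H, hH, h0, h1, hA', hS⟩ := h
  exact ⟨f ∘ H, hf.comp hH fun _ hq => hS _ hq.1 _ hq.2, fun x hx => by simp [h0 x hx],
    fun x hx => by simp [h1 x hx], fun x hx t ht => by simp [hA' x hx t ht],
    fun x hx t ht => hfS _ (hS x hx t ht)⟩

lemma congr {a' b' : V → Z} (h : HRel S K A a b) (hA : A ⊆ K) (ha : ∀ x ∈ K, a x = a' x)
    (hb : ∀ x ∈ K, b x = b' x) : HRel S K A a' b' := by
  obtain ⟨H, hH, h0, h1, hA', hS⟩ := h
  exact ⟨H, hH, fun x hx => by rw [h0 x hx, ha x hx], fun x hx => by rw [h1 x hx, hb x hx],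
    fun x hx t ht => by rw [hA' x hx t ht, ha x (hA hx)], hS⟩

lemma precomp {K' A' : Set V'} (h : HRel S K A a b) {φ : V' → V} (hφ : ContinuousOn φ K')
    (hK : MapsTo φ K' K) (hA : MapsTo φ A' A) : HRel S K' A' (a ∘ φ) (b ∘ φ) := by
  obtain ⟨H, hH, h0, h1, hA', hS⟩ := h
  refine ⟨fun q => H (φ q.1, q.2), hH.comp ?_ fun q hq => ⟨hK hq.1, hq.2⟩,
    fun x hx => h0 _ (hK hx), fun x hx => h1 _ (hK hx), fun x hx t ht => hA' _ (hA hx) t ht,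
    fun x hx t ht => hS _ (hK hx) t ht⟩
  exact (hφ.comp continuousOn_fst fun q hq => hq.1).prodMk continuousOn_snd

end HRel

set_option maxHeartbeats 1000000 in
/-- Two families agreeing on `A` with homotopic ends have homotopic beginnings. -/
lemma IsCell.hrel_of_ends {K A : Set V} (hK : IsCell K A) {S : Set Z} {U W : V × ℝ → Z}
    (hU : ContinuousOn U (K ×ˢ Icc 0 1)) (hW : ContinuousOn W (K ×ˢ Icc 0 1))
    (hUS : ∀ x ∈ K, ∀ t ∈ Icc (0 : ℝ) 1, U (x, t) ∈ S)
    (hWS : ∀ x ∈ K, ∀ t ∈ Icc (0 : ℝ) 1, W (x, t) ∈ S)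
    (hUW : ∀ x ∈ A, ∀ t ∈ Icc (0 : ℝ) 1, U (x, t) = W (x, t))
    (h : HRel S K A (fun x => U (x, 1)) (fun x => W (x, 1))) :
    HRel S K A (fun x => U (x, 0)) (fun x => W (x, 0)) := by
  classical
  have hAK := hK.subset
  obtain ⟨G, hG, hG0, hG1, hGA, hGS⟩ := h
  -- the concatenation, parametrised by `[-1, 1]`
  let D1 : V × ℝ → Z := fun q => if q.2 ≤ 1 / 2 then G (q.1, q.2 + 1 / 2) else W (q.1, 2 - 2 * q.2)
  let D : V × ℝ → Z := fun q => if q.2 ≤ -1 / 2 then U (q.1, 2 * q.2 + 2) else D1 q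
  have hD1c : ContinuousOn D1 (K ×ˢ Icc (-1 / 2) 1) := by
    refine continuousOn_ite_le (r := 1 / 2) continuous_snd ?_ ?_ ?_
    · refine hG.comp (by fun_prop) fun q hq => ⟨hq.1.1, ?_⟩
      have h1 : q.2 ≤ 1 / 2 := hq.2
      exact ⟨by linarith [hq.1.2.1, hq.1.2.2], by linarith [hq.1.2.1, hq.1.2.2]⟩
    · refine hW.comp (by fun_prop) fun q hq => ⟨hq.1.1, ?_⟩
      have h1 : 1 / 2 ≤ q.2 := hq.2
      exact ⟨by linarith [hq.1.2.1, hq.1.2.2], by linarith [hq.1.2.1, hq.1.2.2]⟩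
    · intro q hq this
      rw [this]; norm_num
      exact hG1 _ hq.1
  have hDc : ContinuousOn D (K ×ˢ Icc (-1) 1) := by
    refine continuousOn_ite_le (r := -1 / 2) continuous_snd ?_ ?_ ?_
    · refine hU.comp (by fun_prop) fun q hq => ⟨hq.1.1, ?_⟩
      have h1 : q.2 ≤ -1 / 2 := hq.2
      exact ⟨by linarith [hq.1.2.1, hq.1.2.2], by linarith [hq.1.2.1, hq.1.2.2]⟩
    · refine hD1c.mono fun q hq => ⟨hq.1.1, hq.2, hq.1.2.2⟩
    · intro q hq this
      have h3 : ((-1 : ℝ) / 2) ≤ 1 / 2 := by norm_num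
      simp only [D1, this, if_pos h3]
      norm_num
      exact (hG0 _ hq.1).symm
  have hDS : ∀ x ∈ K, ∀ t ∈ Icc (-1 : ℝ) 1, D (x, t) ∈ S := by
    intro x hx t ht
    simp only [D, D1]
    split_ifs with h1 h2
    · exact hUS x hx _ ⟨by linarith [ht.1], by linarith⟩
    · exact hGS x hx _ ⟨by linarith, by linarith⟩
    · exact hWS x hx _ ⟨by linarith [ht.2], by linarith⟩
  have hDA : ∀ x ∈ A, ∀ t ∈ Icc (0 : ℝ) 1, D (x, -t) = D (x, t) := by
    intro x hx t ht
    have hGc : ∀ s ∈ Icc (0 : ℝ) 1, G (x, s) = U (x, 1) := fun s hs => hGA x hx s hs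
    have h0 : ¬ t ≤ -1 / 2 := by linarith [ht.1]
    simp only [D, D1, if_neg h0]
    by_cases h : t ≤ 1 / 2
    · have h1 : -t ≤ 1 / 2 := by linarith [ht.1]
      rw [if_pos h, if_pos h1, hGc _ ⟨by linarith [ht.1], by linarith⟩]
      by_cases h2 : -t ≤ -1 / 2
      · have : t = 1 / 2 := by linarith
        rw [if_pos h2, this]; norm_num
        exact (hGc 1 (by simp)).symm
      · rw [if_neg h2, hGc _ ⟨by linarith [ht.1], by linarith [ht.1]⟩]
    · have h1 : -t ≤ -1 / 2 := by linarith
      rw [if_neg h, if_pos h1, ← hUW x hx _ ⟨by linarith [ht.2], by linarith⟩]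
      congr 2; ring
  have hDneg : ∀ x ∈ K, D (x, -1) = U (x, 0) := by
    intro x hx
    have : (-1 : ℝ) ≤ -1 / 2 := by norm_num
    simp only [D, if_pos this]; norm_num
  have hDpos : ∀ x ∈ K, D (x, 1) = W (x, 0) := by
    intro x hx
    have : ¬ (1 : ℝ) ≤ -1 / 2 := by norm_num
    have h2 : ¬ (1 : ℝ) ≤ 1 / 2 := by norm_num
    simp only [D, D1, if_neg this, if_neg h2]; norm_num
  -- contract the palindrome over `A`
  let E : (V × ℝ) × ℝ → Z := fun q =>
    if q.1.1 ∈ A then D (q.1.1, max |q.1.2| q.2) else D q.1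
  have hcell := hK.prod (isCell_Icc (show (-1 : ℝ) < 1 by norm_num))
  have hmax : ∀ t ∈ Icc (-1 : ℝ) 1, ∀ s ∈ Icc (0 : ℝ) 1, max |t| s ∈ Icc (-1 : ℝ) 1 := by
    intro t ht s hs
    exact ⟨le_trans (by linarith [abs_nonneg t]) (le_max_left _ _), max_le (abs_le.2 ht) hs.2⟩
  have hEE : ∀ x ∈ A, ∀ t, (t = -1 ∨ t = 1) → ∀ s ∈ Icc (0 : ℝ) 1,
      D (x, max |t| s) = D (x, t) := by
    intro x hx t ht s hs
    have hD1 := hDA x hx 1 (by simp)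
    rcases ht with rfl | rfl
    · rw [abs_neg, abs_one, max_eq_left hs.2, hD1]
    · rw [abs_one, max_eq_left hs.2]
  have hEc : ContinuousOn E ((A ×ˢ Icc (-1 : ℝ) 1 ∪ K ×ˢ {-1, 1}) ×ˢ Icc 0 1) := by
    refine continuousOn_ite_of_isClosed (S := {q : (V × ℝ) × ℝ | q.1.1 ∈ A})
      (T := {q : (V × ℝ) × ℝ | q.1.2 = -1 ∨ q.1.2 = 1})
      (hK.isClosed_bdry.preimage (continuous_fst.comp continuous_fst))
      ((isClosed_eq (by fun_prop) continuous_const).union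
        (isClosed_eq (by fun_prop) continuous_const)) ?_ ?_ (fun x _ hx => hx) ?_ ?_
    · refine hDc.comp (by fun_prop) ?_
      rintro ⟨⟨x, t⟩, s⟩ ⟨hx, hxt, hs⟩
      have ht : t ∈ Icc (-1 : ℝ) 1 := by
        rcases hxt with hxt | hxt
        · exact hxt.2
        · rcases hxt.2 with h | h <;> simp_all
      exact ⟨hAK hx, hmax t ht s hs⟩
    · refine hDc.comp continuousOn_fst ?_
      rintro ⟨⟨x, t⟩, s⟩ ⟨hx, hxt, hs⟩
      rcases hxt with hxt | hxt
      · exact ⟨hAK hxt.1, hxt.2⟩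
      · refine ⟨hxt.1, ?_⟩
        rcases hxt.2 with h | h <;> simp_all
    · rintro ⟨⟨x, t⟩, s⟩ ⟨hxt, hs⟩ hx
      rcases hxt with hxt | hxt
      · exact absurd hxt.1 hx
      · exact hxt.2
    · rintro ⟨⟨x, t⟩, s⟩ ⟨hxt, hs⟩ hx ht
      exact hEE x hx t ht s hs
  obtain ⟨F, hFc, hF0, hFA, hFS⟩ := hcell.hep (S := S) hDc hEc (by
      rintro ⟨x, t⟩ hxt
      simp only [E]
      split_ifs with hx
      · have ht : t ∈ Icc (-1 : ℝ) 1 := by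
          rcases hxt with hxt | hxt
          · exact hxt.2
          · rcases hxt.2 with h | h <;> simp_all
        rw [max_eq_left (abs_nonneg t)]
        rcases abs_cases t with ⟨h1, h2⟩ | ⟨h1, h2⟩
        · rw [h1]
        · rw [h1]
          have := hDA x hx (-t) ⟨by linarith, by linarith [ht.1]⟩
          rw [neg_neg] at this; exact this.symm
      · rfl) (fun q hq => hDS _ hq.1 _ hq.2) (by
      rintro ⟨x, t⟩ hxt s hs
      simp only [E]
      have hx : x ∈ K ∧ t ∈ Icc (-1 : ℝ) 1 := by
        rcases hxt with hxt | hxt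
        · exact ⟨hAK hxt.1, hxt.2⟩
        · refine ⟨hxt.1, ?_⟩
          rcases hxt.2 with h | h <;> simp_all
      split_ifs with hxA
      · exact hDS _ hx.1 _ (hmax t hx.2 s hs)
      · exact hDS _ hx.1 _ hx.2)
  have h1I : (1 : ℝ) ∈ Icc (0 : ℝ) 1 := by simp
  have hI : ∀ t ∈ Icc (0 : ℝ) 1, 2 * t - 1 ∈ Icc (-1 : ℝ) 1 := fun t ht =>
    ⟨by linarith [ht.1], by linarith [ht.2]⟩
  have hUA : ∀ x ∈ A, D (x, 1) = U (x, 0) := fun x hx => by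
    rw [← hDA x hx 1 (by simp), hDneg x (hAK hx)]
  refine ⟨fun q => F ((q.1, 2 * q.2 - 1), 1), ?_, ?_, ?_, ?_, ?_⟩
  · exact hFc.comp (by fun_prop) fun q hq => ⟨⟨hq.1, hI _ hq.2⟩, h1I⟩
  · intro x hx
    have : ((x, (2 : ℝ) * 0 - 1) : V × ℝ) = (x, -1) := by norm_num
    simp only [this]
    rw [hFA (x, -1) (Or.inr ⟨hx, by simp⟩) 1 h1I]
    simp only [E]
    split_ifs with hxA
    · rw [hEE x hxA _ (Or.inl rfl) 1 h1I, hDneg x hx]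
    · exact hDneg x hx
  · intro x hx
    have : ((x, (2 : ℝ) * 1 - 1) : V × ℝ) = (x, 1) := by norm_num
    simp only [this]
    rw [hFA (x, 1) (Or.inr ⟨hx, by simp⟩) 1 h1I]
    simp only [E]
    split_ifs with hxA
    · rw [hEE x hxA _ (Or.inr rfl) 1 h1I, hDpos x hx]
    · exact hDpos x hx
  · intro x hx t ht
    simp only
    rw [hFA (x, 2 * t - 1) (Or.inl ⟨hx, hI t ht⟩) 1 h1I]
    simp only [E, if_pos hx]
    rw [max_eq_right (abs_le.2 (hI t ht)), hUA x hx]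
  · intro x hx t ht
    exact hFS _ ⟨hx, hI t ht⟩ 1 h1I

/-- Any two maps into a contractible space agreeing on `A` are homotopic relative to `A`. -/
lemma IsCell.hrel_of_contractible {K A : Set V} (hK : IsCell K A) {S : Set Z} {h : Z × ℝ → Z}
    {z₀ : Z} (hc : ContinuousOn h (S ×ˢ Icc 0 1)) (h0 : ∀ z ∈ S, h (z, 0) = z)
    (h1 : ∀ z ∈ S, h (z, 1) = z₀) (hS : ∀ z ∈ S, ∀ t ∈ Icc (0 : ℝ) 1, h (z, t) ∈ S)
    {a b : V → Z} (ha : ContinuousOn a K)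
    (hb : ContinuousOn b K) (haS : ∀ x ∈ K, a x ∈ S) (hbS : ∀ x ∈ K, b x ∈ S)
    (hab : ∀ x ∈ A, a x = b x) : HRel S K A a b := by
  have hcont : ∀ {a : V → Z}, ContinuousOn a K → (∀ x ∈ K, a x ∈ S) →
      ContinuousOn (fun q : V × ℝ => h (a q.1, q.2)) (K ×ˢ Icc 0 1) := fun ha haS =>
    hc.comp ((ha.comp continuousOn_fst fun q hq => hq.1).prodMk continuousOn_snd)
      fun q hq => ⟨haS _ hq.1, hq.2⟩
  have h1I : (1 : ℝ) ∈ Icc (0 : ℝ) 1 := by simp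
  refine (hK.hrel_of_ends (hcont ha haS) (hcont hb hbS) (fun x hx t ht => hS _ (haS x hx) t ht)
    (fun x hx t ht => hS _ (hbS x hx) t ht) (fun x hx t ht => by simp only [hab x hx])
    (HRel.refl_of ?_ (fun x hx => hS _ (haS x hx) 1 h1I) ?_)).congr hK.subset
      (fun x hx => h0 _ (haS x hx)) (fun x hx => h0 _ (hbS x hx))
  · exact (continuousOn_const (c := z₀)).congr fun x hx => h1 _ (haS x hx)
  · intro x hx; simp only [h1 _ (haS x hx), h1 _ (hbS x hx)]

/-- Relative lifting up to homotopy along `f` for all cells. -/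
def WEq (f : Z → Z') : Prop :=
  ∀ (V : Type) [TopologicalSpace V] (K A : Set V), IsCell K A → ∀ c : V → Z, ContinuousOn c A →
    ∀ g : V → Z', ContinuousOn g K → (∀ x ∈ A, f (c x) = g x) →
      ∃ c' : V → Z, ContinuousOn c' K ∧ (∀ x ∈ A, c' x = c x) ∧ HRel univ K A (f ∘ c') g

lemma WEq.of_homotopic_id {f : Z → Z} {h : Z × ℝ → Z} (hc : ContinuousOn h (univ ×ˢ Icc 0 1))
    (h0 : ∀ z, h (z, 0) = z) (h1 : ∀ z, h (z, 1) = f z) : WEq f := by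
  intro V _ K A hK c hcA g hg hfc
  have hI : ∀ t ∈ Icc (0 : ℝ) 1, 1 - t ∈ Icc (0 : ℝ) 1 := fun t ht =>
    ⟨by linarith [ht.2], by linarith [ht.1]⟩
  obtain ⟨E, hE, hE0, hEA, -⟩ := hK.hep (S := univ) (H := fun q => h (c q.1, 1 - q.2)) hg
    (hc.comp ((hcA.comp continuousOn_fst fun q hq => hq.1).prodMk (by fun_prop))
      fun q hq => ⟨trivial, hI _ hq.2⟩)
    (fun x hx => by simp [h1, hfc x hx]) (fun _ _ => trivial) (fun _ _ _ _ => trivial)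
  have hc' : ContinuousOn (fun x => E (x, 1)) K :=
    hE.comp (by fun_prop) fun x hx => ⟨hx, by simp⟩
  refine ⟨fun x => E (x, 1), hc', fun x hx => ?_, ?_⟩
  · simp only; rw [hEA x hx 1 (by simp)]; simp [h0]
  · refine (hK.hrel_of_ends (S := univ) (U := fun q => h (E (q.1, 1), 1 - q.2)) (W := E) ?_ hE
      (fun _ _ _ _ => trivial) (fun _ _ _ _ => trivial) ?_ ?_).congr hK.subset ?_ ?_
    · exact hc.comp ((hc'.comp continuousOn_fst fun q hq => hq.1).prodMk (by fun_prop))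
        fun q hq => ⟨trivial, hI _ hq.2⟩
    · intro x hx t ht
      simp only
      rw [hEA x hx t ht, hEA x hx 1 (by simp)]; simp [h0]
    · refine HRel.refl_of ?_ (fun _ _ => trivial) ?_
      · exact hc'.congr fun x hx => by simp [h0]
      · intro x hx; simp [h0]
    · intro x hx; simp [h1]
    · intro x hx; exact hE0 x hx

lemma WEq.hrel_of_comp {f : Z → Z'} (hf : WEq f) {K A : Set V} (hK : IsCell K A) {a b : V → Z}
    (ha : ContinuousOn a K) (hb : ContinuousOn b K) (hab : ∀ x ∈ A, a x = b x)
    (h : HRel univ K A (f ∘ a) (f ∘ b)) : HRel univ K A a b := by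
  classical
  have hAK := hK.subset
  obtain ⟨H, hH, hH0, hH1, hHA, -⟩ := h
  have hcell := hK.prod (isCell_Icc (show (0 : ℝ) < 1 by norm_num))
  have hbd : ∀ q ∈ (A ×ˢ Icc (0 : ℝ) 1 ∪ K ×ˢ {0, 1}), q.1 ∈ K ∧ q.2 ∈ Icc (0 : ℝ) 1 ∧
      (q.1 ∈ A ∨ q.2 = 0 ∨ q.2 = 1) := by
    rintro ⟨x, t⟩ (⟨h1, h2⟩ | ⟨h1, h2 | h2⟩)
    · exact ⟨hAK h1, h2, Or.inl h1⟩
    · simp only at h2; subst h2; exact ⟨h1, by simp, by simp⟩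
    · simp only [mem_singleton_iff] at h2; subst h2; exact ⟨h1, by simp, by simp⟩
  obtain ⟨c', hc', hc'A, -⟩ := hf (V × ℝ) _ _ hcell (fun q => if q.2 ≤ 1 / 2 then a q.1 else b q.1)
    (by
      refine continuousOn_ite_le (r := 1 / 2) continuous_snd ?_ ?_ ?_
      · exact ha.comp continuousOn_fst fun q hq => (hbd q hq.1).1
      · exact hb.comp continuousOn_fst fun q hq => (hbd q hq.1).1
      · intro q hq h3
        rcases (hbd q hq).2.2 with h | h | h
        · exact hab _ h
        · rw [h] at h3; norm_num at h3
        · rw [h] at h3; norm_num at h3) H hH (by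
      rintro ⟨x, t⟩ hq
      obtain ⟨h1, h2, h3⟩ := hbd _ hq
      simp only at h1 h2 h3 ⊢
      rcases h3 with h3 | rfl | rfl
      · rw [hHA x h3 t h2, ← hab x h3, ite_self]; rfl
      · rw [hH0 x h1]; norm_num
      · rw [hH1 x h1]; norm_num)
  refine ⟨c', hc', fun x hx => ?_, fun x hx => ?_, fun x hx t ht => ?_, fun _ _ _ _ => trivial⟩
  · rw [hc'A (x, 0) (Or.inr ⟨hx, by simp⟩)]; norm_num
  · rw [hc'A (x, 1) (Or.inr ⟨hx, by simp⟩)]; norm_num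
  · rw [hc'A (x, t) (Or.inl ⟨hx, ht⟩)]; simp [hab x hx]

lemma WEq.of_comp {f : Z → Z'} {g : Z' → Z} (hf : Continuous f) (hg : Continuous g)
    (hgf : WEq (g ∘ f)) (hfg : WEq (f ∘ g)) : WEq f := by
  intro V _ K A hK c hcA k hk hfc
  obtain ⟨c', hc', hcA', h⟩ := hgf V K A hK c hcA (g ∘ k) (hg.comp_continuousOn hk)
    (fun x hx => by simp [hfc x hx])
  refine ⟨c', hc', hcA', ?_⟩
  refine hfg.hrel_of_comp hK (hf.comp_continuousOn hc') hk (fun x hx => ?_) ?_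
  · simp [hcA' x hx, hfc x hx]
  · exact h.map hf.continuousOn fun _ _ => trivial

end HEP

end Cells

end Scan

namespace Scan

open Filter

namespace Conf

section Constructors

variable {P L P' L' : Type*}

/-- The distinct visible points of `F` stay distinct. -/
def VisInj (ω' : P' × L' → ℝ) (F : P × L → P' × L') : Prop :=
  ∀ y y', 0 < ω' (F y) → 0 < ω' (F y') → (F y).1 = (F y').1 → y.1 = y'.1

open Classical in
/-- The visible part of the image of a configuration. -/
def map {ω : P × L → ℝ} (ω' : P' × L' → ℝ) (F : P × L → P' × L') (c : Conf ω) : Conf ω' :=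
  if h : VisInj ω' F then
    mk {y' | ∃ y ∈ c, F y = y' ∧ 0 < ω' y'}
      ((c.finite.image F).subset (by rintro _ ⟨y, hy, rfl, -⟩; exact ⟨y, hy, rfl⟩))
      (by
        rintro _ ⟨y, hy, rfl, h1⟩ _ ⟨y', hy', rfl, h1'⟩ heq
        rw [c.eq_of_fst hy hy' (h y y' h1 h1' heq)])
      (by rintro _ ⟨y, hy, rfl, h1⟩; exact h1)
  else ∅

lemma mem_map {ω : P × L → ℝ} {ω' : P' × L' → ℝ} {F : P × L → P' × L'} (h : VisInj ω' F)
    {c : Conf ω} {y' : P' × L'} : y' ∈ map ω' F c ↔ ∃ y ∈ c, F y = y' ∧ 0 < ω' y' := by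
  rw [map, dif_pos h]; rfl

/-- The visible points of a configuration in a region `R`. -/
def filter {ω : P × L → ℝ} (ω' : P × L → ℝ) (R : Set (P × L)) (c : Conf ω) : Conf ω' :=
  mk {y | y ∈ c ∧ y ∈ R ∧ 0 < ω' y} (c.finite.subset fun _ h => h.1)
    (c.injOn.mono fun _ h => h.1) fun _ h => h.2.2

@[simp] lemma mem_filter {ω ω' : P × L → ℝ} {R : Set (P × L)} {c : Conf ω} {y : P × L} :
    y ∈ filter ω' R c ↔ y ∈ c ∧ y ∈ R ∧ 0 < ω' y := Iff.rfl

variable {ω ω₁ ω₂ ω' : P × L → ℝ}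

/-- The union of the part of `c₁` on which `s < b` and of the part of `c₂` on which `b < s`. -/
def glue (ω' : P × L → ℝ) (s : P → ℝ) (b : ℝ) (c₁ : Conf ω₁) (c₂ : Conf ω₂) : Conf ω' :=
  mk {y | (y ∈ c₁ ∧ s y.1 < b ∨ y ∈ c₂ ∧ b < s y.1) ∧ 0 < ω' y}
    ((c₁.finite.union c₂.finite).subset fun y h => h.1.imp And.left And.left)
    (by
      rintro y ⟨h1 | h1, -⟩ y' ⟨h2 | h2, -⟩ h
      · exact c₁.eq_of_fst h1.1 h2.1 h
      · exact absurd (h1.2.trans h2.2) (by rw [h]; exact lt_irrefl _)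
      · exact absurd (h2.2.trans h1.2) (by rw [h]; exact lt_irrefl _)
      · exact c₂.eq_of_fst h1.1 h2.1 h) fun _ h => h.2

@[simp] lemma mem_glue {s : P → ℝ} {b : ℝ} {c₁ : Conf ω₁} {c₂ : Conf ω₂} {y : P × L} :
    y ∈ glue ω' s b c₁ c₂ ↔ (y ∈ c₁ ∧ s y.1 < b ∨ y ∈ c₂ ∧ b < s y.1) ∧ 0 < ω' y := Iff.rfl

end Constructors

section Continuity

variable {P L : Type*} [MetricSpace P] [TopologicalSpace L] {ω ω₁ ω₂ : P × L → ℝ}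
  {P' L' : Type*} [MetricSpace P'] [TopologicalSpace L'] {ω' : P' × L' → ℝ}
  {X : Type*} [TopologicalSpace X] {U : Set X}

lemma tendsto_map (hω : Continuous ω) (hω' : Continuous ω') {K : Type*} {l : Filter K}
    {f : K → Conf ω} {c : Conf ω} (hf : Tendsto f l (𝓝 c)) {f' : K → Conf ω'} {c' : Conf ω'}
    (Φ : K → P × L → P' × L') (Φ₀ : P × L → P' × L')
    (hf' : ∀ᶠ k in l, ∀ y', y' ∈ f' k ↔ ∃ y ∈ f k, Φ k y = y' ∧ 0 < ω' y')
    (hc' : ∀ y', y' ∈ c' ↔ ∃ y ∈ c, Φ₀ y = y' ∧ 0 < ω' y') (hinj : VisInj ω' Φ₀)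
    (h1 : ∀ y ∈ c, Tendsto (fun q : K × (P × L) => Φ q.1 q.2) (l ×ˢ 𝓝 y) (𝓝 (Φ₀ y)))
    (h3 : ∀ θ' > 0, ∃ θ > 0, ∀ᶠ k in l, ∀ y ∈ f k, θ' ≤ ω' (Φ k y) → θ ≤ ω y) :
    Tendsto f' l (𝓝 c') := by
  refine tendsto_image hω hω' hf Φ Φ₀ (fun _ _ => True) (fun y => 0 < ω' (Φ₀ y))
    (by simpa using hf') ?_ ?_ ?_ ?_ (by simpa using h3)
  · intro y'
    rw [hc']
    constructor
    · rintro ⟨y, hy, rfl, h⟩; exact ⟨y, hy, h, rfl, h⟩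
    · rintro ⟨y, hy, -, rfl, h⟩; exact ⟨y, hy, rfl, h⟩
  · intro y hy y' hy' hp hp' h
    exact c.eq_of_fst hy hy' (hinj y y' hp hp' (by rw [h]))
  · intro y hy _
    exact ⟨h1 y hy, Eventually.of_forall fun _ => trivial⟩
  · intro y hy hn θ hθ
    filter_upwards [((hω'.tendsto _).comp (h1 y hy)).eventually
      (gt_mem_nhds (lt_of_le_of_lt (not_lt.1 hn) hθ))] with q hq _
    exact hq

lemma continuousOn_map (hω : Continuous ω) (hω' : Continuous ω') {f : X → Conf ω}
    (hf : ContinuousOn f U) {Φ : X → P × L → P' × L'}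
    (hΦ : ContinuousOn (fun q : X × (P × L) => Φ q.1 q.2) (U ×ˢ univ))
    (hinj : ∀ x ∈ U, VisInj ω' (Φ x))
    (h3 : ∀ θ' > 0, ∃ θ > 0, ∀ x ∈ U, ∀ y ∈ f x, θ' ≤ ω' (Φ x y) → θ ≤ ω y) :
    ContinuousOn (fun x => map ω' (Φ x) (f x)) U := by
  intro x hx
  refine tendsto_map hω hω' (hf x hx) Φ (Φ x) ?_ (fun y' => mem_map (hinj x hx)) (hinj x hx) ?_ ?_
  · filter_upwards [self_mem_nhdsWithin] with k hk y'
    exact mem_map (hinj k hk)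
  · intro y hy
    have := hΦ (x, y) ⟨hx, trivial⟩
    rwa [ContinuousWithinAt, nhdsWithin_prod_eq, nhdsWithin_univ] at this
  · intro θ' hθ'
    obtain ⟨θ, hθ, h⟩ := h3 θ' hθ'
    refine ⟨θ, hθ, ?_⟩
    filter_upwards [self_mem_nhdsWithin] with k hk y hy hle
    exact h k hk y hy hle

lemma continuousOn_filter (hω₁ : Continuous ω₁) (hω₂ : Continuous ω₂) {f : X → Conf ω₁}
    (hf : ContinuousOn f U) {R : Set (P × L)}
    (hR : ∀ x ∈ U, ∀ y ∈ f x, R ∈ 𝓝 y ∨ Rᶜ ∈ 𝓝 y)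
    (h3 : ∀ θ' > 0, ∃ θ > 0, ∀ y ∈ R, θ' ≤ ω₂ y → θ ≤ ω₁ y) :
    ContinuousOn (fun x => filter ω₂ R (f x)) U := by
  intro x hx
  refine tendsto_image hω₁ hω₂ (hf x hx) (fun _ y => y) (fun y => y) (fun _ y => y ∈ R)
    (fun y => y ∈ R) (Eventually.of_forall fun k y' => ?_) (fun y' => ?_) (fun _ _ _ _ _ _ h => h)
    ?_ ?_ ?_
  · simp
  · simp
  · intro y hy hyR
    refine ⟨tendsto_snd, tendsto_snd.eventually ?_⟩
    rcases hR x hx y hy with h | h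
    · exact h
    · exact absurd hyR (mem_of_mem_nhds h)
  · intro y hy hyR θ hθ
    rcases hR x hx y hy with h | h
    · exact absurd (mem_of_mem_nhds h) hyR
    · filter_upwards [tendsto_snd.eventually h] with q hq hq'
      exact absurd hq' hq
  · intro θ' hθ'
    obtain ⟨θ, hθ, h⟩ := h3 θ' hθ'
    exact ⟨θ, hθ, Eventually.of_forall fun k y _ hy => h y hy⟩

variable {ω₃ : P × L → ℝ}

lemma continuousOn_glue (hω₁ : Continuous ω₁) (hω₂ : Continuous ω₂) (hω₃ : Continuous ω₃)
    {s : P → ℝ} (hs : Continuous s) {b : ℝ} {f : X → Conf ω₁} {g : X → Conf ω₂}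
    (hf : ContinuousOn f U) (hg : ContinuousOn g U) (hfb : ∀ x ∈ U, ∀ y ∈ f x, s y.1 ≠ b)
    (hgb : ∀ x ∈ U, ∀ y ∈ g x, s y.1 ≠ b)
    (h3 : ∀ θ' > 0, ∃ θ > 0, ∀ y : P × L, s y.1 < b → θ' ≤ ω₃ y → θ ≤ ω₁ y)
    (h3' : ∀ θ' > 0, ∃ θ > 0, ∀ y : P × L, b < s y.1 → θ' ≤ ω₃ y → θ ≤ ω₂ y) :
    ContinuousOn (fun x => glue ω₃ s b (f x) (g x)) U := by
  have hs' : Continuous fun y : P × L => s y.1 := hs.comp continuous_fst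
  have h1 : ContinuousOn (fun x => filter ω₃ {y | s y.1 < b} (f x)) U := by
    refine continuousOn_filter hω₁ hω₃ hf (fun x hx y hy => ?_) h3
    rcases lt_or_gt_of_ne (hfb x hx y hy) with h | h
    · exact Or.inl ((isOpen_lt hs' continuous_const).mem_nhds h)
    · refine Or.inr (mem_of_superset ((isOpen_lt continuous_const hs').mem_nhds h) ?_)
      intro z hz hz'; exact lt_asymm (show b < s z.1 from hz) hz'
  have h2 : ContinuousOn (fun x => filter ω₃ {y | b < s y.1} (g x)) U := by
    refine continuousOn_filter hω₂ hω₃ hg (fun x hx y hy => ?_) h3'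
    rcases lt_or_gt_of_ne (hgb x hx y hy) with h | h
    · refine Or.inr (mem_of_superset ((isOpen_lt hs' continuous_const).mem_nhds h) ?_)
      intro z hz hz'; exact lt_asymm (show s z.1 < b from hz) hz'
    · exact Or.inl ((isOpen_lt continuous_const hs').mem_nhds h)
  intro x hx
  have key : ∀ x y, y ∈ glue ω₃ s b (f x) (g x) ↔
      y ∈ filter ω₃ {y | s y.1 < b} (f x) ∨ y ∈ filter ω₃ {y | b < s y.1} (g x) := by
    intro x y
    simp only [mem_glue, mem_filter, mem_ofPred_eq]
    tauto
  refine tendsto_union hω₃ (h1 x hx) (h2 x hx) (Eventually.of_forall fun k => key k) (key x) ?_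
  intro y hy hy'
  exact lt_asymm (show s y.1 < b from hy.2.1) hy'.2.1

end Continuity

end Conf

end Scan

/-! ### Lifting homotopies of configurations in one direction -/

namespace Scan

lemma IsCell.hep_Icc {V : Type} [TopologicalSpace V] {Z : Type*} [TopologicalSpace Z] {K A : Set V}
    (hK : IsCell K A) {p q : ℝ} (hpq : p < q) {b : V → Z} {H : V × ℝ → Z} {S : Set Z}
    (hb : ContinuousOn b K) (hH : ContinuousOn H (A ×ˢ Icc p q)) (h0 : ∀ x ∈ A, H (x, p) = b x)
    (hbS : ∀ x ∈ K, b x ∈ S) (hHS : ∀ x ∈ A, ∀ t ∈ Icc p q, H (x, t) ∈ S) :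
    ∃ E : V × ℝ → Z, ContinuousOn E (K ×ˢ Icc p q) ∧ (∀ x ∈ K, E (x, p) = b x) ∧
      (∀ x ∈ A, ∀ t ∈ Icc p q, E (x, t) = H (x, t)) ∧
      ∀ x ∈ K, ∀ t ∈ Icc p q, E (x, t) ∈ S := by
  have hd : 0 < q - p := sub_pos.2 hpq
  have hI : ∀ t ∈ Icc (0 : ℝ) 1, p + t * (q - p) ∈ Icc p q := fun t ht =>
    ⟨by nlinarith [ht.1], by nlinarith [ht.2]⟩
  have hI' : ∀ t ∈ Icc p q, (t - p) / (q - p) ∈ Icc (0 : ℝ) 1 := fun t ht =>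
    ⟨div_nonneg (by linarith [ht.1]) hd.le, (div_le_one hd).2 (by linarith [ht.2])⟩
  have hinv : ∀ t, p + (t - p) / (q - p) * (q - p) = t := fun t => by
    rw [div_mul_cancel₀ _ hd.ne']; ring
  obtain ⟨E, hE, hE0, hEA, hES⟩ := hK.hep (S := S) (H := fun x => H (x.1, p + x.2 * (q - p))) hb
    (hH.comp (by fun_prop) fun x hx => ⟨hx.1, hI _ hx.2⟩) (fun x hx => by simpa using h0 x hx) hbS
    (fun x hx t ht => hHS x hx _ (hI t ht))
  refine ⟨fun x => E (x.1, (x.2 - p) / (q - p)), hE.comp (by fun_prop) fun x hx => ⟨hx.1, hI' _ hx.2⟩,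
    fun x hx => by simpa using hE0 x hx, fun x hx t ht => ?_, fun x hx t ht => hES x hx _ (hI' t ht)⟩
  simp only
  rw [hEA x hx _ (hI' t ht)]
  simp only [hinv]

/-- The data needed to scan labelled configurations in the direction of the coordinate `i`: the
visibility weight `ω` does not depend on this coordinate, and the points can be made less visible
by zooming in by `1 + t` while moving the labels along `q t`. -/
structure ScanData (n : ℕ) (L : Type*) [TopologicalSpace L] where
  /-- the direction of scanning -/
  i : Fin n
  /-- the visibility weight -/
  ω : (Fin n → ℝ) × L → ℝ
  /-- the homotopy of the labels -/
  q : ℝ × L → L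
  continuous_ω : Continuous ω
  continuous_q : Continuous q
  q_zero : ∀ l, q (0, l) = l
  ω_congr : ∀ z z' l, (∀ j, j ≠ i → z j = z' j) → ω (z, l) = ω (z', l)
  ω_le : ∀ t z l, 0 ≤ t → ω ((1 + t) • z, q (t, l)) ≤ ω (z, l)
  ω_pos : ∀ z l, 0 < ω ((2 : ℝ) • z, q (1, l)) → 1 / 2 ≤ ω (z, l)
  exists_path : ∀ z l, ∃ γ : ℝ → L, Continuous γ ∧ γ 0 = l ∧ ω (z, γ 1) ≤ 0

namespace ScanData

variable {n : ℕ} {L : Type*} [TopologicalSpace L] (D : ScanData n L)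

/-- Visibility in the window `|z i| < 1`. -/
def ωB (y : (Fin n → ℝ) × L) : ℝ := min (D.ω y) (1 - |y.1 D.i|)

/-- Visibility in the half space `z i < 1`. -/
def ωE (y : (Fin n → ℝ) × L) : ℝ := min (D.ω y) (1 - y.1 D.i)

lemma continuous_ωB : Continuous D.ωB := by
  have := D.continuous_ω
  unfold ωB; fun_prop

lemma continuous_ωE : Continuous D.ωE := by
  have := D.continuous_ω
  unfold ωE; fun_prop

lemma ωB_le_ωE (y : (Fin n → ℝ) × L) : D.ωB y ≤ D.ωE y :=
  min_le_min le_rfl (by linarith [le_abs_self (y.1 D.i)])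

lemma le_ωB {y : (Fin n → ℝ) × L} {θ b : ℝ} (h : θ ≤ D.ωE y) (hb : b ≤ y.1 D.i) :
    min θ (1 + b) ≤ D.ωB y := by
  refine le_min ((min_le_left _ _).trans (h.trans (min_le_left _ _))) ?_
  have h1 : θ ≤ 1 - y.1 D.i := h.trans (min_le_right _ _)
  rcases abs_cases (y.1 D.i) with ⟨h2, -⟩ | ⟨h2, -⟩
  · exact (min_le_left _ _).trans (by linarith)
  · exact (min_le_right _ _).trans (by linarith)

lemma continuous_shift (r : ℝ → ℝ → ℝ) (hr : Continuous fun p : ℝ × ℝ => r p.1 p.2) :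
    Continuous fun p : ℝ × ((Fin n → ℝ) × L) =>
      ((Function.update p.2.1 D.i (r p.1 (p.2.1 D.i)), p.2.2) : (Fin n → ℝ) × L) := by
  refine Continuous.prodMk ?_ (by fun_prop)
  refine Continuous.update (by fun_prop) D.i (hr.comp (by fun_prop : Continuous
    fun p : ℝ × ((Fin n → ℝ) × L) => (p.1, p.2.1 D.i)))

lemma ω_update (z : Fin n → ℝ) (l : L) (r : ℝ) : D.ω (Function.update z D.i r, l) = D.ω (z, l) :=
  D.ω_congr _ _ _ fun j hj => by simp [hj]

section Compress

variable {V : Type} [TopologicalSpace V] {K A : Set V}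

/-- Families of configurations on a cell are null-homotopic through configurations of points lying
in the same region. -/
lemma exists_contraction (hK : IsCell K A) {m : V → Conf D.ωE} (hm : ContinuousOn m K)
    {R : Set ℝ} (hR : ∀ x ∈ K, ∀ y ∈ m x, y.1 D.i ∈ R) :
    ∃ M : V × ℝ → Conf D.ωE, ContinuousOn M (K ×ˢ Icc 0 1) ∧ (∀ x ∈ K, M (x, 0) = m x) ∧
      (∀ x ∈ K, M (x, 1) = ∅) ∧ ∀ x ∈ K, ∀ t ∈ Icc (0 : ℝ) 1, ∀ y ∈ M (x, t), y.1 D.i ∈ R := by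
  classical
  obtain ⟨d, h, rfl, rfl⟩ := hK
  have hhc := h.continuous
  have hhc' := h.symm.continuous
  have h0 : h.symm 0 ∈ h ⁻¹' closedBall 0 1 := by simp
  set c := m (h.symm 0) with hc
  choose γ hγ hγ0 hγ1 using D.exists_path
  let M₂ : ℝ → Conf D.ωE := fun t =>
    Conf.map D.ωE (fun y => (y.1, γ y.1 y.2 t)) c
  have hinj : ∀ t, Conf.VisInj D.ωE (fun y : (Fin n → ℝ) × L => (y.1, γ y.1 y.2 t)) :=
    fun t y y' _ _ h => h
  have hM₂ : Continuous M₂ := by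
    rw [continuous_iff_continuousAt]
    intro t₀
    have := c.finite.to_subtype
    refine Conf.tendsto_list D.continuous_ωE (ι := (c : Set ((Fin n → ℝ) × L)))
      (y := fun j t => (j.1.1, γ j.1.1 j.1.2 t)) (y₀ := fun j => (j.1.1, γ j.1.1 j.1.2 t₀))
      ?_ ?_ ?_ ?_ ?_
    · intro j _
      exact ((continuous_const.prodMk (hγ _ _)).tendsto t₀)
    · intro j hj θ hθ
      have : Continuous fun t => D.ωE (j.1.1, γ j.1.1 j.1.2 t) :=
        D.continuous_ωE.comp (continuous_const.prodMk (hγ _ _))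
      exact (this.tendsto t₀).eventually (gt_mem_nhds (lt_of_le_of_lt hj hθ))
    · intro j j' _ _ h
      exact Subtype.ext (c.eq_of_fst j.2 j'.2 (Prod.ext_iff.1 h).1)
    · refine Filter.Eventually.of_forall fun t z => ?_
      rw [Conf.mem_map (hinj t)]
      exact ⟨fun ⟨y, hy, h1, h2⟩ => ⟨⟨y, hy⟩, h1, h2⟩, fun ⟨j, h1, h2⟩ => ⟨j.1, j.2, h1, h2⟩⟩
    · intro z
      rw [Conf.mem_map (hinj t₀)]
      exact ⟨fun ⟨y, hy, h1, h2⟩ => ⟨⟨y, hy⟩, h1, h2⟩, fun ⟨j, h1, h2⟩ => ⟨j.1, j.2, h1, h2⟩⟩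
  have hin : ∀ q ∈ (h ⁻¹' closedBall 0 1) ×ˢ Icc (0 : ℝ) 1, q.2 ≤ 1 / 2 →
      h.symm ((1 - 2 * q.2) • h q.1) ∈ h ⁻¹' closedBall 0 1 := by
    rintro ⟨x, t⟩ ⟨hx, ht⟩ h2
    simp only [mem_preimage, Homeomorph.apply_symm_apply, mem_closedBall, dist_zero_right,
      norm_smul, Real.norm_eq_abs] at hx ⊢
    rw [abs_of_nonneg (by linarith)]
    exact mul_le_one₀ (by linarith [ht.1]) (norm_nonneg _) hx
  have hlow : ∀ y : (Fin n → ℝ) × L, y ∈ M₂ 0 ↔ y ∈ c := by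
    intro y
    rw [Conf.mem_map (hinj 0)]
    constructor
    · rintro ⟨y, hy, rfl, h⟩; rwa [hγ0]
    · intro hy; exact ⟨y, hy, by simp only [hγ0], c.pos hy⟩
  refine ⟨fun q => if q.2 ≤ 1 / 2 then m (h.symm ((1 - 2 * q.2) • h q.1)) else M₂ (2 * q.2 - 1),
    ?_, ?_, ?_, ?_⟩
  · refine continuousOn_ite_le (r := 1 / 2) continuous_snd ?_ ?_ ?_
    · refine hm.comp (by fun_prop) fun q hq => hin q hq.1 hq.2
    · exact hM₂.comp_continuousOn (by fun_prop)
    · intro q hq h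
      rw [h]
      refine SetLike.ext fun y => ?_
      norm_num
      exact (hlow y).symm
  · intro x hx; simp
  · intro x hx
    norm_num
    rw [Conf.eq_empty_iff]
    intro y hy
    rw [Conf.mem_map (hinj 1)] at hy
    obtain ⟨y, -, rfl, h⟩ := hy
    exact absurd (h.trans_le (min_le_left _ _)) (not_lt.2 (hγ1 _ _))
  · intro x hx t ht y hy
    by_cases h2 : t ≤ 1 / 2
    · simp only [if_pos h2] at hy
      exact hR _ (hin (x, t) ⟨hx, ht⟩ h2) y hy
    · simp only [if_neg h2] at hy
      rw [Conf.mem_map (hinj _)] at hy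
      obtain ⟨y, hy, rfl, -⟩ := hy
      exact hR _ h0 y hy

/-- Translation in the direction of scanning. -/
def shift (r : ℝ) (c : Conf D.ωE) : Conf D.ωE :=
  Conf.map D.ωE (fun y => (Function.update y.1 D.i (y.1 D.i - r), y.2)) c

lemma mem_shift {r : ℝ} {c : Conf D.ωE} {y' : (Fin n → ℝ) × L} : y' ∈ D.shift r c ↔
    ∃ y ∈ c, (Function.update y.1 D.i (y.1 D.i - r), y.2) = y' ∧ 0 < D.ωE y' := by
  refine Conf.mem_map fun y y' _ _ h => ?_
  funext j
  have := congrFun h j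
  by_cases hj : j = D.i
  · subst hj; simpa using this
  · simpa [hj] using this

lemma shift_lt {r β : ℝ} {c : Conf D.ωE} (hc : ∀ y ∈ c, y.1 D.i < β) :
    ∀ y ∈ D.shift r c, y.1 D.i < β - r := by
  intro y hy
  rw [mem_shift] at hy
  obtain ⟨y, hy, rfl, -⟩ := hy
  have := hc y hy
  simpa using this

lemma shift_zero (c : Conf D.ωE) : D.shift 0 c = c := by
  refine SetLike.ext fun y => ?_
  rw [mem_shift]
  constructor
  · rintro ⟨y, hy, rfl, -⟩; simpa using hy
  · intro hy; exact ⟨y, hy, by simp, c.pos hy⟩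

lemma continuousOn_shift {X : Type*} [TopologicalSpace X] {U : Set X} {f : X → Conf D.ωE}
    (hf : ContinuousOn f U) {r : X → ℝ} (hr : ContinuousOn r U) {β : ℝ} (hβ : β < 1)
    (hfβ : ∀ x ∈ U, ∀ y ∈ f x, y.1 D.i < β) : ContinuousOn (fun x => D.shift (r x) (f x)) U := by
  refine Conf.continuousOn_map D.continuous_ωE D.continuous_ωE hf
    (Φ := fun x y => (Function.update y.1 D.i (y.1 D.i - r x), y.2)) ?_ ?_ ?_
  · exact (D.continuous_shift (fun r x => x - r) (by fun_prop)).comp_continuousOn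
      ((hr.comp continuousOn_fst fun x hx => hx.1).prodMk continuousOn_snd)
  · intro x _ y y' _ _ h
    funext j
    have := congrFun h j
    by_cases hj : j = D.i
    · subst hj; simpa using this
    · simpa [hj] using this
  · intro θ hθ
    refine ⟨min θ (1 - β), lt_min hθ (by linarith), fun x hx y hy h => ?_⟩
    refine le_min ?_ ((min_le_right _ _).trans (by linarith [hfβ x hx y hy]))
    have := h.trans (min_le_left _ _)
    rw [ω_update] at this
    exact (min_le_left _ _).trans this

/-- A family of configurations in the half space `z i < β` which looks like `m` beyond `b` over the
boundary of a cell can be deformed such that it looks like `m` beyond `b` over the cell. -/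
lemma exists_compression (hK : IsCell K A) {b β : ℝ} (hbβ : b < β) (hβ : β < 1)
    {m a : V → Conf D.ωE} (hm : ContinuousOn m K)
    (hmb : ∀ x ∈ K, ∀ y ∈ m x, b < y.1 D.i ∧ y.1 D.i < β) (ha : ContinuousOn a K)
    (haβ : ∀ x ∈ K, ∀ y ∈ a x, y.1 D.i < β)
    (ham : ∀ x ∈ A, ∀ y : (Fin n → ℝ) × L, b ≤ y.1 D.i → (y ∈ a x ↔ y ∈ m x)) :
    ∃ a' : V → Conf D.ωE, HRel {c | ∀ y ∈ c, y.1 D.i < β} K A a a' ∧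
      ∀ x ∈ K, ∀ y : (Fin n → ℝ) × L, b ≤ y.1 D.i → (y ∈ a' x ↔ y ∈ m x) := by
  have hAK := hK.subset
  have hI : ∀ t ∈ Icc (0 : ℝ) 1, 1 - t ∈ Icc (0 : ℝ) 1 := fun t ht =>
    ⟨by linarith [ht.2], by linarith [ht.1]⟩
  have h1I : (1 : ℝ) ∈ Icc (0 : ℝ) 1 := by simp
  have hs : Continuous fun z : Fin n → ℝ => z D.i := continuous_apply _
  obtain ⟨M, hM, hM0, hM1, hMb⟩ := D.exists_contraction hK hm (R := Ioo b β) hmb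
  have hglue : ∀ {U : Set (V × ℝ)} {f : V → Conf D.ωE}, U ⊆ K ×ˢ Icc 0 1 →
      ContinuousOn (fun q => f q.1) U → (∀ q ∈ U, ∀ y ∈ f q.1, y.1 D.i ≠ b) →
      ContinuousOn (fun q => Conf.glue D.ωE (fun z => z D.i) b (f q.1) (M q)) U := by
    intro U f hU hf hfb
    exact Conf.continuousOn_glue D.continuous_ωE D.continuous_ωE D.continuous_ωE hs hf
      (hM.mono hU) hfb
      (fun q hq y hy => (hMb _ (hU hq).1 _ (hU hq).2 y hy).1.ne')
      (fun θ hθ => ⟨θ, hθ, fun _ _ h => h⟩) (fun θ hθ => ⟨θ, hθ, fun _ _ h => h⟩)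
  have hsub : A ×ˢ Icc (0 : ℝ) 1 ⊆ K ×ˢ Icc 0 1 := prod_mono hAK subset_rfl
  obtain ⟨E, hE, hE0, hEA, hES⟩ := hK.hep (S := {c : Conf D.ωE | ∀ y ∈ c, y.1 D.i < β})
    (H := fun q => Conf.glue D.ωE (fun z => z D.i) b (a q.1) (M q)) ha
    (hglue hsub (ha.comp continuousOn_fst fun q hq => hAK hq.1) (by
      intro q hq y hy h
      have := hmb _ (hAK hq.1) y ((ham _ hq.1 y h.ge).1 hy)
      linarith [this.1]))
    (by
      intro x hx
      refine SetLike.ext fun y => ?_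
      rw [Conf.mem_glue, hM0 x (hAK hx)]
      constructor
      · rintro ⟨h | h, -⟩
        · exact h.1
        · exact (ham x hx y h.2.le).2 h.1
      · intro hy
        refine ⟨?_, Conf.pos _ hy⟩
        rcases lt_or_ge (y.1 D.i) b with h | h
        · exact Or.inl ⟨hy, h⟩
        · have := (ham x hx y h).1 hy
          exact Or.inr ⟨this, (hmb x (hAK hx) y this).1⟩)
    haβ (by
      rintro x hx t ht y ⟨h | h, -⟩
      · exact haβ x (hAK hx) y h.1
      · exact (hMb x (hAK hx) t ht y h.1).2)
  set a₁ : V → Conf D.ωE := fun x => E (x, 1) with ha₁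
  have ha₁c : ContinuousOn a₁ K := hE.comp (by fun_prop) fun x hx => ⟨hx, h1I⟩
  have ha₁β : ∀ x ∈ K, ∀ y ∈ a₁ x, y.1 D.i < β := fun x hx => hES x hx 1 h1I
  have ha₁A : ∀ x ∈ A, ∀ y, y ∈ a₁ x ↔ y ∈ a x ∧ y.1 D.i < b := by
    intro x hx y
    rw [ha₁]
    simp only
    rw [hEA x hx 1 h1I, Conf.mem_glue, hM1 x (hAK hx)]
    constructor
    · rintro ⟨h | h, -⟩
      · exact h
      · exact absurd h.1 (Conf.notMem_empty _)
    · intro h; exact ⟨Or.inl h, Conf.pos _ h.1⟩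
  have hT : ∀ {U : Set V} {r : ℝ → ℝ}, U ⊆ K → Continuous r →
      ContinuousOn (fun q : V × ℝ => D.shift (r q.2) (a₁ q.1)) (U ×ˢ Icc 0 1) := fun hU hr =>
    D.continuousOn_shift (ha₁c.comp continuousOn_fst fun q hq => hU hq.1) (by fun_prop) hβ
      fun q hq => ha₁β _ (hU hq.1)
  have hlt : ∀ {c : Conf D.ωE} {r b' : ℝ}, (∀ y ∈ c, y.1 D.i < b') → 0 ≤ r →
      ∀ y ∈ D.shift r c, y.1 D.i < b' := fun h hr y hy => by linarith [D.shift_lt h y hy]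
  obtain ⟨F, hF, hF0, hFA, hFS⟩ := hK.hep (S := {c : Conf D.ωE | ∀ y ∈ c, y.1 D.i < b})
    (b := fun x => D.shift (β - b) (a₁ x))
    (H := fun q => D.shift ((1 - q.2) * (β - b)) (a₁ q.1))
    (D.continuousOn_shift ha₁c continuousOn_const hβ ha₁β)
    (hT hAK (r := fun t => (1 - t) * (β - b)) (by fun_prop)) (fun x hx => by simp)
    (fun x hx y hy => by
      have := D.shift_lt (ha₁β x hx) y hy
      linarith)
    (fun x hx t ht => hlt (fun y hy => ((ha₁A x hx y).1 hy).2)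
      (mul_nonneg (hI t ht).1 (by linarith)))
  set l : V → Conf D.ωE := fun x => F (x, 1) with hl
  have hlc : ContinuousOn l K := hF.comp (by fun_prop) fun x hx => ⟨hx, h1I⟩
  have hlb : ∀ x ∈ K, ∀ y ∈ l x, y.1 D.i < b := fun x hx => hFS x hx 1 h1I
  have hlA : ∀ x ∈ A, l x = a₁ x := fun x hx => by
    rw [hl]
    simp only
    rw [hFA x hx 1 h1I]; simp [shift_zero]
  have hrel : HRel {c : Conf D.ωE | ∀ y ∈ c, y.1 D.i < β} K A a₁ l := by
    refine (hK.hrel_of_ends (U := fun q => D.shift (q.2 * (β - b)) (a₁ q.1))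
      (W := fun q => F (q.1, 1 - q.2)) (hT subset_rfl (r := fun t => t * (β - b)) (by fun_prop))
      (hF.comp (by fun_prop) fun q hq => ⟨hq.1, hI _ hq.2⟩) ?_ ?_ ?_ ?_).congr hAK ?_ ?_
    · intro x hx t ht
      exact hlt (ha₁β x hx) (mul_nonneg ht.1 (by linarith))
    · intro x hx t ht y hy
      exact (hFS x hx _ (hI t ht) y hy).trans hbβ
    · intro x hx t ht
      simp only
      rw [hFA x hx _ (hI t ht)]; simp
    · refine HRel.refl_of ?_ ?_ ?_
      · simpa using D.continuousOn_shift ha₁c (continuousOn_const (c := β - b)) hβ ha₁β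
      · intro x hx
        exact hlt (ha₁β x hx) (by linarith)
      · intro x hx
        simp [hF0 x hx]
    · intro x hx; simp [shift_zero]
    · intro x hx; simp [hl]
  have hmem : ∀ x ∈ K, ∀ y : (Fin n → ℝ) × L, b ≤ y.1 D.i →
      (y ∈ Conf.glue D.ωE (fun z => z D.i) b (l x) (m x) ↔ y ∈ m x) := by
    intro x hx y hy
    rw [Conf.mem_glue]
    constructor
    · rintro ⟨h | h, -⟩
      · exact absurd h.2 (not_lt.2 hy)
      · exact h.1
    · intro h; exact ⟨Or.inr ⟨h, (hmb x hx y h).1⟩, Conf.pos _ h⟩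
  refine ⟨fun x => Conf.glue D.ωE (fun z => z D.i) b (l x) (m x), ?_, hmem⟩
  refine (hK.hrel_of_ends (U := E)
    (W := fun q => Conf.glue D.ωE (fun z => z D.i) b (l q.1) (M q)) hE
    (hglue subset_rfl (hlc.comp continuousOn_fst fun q hq => hq.1)
      fun q hq y hy => (hlb _ hq.1 y hy).ne) hES ?_ ?_ ?_).congr hAK hE0 ?_
  · rintro x hx t ht y ⟨h | h, -⟩
    · exact (hlb x hx y h.1).trans hbβ
    · exact (hMb x hx t ht y h.1).2
  · intro x hx t ht
    rw [hEA x hx t ht]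
    refine SetLike.ext fun y => ?_
    simp only [Conf.mem_glue, hlA x hx, ha₁A x hx]
    tauto
  · refine hrel.congr hAK (fun x hx => rfl) fun x hx => ?_
    refine SetLike.ext fun y => ?_
    simp only [Conf.mem_glue, hM1 x hx]
    constructor
    · intro h; exact ⟨Or.inl ⟨h, hlb x hx y h⟩, Conf.pos _ h⟩
    · rintro ⟨h | h, -⟩
      · exact h.1
      · exact absurd h.1 (Conf.notMem_empty _)
  · intro x hx; simp only [hM0 x hx]

end Compress

end ScanData

namespace ScanData

variable {n : ℕ} {L : Type*} [TopologicalSpace L] (D : ScanData n L)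

/-- The configurations `e` and `w` coincide in the half space `β ≤ z i`. -/
def LiftsAbove (β : ℝ) (e : Conf D.ωE) (w : Conf D.ωB) : Prop :=
  ∀ y : (Fin n → ℝ) × L, β ≤ y.1 D.i → (y ∈ e ↔ y ∈ w)

/-- No point of `w` lies on the wall `z i = b`. -/
def IsClear (b : ℝ) (w : Conf D.ωB) : Prop := ∀ y ∈ w, y.1 D.i ≠ b

variable {D} in
lemma LiftsAbove.mono {β β' : ℝ} {e : Conf D.ωE} {w : Conf D.ωB} (h : D.LiftsAbove β e w)
    (hβ : β ≤ β') : D.LiftsAbove β' e w := fun y hy => h y (hβ.trans hy)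

lemma continuousOn_filter_Ioo {X : Type*} [TopologicalSpace X] {U : Set X} {w : X → Conf D.ωB}
    (hw : ContinuousOn w U) {b β : ℝ} (hb : ∀ x ∈ U, D.IsClear b (w x))
    (hβ : ∀ x ∈ U, D.IsClear β (w x)) (hb1 : -1 < b) :
    ContinuousOn (fun x => Conf.filter D.ωE {y | b < y.1 D.i ∧ y.1 D.i < β} (w x)) U := by
  have hs : Continuous fun y : (Fin n → ℝ) × L => y.1 D.i := by fun_prop
  refine Conf.continuousOn_filter D.continuous_ωB D.continuous_ωE hw (fun x hx y hy => ?_)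
    fun θ hθ => ⟨min θ (1 + b), lt_min hθ (by linarith), fun y hy h => D.le_ωB h hy.1.le⟩
  rcases lt_or_gt_of_ne (hb x hx y hy) with h | h
  · right
    filter_upwards [(isOpen_lt hs continuous_const).mem_nhds h] with z hz hz'
    exact lt_asymm (show z.1 D.i < b from hz) hz'.1
  rcases lt_or_gt_of_ne (hβ x hx y hy) with h' | h'
  · left
    filter_upwards [(isOpen_lt hs continuous_const).mem_nhds h',
      (isOpen_lt continuous_const hs).mem_nhds h] with z hz hz'
    exact ⟨hz', hz⟩
  · right
    filter_upwards [(isOpen_lt continuous_const hs).mem_nhds h'] with z hz hz'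
    exact lt_asymm (show β < z.1 D.i from hz) hz'.2

section Slab

variable {V : Type} [TopologicalSpace V] {K A : Set V}

lemma exists_deformation_above (hK : IsCell K A) {s s' : ℝ} (hs : s < s') {α β b : ℝ}
    (hα : -1 < α) (hβ : β < 1) (hαb : α < b) {W : V × ℝ → Conf D.ωB}
    (hW : ContinuousOn W (K ×ˢ Icc s s')) (hWβ : ∀ q ∈ K ×ˢ Icc s s', D.IsClear β (W q))
    (hWb : ∀ x ∈ K, D.IsClear b (W (x, s'))) {a : V × ℝ → Conf D.ωE}
    (ha : ContinuousOn a (K ×ˢ Icc s s'))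
    (haβ : ∀ q ∈ K ×ˢ Icc s s', ∀ y ∈ a q, y.1 D.i < β)
    (hat : ∀ x ∈ A, ∀ y : (Fin n → ℝ) × L, b ≤ y.1 D.i → y.1 D.i < β →
      (y ∈ a (x, s') ↔ y ∈ W (x, s'))) :
    ∃ a' : V × ℝ → Conf D.ωE, ContinuousOn a' (K ×ˢ Icc s s') ∧
      (∀ q ∈ K ×ˢ {s} ∪ A ×ˢ Icc s s', a' q = a q) ∧
      (∀ q ∈ K ×ˢ Icc s s', ∀ y ∈ a' q, y.1 D.i < β) ∧
      ∀ x ∈ K, ∀ y : (Fin n → ℝ) × L, b ≤ y.1 D.i → y.1 D.i < β →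
        (y ∈ a' (x, s') ↔ y ∈ W (x, s')) := by
  classical
  rcases le_or_gt β b with hbβ | hbβ
  · exact ⟨a, ha, fun _ _ => rfl, haβ, fun x _ y h1 h2 => absurd (hbβ.trans h1) (not_le.2 h2)⟩
  have hAK := hK.subset
  have hs' : s' ∈ Icc s s' := ⟨hs.le, le_rfl⟩
  have htop : MapsTo (fun x : V => (x, s')) K (K ×ˢ Icc s s') := fun x hx => ⟨hx, hs'⟩
  have hm : ∀ x ∈ K, ∀ y : (Fin n → ℝ) × L, b ≤ y.1 D.i → y.1 D.i < β →
      (y ∈ Conf.filter D.ωE {y | b < y.1 D.i ∧ y.1 D.i < β} (W (x, s')) ↔ y ∈ W (x, s')) := by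
    intro x hx y h1 h2
    rw [Conf.mem_filter]
    exact ⟨fun h => h.1, fun h => ⟨h, ⟨lt_of_le_of_ne h1 (hWb x hx y h).symm, h2⟩,
      ((W (x, s')).pos h).trans_le (D.ωB_le_ωE y)⟩⟩
  obtain ⟨a₂, ⟨H, hH, hH0, hH1, hHA, hHS⟩, ha₂⟩ := D.exists_compression hK hbβ hβ
    (m := fun x => Conf.filter D.ωE {y | b < y.1 D.i ∧ y.1 D.i < β} (W (x, s')))
    (a := fun x => a (x, s'))
    (D.continuousOn_filter_Ioo (hW.comp (by fun_prop) htop) hWb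
      (fun x hx => hWβ _ (htop hx)) (hα.trans hαb))
    (fun x _ y hy => hy.2.1) (ha.comp (by fun_prop) htop) (fun x hx => haβ _ (htop hx))
    (fun x hx y hy => by
      rcases lt_or_ge (y.1 D.i) β with h | h
      · rw [hat x hx y hy h, hm x (hAK hx) y hy h]
      · exact iff_of_false (fun h' => not_lt.2 h (haβ _ (htop (hAK hx)) y h'))
          fun h' => not_lt.2 h h'.2.1.2)
  have hcell := hK.prod (isCell_Icc hs)
  have hbd : ∀ q ∈ (A ×ˢ Icc s s' ∪ K ×ˢ {s, s'}), q ∈ K ×ˢ Icc s s' := fun q hq => hcell.subset hq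
  have hT : IsClosed (Prod.fst ⁻¹' (A ×ˢ Icc s s' ∪ K ×ˢ {s}) : Set ((V × ℝ) × ℝ)) :=
    ((hK.isClosed_bdry.prod isClosed_Icc).union
      (hK.isClosed.prod isClosed_singleton)).preimage continuous_fst
  obtain ⟨E, hE, hE0, hEA, hES⟩ := hcell.hep (S := {c : Conf D.ωE | ∀ y ∈ c, y.1 D.i < β})
    (b := a) (H := fun q => if q.1.2 = s' then H (q.1.1, q.2) else a q.1) ha
    (by
      refine continuousOn_ite_of_isClosed (S := {q : (V × ℝ) × ℝ | q.1.2 = s'})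
        (T := Prod.fst ⁻¹' (A ×ˢ Icc s s' ∪ K ×ˢ {s}))
        (isClosed_eq (by fun_prop) continuous_const) hT ?_ ?_ (fun _ _ h => h) ?_ ?_
      · exact hH.comp (by fun_prop) fun q hq => ⟨(hbd _ hq.2.1).1, hq.2.2⟩
      · exact ha.comp (by fun_prop) fun q hq => hbd _ hq.2.1
      · rintro ⟨⟨x, t⟩, τ⟩ ⟨h | h, -⟩ hne
        · exact Or.inl h
        · exact Or.inr ⟨h.1, h.2.resolve_right hne⟩
      · rintro ⟨⟨x, t⟩, τ⟩ ⟨-, hτ⟩ h h'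
        simp only [mem_ofPred_eq] at h
        subst h
        rcases h' with h' | h'
        · exact hHA x h'.1 τ hτ
        · exact absurd h'.2 hs.ne')
    (by
      rintro ⟨x, t⟩ hq
      simp only
      split_ifs with h
      · subst h; exact hH0 x (hbd _ hq).1
      · rfl)
    haβ (by
      rintro ⟨x, t⟩ hq τ hτ
      simp only
      split_ifs with h
      · exact hHS x (hbd _ hq).1 τ hτ
      · exact haβ _ (hbd _ hq))
  have h1I : (1 : ℝ) ∈ Icc (0 : ℝ) 1 := by simp
  refine ⟨fun q => E (q, 1), hE.comp (by fun_prop) fun q hq => ⟨hq, h1I⟩, ?_,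
    fun q hq => hES q hq 1 h1I, ?_⟩
  · rintro ⟨x, t⟩ hq
    have hq' : (x, t) ∈ (A ×ˢ Icc s s' ∪ K ×ˢ {s, s'}) := by
      rcases hq with hq | hq
      · exact Or.inr ⟨hq.1, Or.inl hq.2⟩
      · exact Or.inl hq
    simp only
    rw [hEA _ hq' 1 h1I]
    simp only
    split_ifs with h
    · subst h
      rcases hq with hq | hq
      · exact absurd hq.2 hs.ne'
      · exact hHA x hq.1 1 h1I
    · rfl
  · intro x hx y h1 h2
    have hq' : (x, s') ∈ (A ×ˢ Icc s s' ∪ K ×ˢ {s, s'}) := Or.inr ⟨hx, Or.inr rfl⟩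
    simp only
    rw [hEA _ hq' 1 h1I]
    simp only [if_true]
    rw [hH1 x hx, ha₂ x hx y h1, hm x hx y h1 h2]

/-- Lifting over a slab on which there is a clear wall. -/
lemma exists_lift_slab (hK : IsCell K A) {s s' : ℝ} (hs : s < s') {α β b : ℝ}
    (hα : -1 < α) (hαβ : α < β) (hβ : β < 1) (hαb : α < b) {W : V × ℝ → Conf D.ωB}
    (hW : ContinuousOn W (K ×ˢ Icc s s')) (hWβ : ∀ q ∈ K ×ˢ Icc s s', D.IsClear β (W q))
    (hWb : ∀ x ∈ K, D.IsClear b (W (x, s'))) {e : V × ℝ → Conf D.ωE}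
    (he : ContinuousOn e (K ×ˢ {s} ∪ A ×ˢ Icc s s'))
    (heβ : ∀ x ∈ K, D.LiftsAbove β (e (x, s)) (W (x, s)))
    (heα : ∀ q ∈ A ×ˢ Icc s s', D.LiftsAbove α (e q) (W q)) :
    ∃ e' : V × ℝ → Conf D.ωE, ContinuousOn e' (K ×ˢ Icc s s') ∧
      (∀ q ∈ K ×ˢ {s} ∪ A ×ˢ Icc s s', e' q = e q) ∧
      (∀ q ∈ K ×ˢ Icc s s', D.LiftsAbove β (e' q) (W q)) ∧
      ∀ x ∈ K, D.LiftsAbove b (e' (x, s')) (W (x, s')) := by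
  have hAK := hK.subset
  have hs' : s' ∈ Icc s s' := ⟨hs.le, le_rfl⟩
  have hss : s ∈ Icc s s' := ⟨le_rfl, hs.le⟩
  have hsi : Continuous fun z : Fin n → ℝ => z D.i := continuous_apply _
  have hs1 : Continuous fun y : (Fin n → ℝ) × L => y.1 D.i := by fun_prop
  set J := K ×ˢ {s} ∪ A ×ˢ Icc s s' with hJ
  have hJK : J ⊆ K ×ˢ Icc s s' := by
    rintro ⟨x, t⟩ (⟨h1, h2⟩ | ⟨h1, h2⟩)
    · simp only [mem_singleton_iff] at h2; subst h2; exact ⟨h1, hss⟩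
    · exact ⟨hAK h1, h2⟩
  have heJ : ∀ q ∈ J, D.LiftsAbove β (e q) (W q) := by
    rintro ⟨x, t⟩ (⟨h1, h2⟩ | h)
    · simp only [mem_singleton_iff] at h2; subst h2; exact heβ x h1
    · exact (heα _ h).mono hαβ.le
  have heb : ∀ q ∈ J, ∀ y ∈ e q, y.1 D.i ≠ β := fun q hq y hy h =>
    hWβ q (hJK hq) y ((heJ q hq y h.ge).1 hy) h
  have hfilt : ContinuousOn (fun q => Conf.filter D.ωE {y | y.1 D.i < β} (e q)) J := by
    refine Conf.continuousOn_filter D.continuous_ωE D.continuous_ωE he (fun q hq y hy => ?_)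
      fun θ hθ => ⟨θ, hθ, fun _ _ h => h⟩
    rcases lt_or_gt_of_ne (heb q hq y hy) with h | h
    · exact Or.inl ((isOpen_lt hs1 continuous_const).mem_nhds h)
    · right
      filter_upwards [(isOpen_lt continuous_const hs1).mem_nhds h] with z hz hz'
      exact lt_asymm (show β < z.1 D.i from hz) hz'
  obtain ⟨a, ha, ha0, haA, haS⟩ := hK.hep_Icc hs (S := {c : Conf D.ωE | ∀ y ∈ c, y.1 D.i < β})
    (b := fun x => Conf.filter D.ωE {y | y.1 D.i < β} (e (x, s)))
    (H := fun q => Conf.filter D.ωE {y | y.1 D.i < β} (e q))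
    (hfilt.comp (f := fun x => (x, s)) (by fun_prop) fun x hx => Or.inl ⟨hx, rfl⟩)
    (hfilt.mono subset_union_right) (fun _ _ => rfl) (fun x _ y hy => hy.2.1)
    (fun x _ t _ y hy => hy.2.1)
  have haJ : ∀ q ∈ J, a q = Conf.filter D.ωE {y | y.1 D.i < β} (e q) := by
    rintro ⟨x, t⟩ (⟨h1, h2⟩ | h)
    · simp only [mem_singleton_iff] at h2; subst h2; exact ha0 x h1
    · exact haA x h.1 t h.2
  obtain ⟨a', ha', ha'J, ha'β, ha't⟩ := D.exists_deformation_above hK hs hα hβ hαb hW hWβ hWb ha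
    (fun q hq => haS q.1 hq.1 q.2 hq.2) (fun x hx y h1 h2 => by
      have hq : (x, s') ∈ A ×ˢ Icc s s' := ⟨hx, hs'⟩
      rw [haJ _ (Or.inr hq), Conf.mem_filter, ← heα _ hq y (hαb.le.trans h1)]
      exact ⟨fun h => h.1, fun h => ⟨h, h2, Conf.pos _ h⟩⟩)
  refine ⟨fun q => Conf.glue D.ωE (fun z => z D.i) β (a' q) (W q), ?_, ?_, ?_, ?_⟩
  · exact Conf.continuousOn_glue D.continuous_ωE D.continuous_ωB D.continuous_ωE hsi ha' hW
      (fun q hq y hy => (ha'β q hq y hy).ne) hWβ (fun θ hθ => ⟨θ, hθ, fun _ _ h => h⟩)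
      fun θ hθ => ⟨min θ (1 + β), lt_min hθ (by linarith), fun y hy h => D.le_ωB h hy.le⟩
  · intro q hq
    refine SetLike.ext fun y => ?_
    rw [Conf.mem_glue, ha'J q hq, haJ q hq, Conf.mem_filter]
    constructor
    · rintro ⟨h | h, -⟩
      · exact h.1.1
      · exact (heJ q hq y h.2.le).2 h.1
    · intro h
      refine ⟨?_, Conf.pos _ h⟩
      rcases lt_or_gt_of_ne (heb q hq y h) with h' | h'
      · exact Or.inl ⟨⟨h, h', Conf.pos _ h⟩, h'⟩
      · exact Or.inr ⟨(heJ q hq y h'.le).1 h, h'⟩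
  · intro q hq y hy
    rw [Conf.mem_glue]
    constructor
    · rintro ⟨h | h, -⟩
      · exact absurd h.2 (not_lt.2 hy)
      · exact h.1
    · intro h
      exact ⟨Or.inr ⟨h, lt_of_le_of_ne hy (hWβ q hq y h).symm⟩,
        (Conf.pos _ h).trans_le (D.ωB_le_ωE y)⟩
  · intro x hx y hy
    rw [Conf.mem_glue]
    constructor
    · rintro ⟨h | h, -⟩
      · exact (ha't x hx y hy h.2).1 h.1
      · exact h.1
    · intro h
      refine ⟨?_, (Conf.pos _ h).trans_le (D.ωB_le_ωE y)⟩
      rcases lt_or_gt_of_ne (hWβ _ (show (x, s') ∈ K ×ˢ Icc s s' from ⟨hx, hs'⟩) y h) with h' | h'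
      · exact Or.inl ⟨(ha't x hx y hy h').2 h, h'⟩
      · exact Or.inr ⟨h, h'⟩

end Slab

end ScanData

namespace ScanData

variable {n : ℕ} {L : Type*} [TopologicalSpace L] (D : ScanData n L)

/-- Locally there are many clear walls. -/
def LocallyClear {X : Type*} [TopologicalSpace X] (U : Set X) (W : X → Conf D.ωB) : Prop :=
  ∀ p ∈ U, ∀ β β' : ℝ, β < β' → ∃ b ∈ Ioo β β', ∀ᶠ p' in 𝓝[U] p, D.IsClear b (W p')

variable {D} in
lemma LocallyClear.comp {X Y : Type*} [TopologicalSpace X] [TopologicalSpace Y] {U : Set X}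
    {W : X → Conf D.ωB} (h : D.LocallyClear U W) {T : Set Y} {f : Y → X} (hf : ContinuousOn f T)
    (hT : MapsTo f T U) : D.LocallyClear T (W ∘ f) := by
  intro p hp β β' hβ
  obtain ⟨b, hb, hU⟩ := h (f p) (hT hp) β β' hβ
  exact ⟨b, hb, ((hf p hp).tendsto_nhdsWithin hT).eventually hU⟩

/-- The homotopy lifting property relative to `A`, with some loss near the wall. -/
def HasLift {V : Type*} [TopologicalSpace V] (K A : Set V) (W : V × ℝ → Conf D.ωB) (α α' : ℝ) :
    Prop :=
  ∀ e : V × ℝ → Conf D.ωE, ContinuousOn e (K ×ˢ {0} ∪ A ×ˢ Icc 0 1) →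
    (∀ q ∈ K ×ˢ {0} ∪ A ×ˢ Icc 0 1, D.LiftsAbove α (e q) (W q)) →
    ∃ e' : V × ℝ → Conf D.ωE, ContinuousOn e' (K ×ˢ Icc 0 1) ∧
      (∀ q ∈ K ×ˢ {0} ∪ A ×ˢ Icc 0 1, e' q = e q) ∧
      ∀ q ∈ K ×ˢ Icc 0 1, D.LiftsAbove α' (e' q) (W q)

lemma hasLift_of_subdivision {V : Type} [TopologicalSpace V] {K A : Set V} (hK : IsCell K A)
    {W : V × ℝ → Conf D.ωB} (hW : ContinuousOn W (K ×ˢ Icc 0 1)) {α α' : ℝ} (hα : -1 < α)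
    (hα' : α' < 1) {τ β : ℕ → ℝ} {N : ℕ} (hτ0 : τ 0 = 0) (hτN : τ N = 1) (hτ : StrictMono τ)
    (hβ : ∀ k ≤ N, α < β k ∧ β k < α')
    (hclear : ∀ k ≤ N, ∀ x ∈ K, ∀ t ∈ Icc (0 : ℝ) 1, t ∈ Icc (τ k) (τ (k + 1)) →
      D.IsClear (β k) (W (x, t))) : D.HasLift K A W α α' := by
  classical
  intro e he hel
  have hAK := hK.subset
  have hτ1 : ∀ k ≤ N, τ k ≤ 1 := fun k hk => hτN ▸ hτ.monotone hk
  have hτ0' : ∀ k, 0 ≤ τ k := fun k => hτ0 ▸ hτ.monotone (Nat.zero_le k)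
  have main : ∀ k ≤ N, ∃ e' : V × ℝ → Conf D.ωE, ContinuousOn e' (K ×ˢ Icc 0 (τ k)) ∧
      (∀ q ∈ K ×ˢ {0} ∪ A ×ˢ Icc 0 (τ k), e' q = e q) ∧
      (∀ q ∈ K ×ˢ Icc 0 (τ k), D.LiftsAbove α' (e' q) (W q)) ∧
      ∀ x ∈ K, D.LiftsAbove (β k) (e' (x, τ k)) (W (x, τ k)) := by
    intro k
    induction k with
    | zero =>
      intro hk
      have hsub : K ×ˢ Icc 0 (τ 0) ⊆ K ×ˢ {0} ∪ A ×ˢ Icc (0 : ℝ) 1 := by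
        rw [hτ0, Icc_self]; exact subset_union_left
      refine ⟨e, he.mono hsub, fun _ _ => rfl, fun q hq => (hel q (hsub hq)).mono ?_,
        fun x hx => (hel _ (hsub ⟨hx, by simp [hτ0]⟩)).mono (hβ 0 hk).1.le⟩
      exact ((hβ 0 hk).1.trans (hβ 0 hk).2).le
    | succ k ih =>
      intro hk
      obtain ⟨e₁, he₁, he₁J, he₁l, he₁t⟩ := ih (by omega)
      have hk' : k ≤ N := by omega
      have hlt : τ k < τ (k + 1) := hτ (Nat.lt_succ_self k)
      have hsub : ∀ t ∈ Icc (τ k) (τ (k + 1)), t ∈ Icc (0 : ℝ) 1 := fun t ht =>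
        ⟨(hτ0' k).trans ht.1, ht.2.trans (hτ1 _ hk)⟩
      have hsub' : K ×ˢ Icc (τ k) (τ (k + 1)) ⊆ K ×ˢ Icc (0 : ℝ) 1 := fun q hq =>
        ⟨hq.1, hsub _ hq.2⟩
      have hk1 : τ k ∈ Icc 0 (τ k) := ⟨hτ0' k, le_rfl⟩
      obtain ⟨e₂, he₂, he₂J, he₂l, he₂t⟩ := D.exists_lift_slab hK hlt hα (hβ k hk').1
        ((hβ k hk').2.trans hα') (hβ (k + 1) hk).1 (hW.mono hsub')
        (fun q hq => hclear k hk' q.1 hq.1 q.2 (hsub _ hq.2) hq.2)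
        (fun x hx => hclear (k + 1) hk x hx _ (hsub _ ⟨hlt.le, le_rfl⟩)
          ⟨le_rfl, (hτ (Nat.lt_succ_self _)).le⟩)
        (e := fun q => if q.2 ≤ τ k then e₁ q else e q)
        (by
          refine continuousOn_ite_of_isClosed (S := {q : V × ℝ | q.2 ≤ τ k})
            (T := A ×ˢ Icc (τ k) (τ (k + 1))) (isClosed_le continuous_snd continuous_const)
            (hK.isClosed_bdry.prod isClosed_Icc) ?_ ?_ (fun _ _ h => h) ?_ ?_
          · refine he₁.mono ?_
            rintro ⟨x, t⟩ ⟨h1, h2 | h2⟩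
            · exact ⟨h2.1, by rw [h2.2]; exact hk1⟩
            · exact ⟨hAK h2.1, (hτ0' k).trans h2.2.1, h1⟩
          · exact he.mono fun q hq => Or.inr ⟨hq.1.1, hsub _ hq.1.2⟩
          · rintro ⟨x, t⟩ (h | h) hn
            · exact absurd (le_of_eq h.2) hn
            · exact h
          · rintro ⟨x, t⟩ - h1 h2
            exact he₁J _ (Or.inr ⟨h2.1, (hτ0' k).trans h2.2.1, h1⟩))
        (fun x hx => by simpa using he₁t x hx)
        (by
          rintro ⟨x, t⟩ ⟨hx, ht⟩
          simp only
          split_ifs with h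
          · rw [he₁J _ (Or.inr ⟨hx, (hτ0' k).trans ht.1, h⟩)]
            exact hel _ (Or.inr ⟨hx, hsub _ ht⟩)
          · exact hel _ (Or.inr ⟨hx, hsub _ ht⟩))
      refine ⟨fun q => if q.2 ≤ τ k then e₁ q else e₂ q, ?_, ?_, ?_, ?_⟩
      · refine continuousOn_ite_le continuous_snd (he₁.mono ?_) (he₂.mono ?_) ?_
        · exact fun q hq => ⟨hq.1.1, hq.1.2.1, hq.2⟩
        · exact fun q hq => ⟨hq.1.1, hq.2, hq.1.2.2⟩
        · rintro ⟨x, t⟩ hq h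
          simp only at h
          subst h
          rw [he₂J _ (Or.inl ⟨hq.1, rfl⟩)]
          simp
      · rintro ⟨x, t⟩ hq
        simp only
        split_ifs with h
        · refine he₁J _ (hq.imp id fun h' => ⟨h'.1, h'.2.1, h⟩)
        · have hA : x ∈ A ∧ t ∈ Icc (τ k) (τ (k + 1)) := by
            rcases hq with hq | hq
            · exact absurd ((le_of_eq hq.2).trans (hτ0' k)) h
            · exact ⟨hq.1, (not_le.1 h).le, hq.2.2⟩
          rw [he₂J _ (Or.inr hA)]
          simp [h]
      · rintro ⟨x, t⟩ hq
        simp only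
        split_ifs with h
        · exact he₁l _ ⟨hq.1, hq.2.1, h⟩
        · exact (he₂l _ ⟨hq.1, (not_le.1 h).le, hq.2.2⟩).mono (hβ k hk').2.le
      · intro x hx
        simpa [not_le.2 hlt] using he₂t x hx
  obtain ⟨e', h1, h2, h3, -⟩ := main N le_rfl
  rw [hτN] at h1 h2 h3
  exact ⟨e', h1, h2, h3⟩

lemma exists_small_hasLift {V : Type} [MetricSpace V] {K₀ : Set V} (hK₀ : IsCompact K₀)
    {W : V × ℝ → Conf D.ωB} (hW : ContinuousOn W (K₀ ×ˢ Icc 0 1))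
    (hc : D.LocallyClear (K₀ ×ˢ Icc 0 1) W) {α α' : ℝ} (hα : α < α') (hα' : α' < 1) :
    ∃ δ > 0, ∀ K A : Set V, IsCell K A → K ⊆ K₀ → (∀ x ∈ K, ∀ x' ∈ K, dist x x' ≤ δ) →
      ∀ α₁, -1 < α₁ → α₁ < α → D.HasLift K A W α₁ α' := by
  classical
  let c : Ioo α α' → Set (V × ℝ) := fun β =>
    {p | ∀ᶠ p' in 𝓝 p, p' ∈ K₀ ×ˢ Icc (0 : ℝ) 1 → D.IsClear β.1 (W p')}
  obtain ⟨δ, hδ, hcov⟩ := lebesgue_number_lemma_of_metric (hK₀.prod isCompact_Icc) (c := c)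
    (fun β => isOpen_setOfPred_eventually_nhds) (by
      intro p hp
      obtain ⟨b, hb, h⟩ := hc p hp α α' hα
      rw [eventually_nhdsWithin_iff] at h
      exact mem_iUnion.2 ⟨⟨b, hb⟩, h⟩)
  obtain ⟨M, hM⟩ := exists_nat_gt (1 / δ)
  have hM0 : (0 : ℝ) < M := (one_div_pos.2 hδ).trans hM
  have hMδ : 1 / (M : ℝ) < δ := by
    rw [div_lt_iff₀ hM0, mul_comm]; rwa [div_lt_iff₀ hδ] at hM
  refine ⟨δ / 2, half_pos hδ, fun K A hK hKK₀ hdist α₁ hα₁ hα₁α => ?_⟩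
  have key : ∀ k : ℕ, ∃ β, (α < β ∧ β < α') ∧ (k ≤ M → ∀ x ∈ K, ∀ t ∈ Icc (0 : ℝ) 1,
      t ∈ Icc ((k : ℝ) / M) ((k + 1 : ℕ) / M) → D.IsClear β (W (x, t))) := by
    intro k
    by_cases hk : k ≤ M ∧ K.Nonempty
    · obtain ⟨hk, x₀, hx₀⟩ := hk
      have hkI : (k : ℝ) / M ∈ Icc (0 : ℝ) 1 :=
        ⟨by positivity, (div_le_one hM0).2 (by exact_mod_cast hk)⟩
      obtain ⟨⟨β, hβ⟩, hball⟩ := hcov (x₀, (k : ℝ) / M) ⟨hKK₀ hx₀, hkI⟩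
      refine ⟨β, ⟨hβ.1, hβ.2⟩, fun _ x hx t ht ht' => ?_⟩
      have : (x, t) ∈ c ⟨β, hβ⟩ := by
        refine hball ?_
        rw [mem_ball, Prod.dist_eq]
        refine max_lt ((hdist x hx x₀ hx₀).trans_lt (half_lt_self hδ)) ?_
        rw [Real.dist_eq, abs_of_nonneg (sub_nonneg.2 ht'.1)]
        refine lt_of_le_of_lt ?_ hMδ
        have := ht'.2
        push_cast at this
        rw [add_div] at this
        linarith
      exact this.self_of_nhds ⟨hKK₀ hx, ht⟩
    · refine ⟨(α + α') / 2, ⟨by linarith, by linarith⟩, fun h x hx => ?_⟩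
      exact absurd ⟨h, x, hx⟩ hk
  choose β hβ hclear using key
  refine D.hasLift_of_subdivision hK (hW.mono (prod_mono hKK₀ subset_rfl)) hα₁ hα'
    (τ := fun k => (k : ℝ) / M) (β := β) (N := M) (by simp) (div_self hM0.ne') ?_
    (fun k _ => ⟨hα₁α.trans (hβ k).1, (hβ k).2⟩) hclear
  intro k k' h
  exact div_lt_div_of_pos_right (by exact_mod_cast h) hM0

/-- The homotopy lifting property for boxes of dimension `d`. -/
def LiftProp (d : ℕ) : Prop :=
  ∀ (α α' : ℝ), -1 < α → α < α' → α' < 1 → ∀ a b : Fin d → ℝ, (∀ j, a j < b j) →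
    ∀ W : (Fin d → ℝ) × ℝ → Conf D.ωB, ContinuousOn W (Icc a b ×ˢ Icc 0 1) →
      D.LocallyClear (Icc a b ×ˢ Icc 0 1) W → D.HasLift (Icc a b) (boxBdry a b) W α α'

lemma hasLift_split {d : ℕ} (hd : D.LiftProp d) {α α₁ α' : ℝ} (hα : -1 < α) (hαα₁ : α < α₁)
    (hα₁ : α₁ < 1) {a b : Fin (d + 1) → ℝ} (hab : ∀ j, a j < b j)
    {W : (Fin (d + 1) → ℝ) × ℝ → Conf D.ωB} (hW : ContinuousOn W (Icc a b ×ˢ Icc 0 1))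
    (hc : D.LocallyClear (Icc a b ×ˢ Icc 0 1) W) (j : Fin (d + 1)) {r : ℝ} (har : a j < r)
    (hrb : r < b j)
    (h1 : D.HasLift (Icc a (Function.update b j r)) (boxBdry a (Function.update b j r)) W α₁ α')
    (h2 : D.HasLift (Icc (Function.update a j r) b) (boxBdry (Function.update a j r) b) W α₁ α') :
    D.HasLift (Icc a b) (boxBdry a b) W α α' := by
  classical
  intro e he hel
  set J := Icc a b ×ˢ {0} ∪ boxBdry a b ×ˢ Icc (0 : ℝ) 1 with hJ
  have hJc : IsClosed J := (isClosed_Icc.prod isClosed_singleton).union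
    ((isCell_box hab).isClosed_bdry.prod isClosed_Icc)
  have hJI : ∀ q ∈ J, q.2 ∈ Icc (0 : ℝ) 1 := by
    rintro ⟨x, t⟩ (h | h)
    · have : t = 0 := h.2
      simp [this]
    · exact h.2
  let φ : (Fin d → ℝ) × ℝ → (Fin (d + 1) → ℝ) × ℝ := fun q => (j.insertNth r q.1, q.2)
  have hφ : Continuous φ := by
    refine Continuous.prodMk ?_ continuous_snd
    exact Continuous.finInsertNth j continuous_const continuous_fst
  set a' : Fin d → ℝ := j.removeNth a with ha'
  set b' : Fin d → ℝ := j.removeNth b with hb'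
  have hwall : ∀ x : Fin d → ℝ, x ∈ Icc a' b' → (j.insertNth r x : Fin (d + 1) → ℝ) ∈ Icc a b := by
    intro x hx
    rw [mem_Icc, Fin.le_insertNth_iff, Fin.insertNth_le_iff]
    exact ⟨⟨har.le, hx.1⟩, hrb.le, hx.2⟩
  have hwallbd : ∀ x : Fin d → ℝ, x ∈ boxBdry a' b' →
      (j.insertNth r x : Fin (d + 1) → ℝ) ∈ boxBdry a b := by
    rintro x ⟨hx, k, hk⟩
    exact ⟨hwall x hx, j.succAbove k, by simp only [Fin.insertNth_apply_succAbove]; exact hk⟩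
  have hφJ : ∀ q ∈ Icc a' b' ×ˢ {0} ∪ boxBdry a' b' ×ˢ Icc (0 : ℝ) 1, φ q ∈ J := by
    rintro q (hq | hq)
    · exact Or.inl ⟨hwall _ hq.1, hq.2⟩
    · exact Or.inr ⟨hwallbd _ hq.1, hq.2⟩
  have hφK : MapsTo φ (Icc a' b' ×ˢ Icc 0 1) (Icc a b ×ˢ Icc 0 1) := fun q hq =>
    ⟨hwall _ hq.1, hq.2⟩
  have hα₂ : α < (α + α₁) / 2 ∧ (α + α₁) / 2 < α₁ := ⟨by linarith, by linarith⟩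
  obtain ⟨w, hw, hwJ, hwl⟩ := hd α ((α + α₁) / 2) hα hα₂.1 (hα₂.2.trans hα₁) a' b'
    (fun k => hab _) (W ∘ φ) (hW.comp hφ.continuousOn hφK) (hc.comp hφ.continuousOn hφK) (e ∘ φ)
    (he.comp hφ.continuousOn hφJ) (fun q hq => hel _ (hφJ q hq))
  let ψ : (Fin (d + 1) → ℝ) × ℝ → (Fin d → ℝ) × ℝ := fun q => (j.removeNth q.1, q.2)
  have hψ : Continuous ψ := by
    refine Continuous.prodMk ?_ continuous_snd
    exact continuous_pi fun k => (continuous_apply (j.succAbove k)).comp continuous_fst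
  have hφψ : ∀ q : (Fin (d + 1) → ℝ) × ℝ, q.1 j = r → φ (ψ q) = q := by
    rintro ⟨x, t⟩ h
    simp only at h
    simp [φ, ψ, ← h]
  have hψK : ∀ q ∈ Icc a b ×ˢ Icc (0 : ℝ) 1, ψ q ∈ Icc a' b' ×ˢ Icc (0 : ℝ) 1 := fun q hq =>
    ⟨⟨fun k => hq.1.1 _, fun k => hq.1.2 _⟩, hq.2⟩
  have hψJ : ∀ q ∈ J, q.1 j = r →
      ψ q ∈ Icc a' b' ×ˢ {0} ∪ boxBdry a' b' ×ˢ Icc (0 : ℝ) 1 := by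
    rintro ⟨x, t⟩ (hq | ⟨⟨hx, k, hk⟩, ht⟩) hj
    · exact Or.inl ⟨⟨fun k => hq.1.1 _, fun k => hq.1.2 _⟩, hq.2⟩
    · refine Or.inr ⟨⟨⟨fun k => hx.1 _, fun k => hx.2 _⟩, ?_⟩, ht⟩
      have hkj : k ≠ j := by
        rintro rfl
        change x k = a k ∨ x k = b k at hk
        change x k = r at hj
        rw [hj] at hk
        rcases hk with h | h
        · exact har.ne' h
        · exact hrb.ne h
      obtain ⟨k', rfl⟩ := Fin.exists_succAbove_eq hkj
      exact ⟨k', hk⟩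
  set e₀ : (Fin (d + 1) → ℝ) × ℝ → Conf D.ωE := fun q => if q.1 j = r then w (ψ q) else e q
    with he₀
  set J' : Set ((Fin (d + 1) → ℝ) × ℝ) := J ∪ {q | q ∈ Icc a b ×ˢ Icc (0 : ℝ) 1 ∧ q.1 j = r}
    with hJ'
  have hJK : ∀ q ∈ J, q ∈ Icc a b ×ˢ Icc (0 : ℝ) 1 := by
    rintro q (h | h)
    · exact ⟨h.1, hJI q (Or.inl h)⟩
    · exact ⟨h.1.1, h.2⟩
  have hJ'K : ∀ q ∈ J', q ∈ Icc a b ×ˢ Icc (0 : ℝ) 1 := by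
    rintro q (h | h)
    · exact hJK q h
    · exact h.1
  have hwe : ∀ q ∈ J, q.1 j = r → w (ψ q) = e q := by
    intro q hq h
    rw [hwJ _ (hψJ q hq h)]
    simp only [Function.comp_apply, hφψ q h]
  have he₀c : ContinuousOn e₀ J' := by
    refine continuousOn_ite_of_isClosed (S := {q : (Fin (d + 1) → ℝ) × ℝ | q.1 j = r}) (T := J)
      (isClosed_eq (by fun_prop) continuous_const) hJc ?_ (he.mono inter_subset_left)
      (fun _ _ h => h) (fun q hq h => ?_) fun q _ h h' => hwe q h' h
    · exact hw.comp hψ.continuousOn fun q hq => hψK q (hJ'K q hq.2)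
    · exact hq.resolve_right fun h' => h h'.2
  have he₀J : ∀ q ∈ J, e₀ q = e q := by
    intro q hq
    simp only [he₀]
    split_ifs with h
    · exact hwe q hq h
    · rfl
  have he₀l : ∀ q ∈ J', D.LiftsAbove α₁ (e₀ q) (W q) := by
    intro q hq
    simp only [he₀]
    split_ifs with h
    · have := hwl (ψ q) (hψK q (hJ'K q hq))
      simp only [Function.comp_apply, hφψ q h] at this
      exact this.mono hα₂.2.le
    · exact (hel q (hq.resolve_right fun h' => h h'.2)).mono hαα₁.le
  have hleft : ∀ x : Fin (d + 1) → ℝ, x ∈ Icc a (Function.update b j r) ↔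
      x ∈ Icc a b ∧ x j ≤ r := by
    intro x
    simp only [mem_Icc, le_update_iff]
    constructor
    · rintro ⟨h1, h2, h3⟩
      refine ⟨⟨h1, fun k => ?_⟩, h2⟩
      by_cases hk : k = j
      · subst hk; exact h2.trans hrb.le
      · exact h3 k hk
    · rintro ⟨⟨h1, h2⟩, h3⟩
      exact ⟨h1, h3, fun k _ => h2 k⟩
  have hright : ∀ x : Fin (d + 1) → ℝ, x ∈ Icc (Function.update a j r) b ↔
      x ∈ Icc a b ∧ r ≤ x j := by
    intro x
    simp only [mem_Icc, update_le_iff]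
    constructor
    · rintro ⟨⟨h2, h3⟩, h1⟩
      refine ⟨⟨fun k => ?_, h1⟩, h2⟩
      by_cases hk : k = j
      · subst hk; exact har.le.trans h2
      · exact h3 k hk
    · rintro ⟨⟨h1, h2⟩, h3⟩
      exact ⟨⟨h3, fun k _ => h1 k⟩, h2⟩
  have hsub1 : ∀ q ∈ Icc a (Function.update b j r) ×ˢ {0} ∪
      boxBdry a (Function.update b j r) ×ˢ Icc (0 : ℝ) 1, q ∈ J' := by
    rintro ⟨x, t⟩ (hq | ⟨⟨hx, k, hk⟩, ht⟩)
    · exact Or.inl (Or.inl ⟨((hleft x).1 hq.1).1, hq.2⟩)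
    · by_cases hxr : x j = r
      · exact Or.inr ⟨⟨((hleft x).1 hx).1, ht⟩, hxr⟩
      · refine Or.inl (Or.inr ⟨⟨((hleft x).1 hx).1, k, hk.imp id fun h => ?_⟩, ht⟩)
        have hkj : k ≠ j := by rintro rfl; exact hxr (by simpa using h)
        simpa [hkj] using h
  have hsub2 : ∀ q ∈ Icc (Function.update a j r) b ×ˢ {0} ∪
      boxBdry (Function.update a j r) b ×ˢ Icc (0 : ℝ) 1, q ∈ J' := by
    rintro ⟨x, t⟩ (hq | ⟨⟨hx, k, hk⟩, ht⟩)
    · exact Or.inl (Or.inl ⟨((hright x).1 hq.1).1, hq.2⟩)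
    · by_cases hxr : x j = r
      · exact Or.inr ⟨⟨((hright x).1 hx).1, ht⟩, hxr⟩
      · refine Or.inl (Or.inr ⟨⟨((hright x).1 hx).1, k, hk.imp (fun h => ?_) id⟩, ht⟩)
        have hkj : k ≠ j := by rintro rfl; exact hxr (by simpa using h)
        simpa [hkj] using h
  obtain ⟨e₁, he₁, he₁J, he₁l⟩ := h1 e₀ (he₀c.mono hsub1) fun q hq => he₀l q (hsub1 q hq)
  obtain ⟨e₂, he₂, he₂J, he₂l⟩ := h2 e₀ (he₀c.mono hsub2) fun q hq => he₀l q (hsub2 q hq)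
  refine ⟨fun q => if q.1 j ≤ r then e₁ q else e₂ q, ?_, ?_, ?_⟩
  · refine continuousOn_ite_le (φ := fun q : (Fin (d + 1) → ℝ) × ℝ => q.1 j) (by fun_prop)
      (he₁.mono ?_) (he₂.mono ?_) ?_
    · exact fun q hq => ⟨(hleft _).2 ⟨hq.1.1, hq.2⟩, hq.1.2⟩
    · exact fun q hq => ⟨(hright _).2 ⟨hq.1.1, hq.2⟩, hq.1.2⟩
    · intro q hq h
      rw [he₁J q (Or.inr ⟨⟨(hleft _).2 ⟨hq.1, h.le⟩, j, Or.inr (by simpa using h)⟩, hq.2⟩),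
        he₂J q (Or.inr ⟨⟨(hright _).2 ⟨hq.1, h.ge⟩, j, Or.inl (by simpa using h)⟩, hq.2⟩)]
  · rintro ⟨x, t⟩ hq
    simp only
    rw [← he₀J _ hq]
    split_ifs with h
    · refine he₁J _ (hq.imp (fun h' => ⟨(hleft x).2 ⟨h'.1, h⟩, h'.2⟩) fun h' =>
        ⟨⟨(hleft x).2 ⟨h'.1.1, h⟩, ?_⟩, h'.2⟩)
      obtain ⟨k, hk⟩ := h'.1.2
      by_cases hkj : k = j
      · subst hkj
        exact ⟨k, hk.imp id fun h'' => absurd h (not_le.2 (hrb.trans_eq h''.symm))⟩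
      · exact ⟨k, by simpa [hkj] using hk⟩
    · have h := (not_le.1 h).le
      refine he₂J _ (hq.imp (fun h' => ⟨(hright x).2 ⟨h'.1, h⟩, h'.2⟩) fun h' =>
        ⟨⟨(hright x).2 ⟨h'.1.1, h⟩, ?_⟩, h'.2⟩)
      obtain ⟨k, hk⟩ := h'.1.2
      by_cases hkj : k = j
      · subst hkj
        exact ⟨k, hk.imp (fun h'' => absurd h (not_le.2 (h''.trans_lt har))) id⟩
      · exact ⟨k, by simpa [hkj] using hk⟩
  · rintro ⟨x, t⟩ hq
    simp only
    split_ifs with h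
    · exact he₁l _ ⟨(hleft x).2 ⟨hq.1, h⟩, hq.2⟩
    · exact he₂l _ ⟨(hright x).2 ⟨hq.1, (not_le.1 h).le⟩, hq.2⟩

lemma liftProp (d : ℕ) : D.LiftProp d := by
  classical
  suffices h : ∀ d : ℕ, (∀ d', d = d' + 1 → D.LiftProp d') → D.LiftProp d by
    induction d with
    | zero => exact h 0 fun d' h => absurd h (by omega)
    | succ d ih => exact h (d + 1) fun d' h => by obtain rfl : d = d' := by omega
                                                  exact ih
  intro d hd α α' hα hαα' hα' a₀ b₀ hab₀ W hW hc
  obtain ⟨δ, hδ, hsmall⟩ := D.exists_small_hasLift isCompact_Icc hW hc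
    (show (α + α') / 2 < α' by linarith) hα'
  have main : ∀ M : ℕ, ∀ a b : Fin d → ℝ, (∀ j, a j < b j) → a₀ ≤ a → b ≤ b₀ →
      ∑ j, ⌊2 * (b j - a j) / δ⌋₊ ≤ M → ∀ α₁, -1 < α₁ → α₁ < (α + α') / 2 →
        D.HasLift (Icc a b) (boxBdry a b) W α₁ α' := by
    intro M
    induction M with
    | zero =>
      intro a b hab ha hb hM
      refine hsmall _ _ (isCell_box hab) (Icc_subset_Icc ha hb) fun x hx x' hx' => ?_
      rw [dist_pi_le_iff hδ.le]
      intro j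
      have h0 : ⌊2 * (b j - a j) / δ⌋₊ = 0 := by
        have := Finset.single_le_sum (f := fun j => ⌊2 * (b j - a j) / δ⌋₊) (fun _ _ => Nat.zero_le _)
          (Finset.mem_univ j)
        omega
      rw [Nat.floor_eq_zero, div_lt_one hδ] at h0
      rw [Real.dist_eq, abs_le]
      constructor <;> linarith [hx.1 j, hx.2 j, hx'.1 j, hx'.2 j]
    | succ M ih =>
      intro a b hab ha hb hM α₁ hα₁ hα₁'
      by_cases hs : ∀ j, b j - a j ≤ δ
      · refine hsmall _ _ (isCell_box hab) (Icc_subset_Icc ha hb) (fun x hx x' hx' => ?_) α₁ hα₁ hα₁'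
        rw [dist_pi_le_iff hδ.le]
        intro j
        rw [Real.dist_eq, abs_le]
        constructor <;> linarith [hx.1 j, hx.2 j, hx'.1 j, hx'.2 j, hs j]
      push Not at hs
      obtain ⟨j, hj⟩ := hs
      obtain ⟨d, rfl⟩ : ∃ d', d = d' + 1 := ⟨d - 1, by have := j.pos; omega⟩
      have hαm : α₁ < (α₁ + (α + α') / 2) / 2 ∧ (α₁ + (α + α') / 2) / 2 < (α + α') / 2 :=
        ⟨by linarith, by linarith⟩
      have hsum : ∀ a' b' : Fin (d + 1) → ℝ, (∀ k, k ≠ j → a' k = a k ∧ b' k = b k) →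
          2 * (b' j - a' j) / δ + 1 ≤ 2 * (b j - a j) / δ → 0 ≤ 2 * (b' j - a' j) / δ →
          ∑ k, ⌊2 * (b' k - a' k) / δ⌋₊ ≤ M := by
        intro a' b' h h' h0
        have : ∑ k, ⌊2 * (b' k - a' k) / δ⌋₊ < ∑ k, ⌊2 * (b k - a k) / δ⌋₊ := by
          refine Finset.sum_lt_sum (fun k _ => ?_) ⟨j, Finset.mem_univ j, ?_⟩
          · by_cases hk : k = j
            · subst hk; exact Nat.floor_le_floor (by linarith)
            · rw [(h k hk).1, (h k hk).2]
          · have := Nat.floor_le_floor h'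
            rw [Nat.floor_add_one h0] at this
            omega
        omega
      refine D.hasLift_split (hd d rfl) hα₁ hαm.1 (by linarith) hab
        (hW.mono (prod_mono (Icc_subset_Icc ha hb) subset_rfl)) ?_ j (r := a j + δ / 2)
        (by linarith) (by linarith) (ih _ _ ?_ ha ?_ ?_ _ (by linarith) hαm.2)
        (ih _ _ ?_ ?_ hb ?_ _ (by linarith) hαm.2)
      · exact hc.comp (f := id) continuousOn_id
          fun q hq => prod_mono (Icc_subset_Icc ha hb) subset_rfl hq
      · intro k
        by_cases hk : k = j
        · subst hk; simp [hδ]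
        · simp [hk, hab k]
      · refine le_trans ?_ hb
        rw [update_le_iff]
        exact ⟨by linarith, fun _ _ => le_rfl⟩
      · refine hsum _ _ (fun k hk => by simp [hk]) ?_ ?_
        · simp only [Function.update_self]
          rw [div_add_one hδ.ne']
          exact div_le_div_of_nonneg_right (by linarith) hδ.le
        · simp only [Function.update_self]
          exact div_nonneg (by linarith) hδ.le
      · intro k
        by_cases hk : k = j
        · subst hk; simp only [Function.update_self]; linarith
        · simp [hk, hab k]
      · refine ha.trans ?_
        rw [le_update_iff]
        exact ⟨by linarith, fun _ _ => le_rfl⟩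
      · refine hsum _ _ (fun k hk => by simp [hk]) ?_ ?_
        · simp only [Function.update_self]
          rw [div_add_one hδ.ne']
          exact div_le_div_of_nonneg_right (by linarith) hδ.le
        · simp only [Function.update_self]
          exact div_nonneg (by linarith) hδ.le
  intro e he hel
  exact main _ a₀ b₀ hab₀ le_rfl le_rfl le_rfl α hα (by linarith) e he hel

end ScanData

/-- An order embedding of the real line into `(-1, 1)`. -/
def squash (s : ℝ) : ℝ := s / (1 + |s|)

lemma one_add_abs_pos (s : ℝ) : 0 < 1 + |s| := by positivity

lemma continuous_squash : Continuous squash :=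
  continuous_id.div (by fun_prop) fun s => (one_add_abs_pos s).ne'

lemma abs_squash_lt (s : ℝ) : |squash s| < 1 := by
  rw [squash, abs_div, abs_of_pos (one_add_abs_pos s), div_lt_one (one_add_abs_pos s)]
  linarith

lemma squash_strictMono : StrictMono squash := by
  intro s t h
  rw [squash, squash, div_lt_div_iff₀ (one_add_abs_pos s) (one_add_abs_pos t)]
  rcases abs_cases s with ⟨h1, h1'⟩ | ⟨h1, h1'⟩ <;> rcases abs_cases t with ⟨h2, h2'⟩ | ⟨h2, h2'⟩ <;>
    rw [h1, h2] <;> nlinarith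

lemma Conf.map_eq_self {P L : Type*} {ω : P × L → ℝ} {F : P × L → P × L} (hF : VisInj ω F)
    {c : Conf ω} (h : ∀ y ∈ c, F y = y) : map ω F c = c := by
  ext y
  rw [mem_map hF]
  constructor
  · rintro ⟨y₀, h0, rfl, -⟩
    rwa [h _ h0]
  · exact fun hy => ⟨y, hy, h y hy, c.pos hy⟩

lemma update_injective {n : ℕ} {i : Fin n} {r : ℝ → ℝ} (hr : Function.Injective r)
    {z z' : Fin n → ℝ} (h : Function.update z i (r (z i)) = Function.update z' i (r (z' i))) :
    z = z' := by
  funext j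
  have := congr_fun h j
  by_cases hj : j = i
  · subst hj
    simp only [Function.update_self] at this
    exact hr this
  · simpa [hj] using this

namespace ScanData

variable {n : ℕ} {L : Type*} [TopologicalSpace L] (D : ScanData n L)

/-- The zoom at the level of labelled points. -/
def zoomFun (t : ℝ) (y : (Fin n → ℝ) × L) : (Fin n → ℝ) × L := ((1 + t) • y.1, D.q (t, y.2))

lemma continuous_zoomFun :
    Continuous fun p : ℝ × ((Fin n → ℝ) × L) => D.zoomFun p.1 p.2 := by
  have := D.continuous_q
  unfold zoomFun
  fun_prop

@[simp] lemma zoomFun_fst (t : ℝ) (y : (Fin n → ℝ) × L) (j : Fin n) :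
    (D.zoomFun t y).1 j = (1 + t) * y.1 j := rfl

lemma zoomFun_zero (y : (Fin n → ℝ) × L) : D.zoomFun 0 y = y := by
  simp [zoomFun, D.q_zero]

lemma zoomFun_fst_injective {t : ℝ} (ht : 0 ≤ t) {y y' : (Fin n → ℝ) × L}
    (h : (D.zoomFun t y).1 = (D.zoomFun t y').1) : y.1 = y'.1 :=
  smul_right_injective _ (by positivity : (1 + t) ≠ 0) h

lemma visInj_zoomFun {t : ℝ} (ht : 0 ≤ t) (ω' : (Fin n → ℝ) × L → ℝ) :
    Conf.VisInj ω' (D.zoomFun t) := fun _ _ _ _ h => D.zoomFun_fst_injective ht h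

lemma ω_zoomFun_le {t : ℝ} (ht : 0 ≤ t) (y : (Fin n → ℝ) × L) : D.ω (D.zoomFun t y) ≤ D.ω y :=
  D.ω_le t y.1 y.2 ht

lemma ωB_zoomFun_le {t : ℝ} (ht : 0 ≤ t) (y : (Fin n → ℝ) × L) :
    D.ωB (D.zoomFun t y) ≤ D.ωB y := by
  refine min_le_min (D.ω_zoomFun_le ht y) ?_
  rw [zoomFun_fst, abs_mul, abs_of_nonneg (by positivity : 0 ≤ 1 + t)]
  nlinarith [abs_nonneg (y.1 D.i)]

lemma ωE_zoomFun_le {t : ℝ} (ht : 0 ≤ t) (y : (Fin n → ℝ) × L) :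
    min (D.ωE (D.zoomFun t y)) 1 ≤ D.ωE y := by
  refine le_min ((min_le_left _ _).trans ((min_le_left _ _).trans (D.ω_zoomFun_le ht y))) ?_
  by_cases h : 0 ≤ y.1 D.i
  · refine (min_le_left _ _).trans ((min_le_right _ _).trans ?_)
    rw [zoomFun_fst]
    nlinarith
  · exact (min_le_right _ _).trans (by linarith)

lemma continuousOn_zoom {ω' : (Fin n → ℝ) × L → ℝ} (hω' : Continuous ω')
    (h : ∀ t y, 0 ≤ t → min (ω' (D.zoomFun t y)) 1 ≤ ω' y) :
    ContinuousOn (fun p : Conf ω' × ℝ => Conf.map ω' (D.zoomFun p.2) p.1) (univ ×ˢ Icc 0 1) := by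
  refine Conf.continuousOn_map hω' hω' continuousOn_fst (Φ := fun p => D.zoomFun p.2) ?_
    (fun p hp => D.visInj_zoomFun hp.2.1 _) fun θ hθ => ⟨min θ 1, by positivity, ?_⟩
  · exact (D.continuous_zoomFun.comp
      (by fun_prop : Continuous fun q : (Conf ω' × ℝ) × ((Fin n → ℝ) × L) => (q.1.2, q.2))).continuousOn
  · exact fun p hp y _ hy => (min_le_min hy le_rfl).trans (h _ y hp.2.1)

lemma wEq_zoom {ω' : (Fin n → ℝ) × L → ℝ} (hω' : Continuous ω')
    (h : ∀ t y, 0 ≤ t → min (ω' (D.zoomFun t y)) 1 ≤ ω' y) :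
    WEq (Conf.map ω' (D.zoomFun 1) : Conf ω' → Conf ω') :=
  WEq.of_homotopic_id (D.continuousOn_zoom hω' h)
    (fun _ => Conf.map_eq_self (D.visInj_zoomFun le_rfl _) fun y _ => D.zoomFun_zero y) fun _ => rfl

/-- Zooming into the window. -/
def zoomB : Conf D.ωB → Conf D.ωB := Conf.map D.ωB (D.zoomFun 1)

/-- Zooming into the half space. -/
def zoomE : Conf D.ωE → Conf D.ωE := Conf.map D.ωE (D.zoomFun 1)

/-- Zooming from the half space into the window. -/
def zoomEB : Conf D.ωE → Conf D.ωB := Conf.map D.ωB (D.zoomFun 1)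

lemma mem_zoomB {c : Conf D.ωB} {y : (Fin n → ℝ) × L} :
    y ∈ D.zoomB c ↔ ∃ y₀ ∈ c, D.zoomFun 1 y₀ = y ∧ 0 < D.ωB y :=
  Conf.mem_map (D.visInj_zoomFun zero_le_one _)

lemma mem_zoomE {c : Conf D.ωE} {y : (Fin n → ℝ) × L} :
    y ∈ D.zoomE c ↔ ∃ y₀ ∈ c, D.zoomFun 1 y₀ = y ∧ 0 < D.ωE y :=
  Conf.mem_map (D.visInj_zoomFun zero_le_one _)

lemma mem_zoomEB {c : Conf D.ωE} {y : (Fin n → ℝ) × L} :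
    y ∈ D.zoomEB c ↔ ∃ y₀ ∈ c, D.zoomFun 1 y₀ = y ∧ 0 < D.ωB y :=
  Conf.mem_map (D.visInj_zoomFun zero_le_one _)

lemma wEq_zoomB : WEq D.zoomB :=
  D.wEq_zoom D.continuous_ωB fun _ y ht => (min_le_left _ _).trans (D.ωB_zoomFun_le ht y)

lemma _root_.Scan.continuous_of_continuousOn_univ_prod {Z Z' : Type*} [TopologicalSpace Z]
    [TopologicalSpace Z'] {h : Z × ℝ → Z'} (hc : ContinuousOn h (univ ×ˢ Icc 0 1)) {t : ℝ}
    (ht : t ∈ Icc (0 : ℝ) 1) : Continuous fun z => h (z, t) := by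
  rw [← continuousOn_univ]
  exact hc.comp (f := fun z => (z, t)) (by fun_prop) fun z _ => ⟨mem_univ _, ht⟩

lemma continuous_zoomB : Continuous D.zoomB :=
  continuous_of_continuousOn_univ_prod (D.continuousOn_zoom D.continuous_ωB
    fun _ y ht => (min_le_left _ _).trans (D.ωB_zoomFun_le ht y)) (by simp)

lemma continuous_zoomE : Continuous D.zoomE :=
  continuous_of_continuousOn_univ_prod (D.continuousOn_zoom D.continuous_ωE
    fun _ y ht => D.ωE_zoomFun_le ht y) (by simp)

lemma continuous_zoomEB : Continuous D.zoomEB := by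
  rw [← continuousOn_univ]
  refine Conf.continuousOn_map (Φ := fun _ => D.zoomFun 1) D.continuous_ωE D.continuous_ωB
    continuousOn_id ?_ (fun _ _ => D.visInj_zoomFun zero_le_one _) fun θ hθ => ⟨θ, hθ, ?_⟩
  · exact (D.continuous_zoomFun.comp
      (by fun_prop : Continuous fun q : Conf D.ωE × ((Fin n → ℝ) × L) => ((1 : ℝ), q.2))).continuousOn
  · exact fun c _ y _ h => h.trans ((D.ωB_zoomFun_le zero_le_one y).trans (D.ωB_le_ωE y))

lemma locallyClear_zoomB {X : Type*} [TopologicalSpace X] {U : Set X} {v : X → Conf D.ωB}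
    (hv : ContinuousOn v U) : D.LocallyClear U (fun x => D.zoomB (v x)) := by
  intro p hp β β' hβ
  obtain ⟨b, hb, hbv⟩ : ∃ b ∈ Ioo β β', ∀ y ∈ v p, 2 * y.1 D.i ≠ b := by
    have : ((fun y : (Fin n → ℝ) × L => 2 * y.1 D.i) '' (v p : Set ((Fin n → ℝ) × L))).Finite :=
      (v p).finite.image _
    obtain ⟨b, hb, hb'⟩ := (Ioo_infinite hβ).exists_notMem_finite this
    exact ⟨b, hb, fun y hy h => hb' ⟨y, hy, h⟩⟩
  refine ⟨b, hb, ?_⟩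
  have hD : IsClosed {y : (Fin n → ℝ) × L | 1 / 2 ≤ D.ωB y ∧ 2 * y.1 D.i = b} :=
    (isClosed_le continuous_const D.continuous_ωB).inter
      (isClosed_eq (by fun_prop) continuous_const)
  filter_upwards [((Conf.tendsto_iff_basic.1 (hv p hp)).2 _ hD
    ⟨1 / 2, by norm_num, fun y hy => hy.1⟩).1 fun y hy h => hbv y hy h.2] with p' h y hy
  obtain ⟨y₀, hy₀, rfl, hpos⟩ := D.mem_zoomB.1 hy
  intro hb0
  rw [zoomFun_fst] at hb0
  refine h y₀ hy₀ ⟨le_min ?_ ?_, by linarith⟩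
  · refine D.ω_pos y₀.1 y₀.2 ?_
    have := hpos.trans_le (min_le_left _ _)
    rwa [zoomFun, show (1 : ℝ) + 1 = 2 by norm_num] at this
  · have := hpos.trans_le (min_le_right _ _)
    rw [zoomFun_fst, abs_mul, abs_of_pos (by norm_num : (0 : ℝ) < 1 + 1)] at this
    linarith

/-- Scanning at the level of labelled points. -/
def scanFun (t : ℝ) (y : (Fin n → ℝ) × L) : (Fin n → ℝ) × L :=
  (Function.update y.1 D.i (squash (y.1 D.i) - 2 * t), y.2)

lemma continuous_scanFun :
    Continuous fun p : ℝ × ((Fin n → ℝ) × L) => D.scanFun p.1 p.2 :=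
  D.continuous_shift (fun t s => squash s - 2 * t)
    ((continuous_squash.comp continuous_snd).sub (continuous_const.mul continuous_fst))

@[simp] lemma scanFun_fst (t : ℝ) (y : (Fin n → ℝ) × L) :
    (D.scanFun t y).1 D.i = squash (y.1 D.i) - 2 * t := by simp [scanFun]

lemma visInj_scanFun (t : ℝ) (ω' : (Fin n → ℝ) × L → ℝ) : Conf.VisInj ω' (D.scanFun t) :=
  fun _ _ _ _ h => update_injective (r := fun s => squash s - 2 * t)
    (fun _ _ h => squash_strictMono.injective (sub_left_injective h)) h

lemma ω_scanFun (t : ℝ) (y : (Fin n → ℝ) × L) : D.ω (D.scanFun t y) = D.ω y :=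
  D.ω_update _ _ _

/-- Scanning a configuration through the window `|z i| < 1`. -/
def scan (c : Conf D.ω) (t : ℝ) : Conf D.ωB := Conf.map D.ωB (D.scanFun t) c

/-- Scanning a configuration through the half space `z i < 1`. -/
def escan (c : Conf D.ω) (t : ℝ) : Conf D.ωE := Conf.map D.ωE (D.scanFun t) c

lemma mem_scan {c : Conf D.ω} {t : ℝ} {y : (Fin n → ℝ) × L} :
    y ∈ D.scan c t ↔ ∃ y₀ ∈ c, D.scanFun t y₀ = y ∧ 0 < D.ωB y :=
  Conf.mem_map (D.visInj_scanFun t _)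

lemma mem_escan {c : Conf D.ω} {t : ℝ} {y : (Fin n → ℝ) × L} :
    y ∈ D.escan c t ↔ ∃ y₀ ∈ c, D.scanFun t y₀ = y ∧ 0 < D.ωE y :=
  Conf.mem_map (D.visInj_scanFun t _)

lemma continuous_map_scanFun {ω' : (Fin n → ℝ) × L → ℝ} (hω' : Continuous ω')
    (h : ∀ y, ω' y ≤ D.ω y) :
    Continuous fun p : Conf D.ω × ℝ => Conf.map ω' (D.scanFun p.2) p.1 := by
  rw [← continuousOn_univ]
  refine Conf.continuousOn_map D.continuous_ω hω' continuousOn_fst (Φ := fun p => D.scanFun p.2) ?_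
    (fun p hp => D.visInj_scanFun p.2 _) fun θ hθ => ⟨θ, hθ, ?_⟩
  · exact (D.continuous_scanFun.comp (by fun_prop :
      Continuous fun q : (Conf D.ω × ℝ) × ((Fin n → ℝ) × L) => (q.1.2, q.2))).continuousOn
  · exact fun p _ y _ hy => hy.trans ((h _).trans (D.ω_scanFun p.2 y).le)

lemma continuous_scan : Continuous fun p : Conf D.ω × ℝ => D.scan p.1 p.2 :=
  D.continuous_map_scanFun D.continuous_ωB fun _ => min_le_left _ _

lemma continuous_escan : Continuous fun p : Conf D.ω × ℝ => D.escan p.1 p.2 :=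
  D.continuous_map_scanFun D.continuous_ωE fun _ => min_le_left _ _

lemma scan_eq_empty {c : Conf D.ω} {t : ℝ} (ht : 1 ≤ |t|) : D.scan c t = ∅ := by
  rw [Conf.eq_empty_iff]
  intro y hy
  obtain ⟨y₀, -, rfl, h⟩ := D.mem_scan.1 hy
  have h1 := h.trans_le (min_le_right _ _)
  rw [scanFun_fst] at h1
  have h2 := abs_squash_lt (y₀.1 D.i)
  have h3 : |2 * t| = 2 * |t| := by rw [abs_mul]; norm_num
  have h4 := abs_sub_abs_le_abs_sub (2 * t) (squash (y₀.1 D.i))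
  rw [abs_sub_comm] at h4
  linarith

lemma escan_eq_empty {c : Conf D.ω} : D.escan c (-1) = ∅ := by
  rw [Conf.eq_empty_iff]
  intro y hy
  obtain ⟨y₀, -, rfl, h⟩ := D.mem_escan.1 hy
  have h1 := h.trans_le (min_le_right _ _)
  rw [scanFun_fst] at h1
  linarith [(abs_lt.1 (abs_squash_lt (y₀.1 D.i))).1]

lemma zoomEB_zoomE_escan (c : Conf D.ω) (t : ℝ) :
    D.zoomEB (D.zoomE (D.escan c t)) = D.zoomB (D.zoomB (D.scan c t)) := by
  ext y
  simp only [mem_zoomEB, mem_zoomE, mem_escan, mem_zoomB, mem_scan]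
  constructor
  · rintro ⟨_, ⟨_, ⟨y₀, h0, rfl, -⟩, rfl, -⟩, rfl, h⟩
    have h1 := h.trans_le (D.ωB_zoomFun_le zero_le_one _)
    exact ⟨_, ⟨_, ⟨y₀, h0, rfl, h1.trans_le (D.ωB_zoomFun_le zero_le_one _)⟩, rfl, h1⟩, rfl, h⟩
  · rintro ⟨_, ⟨_, ⟨y₀, h0, rfl, -⟩, rfl, -⟩, rfl, h⟩
    have h1 := h.trans_le (D.ωB_zoomFun_le zero_le_one _)
    exact ⟨_, ⟨_, ⟨y₀, h0, rfl, (h1.trans_le (D.ωB_zoomFun_le zero_le_one _)).trans_le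
      (D.ωB_le_ωE _)⟩, rfl, h1.trans_le (D.ωB_le_ωE _)⟩, rfl, h⟩

lemma liftsAbove_zoomE_escan (c : Conf D.ω) (t : ℝ) {α : ℝ} (hα : -1 < α) :
    D.LiftsAbove α (D.zoomE (D.escan c t)) (D.zoomB (D.scan c t)) := by
  intro y hy
  simp only [mem_zoomE, mem_escan, mem_zoomB, mem_scan]
  constructor
  · rintro ⟨_, ⟨y₀, h0, rfl, -⟩, rfl, h⟩
    have h1 : 0 < D.ωB (D.zoomFun 1 (D.scanFun t y₀)) :=
      (lt_min h (by linarith)).trans_le (D.le_ωB le_rfl hy)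
    exact ⟨_, ⟨y₀, h0, rfl, h1.trans_le (D.ωB_zoomFun_le zero_le_one _)⟩, rfl, h1⟩
  · rintro ⟨_, ⟨y₀, h0, rfl, h⟩, rfl, h1⟩
    exact ⟨_, ⟨y₀, h0, rfl, h.trans_le (D.ωB_le_ωE _)⟩, rfl, h1.trans_le (D.ωB_le_ωE _)⟩

lemma zoomEB_eq_zoomB {e : Conf D.ωE} {w : Conf D.ωB} (h : D.LiftsAbove (-1 / 2) e w) :
    D.zoomEB e = D.zoomB w := by
  ext y
  simp only [mem_zoomEB, mem_zoomB]
  refine exists_congr fun y₀ => ?_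
  by_cases hy : -1 / 2 ≤ y₀.1 D.i
  · rw [h y₀ hy]
  · have : ¬ (D.zoomFun 1 y₀ = y ∧ 0 < D.ωB y) := by
      rintro ⟨rfl, h'⟩
      have h1 := h'.trans_le (min_le_right _ _)
      rw [zoomFun_fst] at h1
      linarith [neg_abs_le ((1 + 1) * y₀.1 D.i)]
    simp [this]

lemma zoomEB_eq_empty {e : Conf D.ωE} (h : ∀ y ∈ e, y.1 D.i < -1 / 2) : D.zoomEB e = ∅ := by
  rw [D.zoomEB_eq_zoomB (w := ∅) fun y hy => ?_]
  · rw [Conf.eq_empty_iff]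
    intro y hy
    obtain ⟨y₀, h0, -⟩ := D.mem_zoomB.1 hy
    exact Conf.notMem_empty _ h0
  · exact iff_of_false (fun hy' => absurd (h y hy') (not_lt.2 hy)) (Conf.notMem_empty _)

end ScanData

namespace ScanData

variable {n : ℕ} {L : Type*} [TopologicalSpace L] (D : ScanData n L)

lemma hrel_E {V : Type} [TopologicalSpace V] {K A : Set V} (hK : IsCell K A)
    {a b : V → Conf D.ωE} (ha : ContinuousOn a K) (hb : ContinuousOn b K)
    (hab : ∀ x ∈ A, a x = b x) : HRel univ K A a b := by
  let r : ℝ → (Fin n → ℝ) × L → (Fin n → ℝ) × L := fun τ y =>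
    (Function.update y.1 D.i ((1 - τ) * (y.1 D.i - 1) + 1), y.2)
  have hr : ∀ τ y, 1 - (r τ y).1 D.i = (1 - τ) * (1 - y.1 D.i) := by
    intro τ y; simp [r]; ring
  have hinj : ∀ τ ∈ Icc (0 : ℝ) 1, Conf.VisInj D.ωE (r τ) := by
    intro τ hτ y y' hy hy' h
    have h1 := hy.trans_le (min_le_right _ _)
    rw [hr] at h1
    have hτ1 : 1 - τ ≠ 0 := by rintro h; simp [h] at h1
    refine update_injective (r := fun s => (1 - τ) * (s - 1) + 1) (fun s t hst => ?_) h
    have : s - 1 = t - 1 := mul_left_cancel₀ hτ1 (add_right_cancel hst)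
    linarith
  refine hK.hrel_of_contractible (S := univ) (z₀ := ∅)
    (h := fun p => Conf.map D.ωE (r p.2) p.1) ?_ ?_ ?_ (fun _ _ _ _ => mem_univ _) ha hb
    (fun _ _ => mem_univ _) (fun _ _ => mem_univ _) hab
  · refine Conf.continuousOn_map D.continuous_ωE D.continuous_ωE continuousOn_fst
      (Φ := fun p => r p.2) ?_ (fun p hp => hinj _ hp.2) fun θ hθ => ⟨θ, hθ, ?_⟩
    · exact ((D.continuous_shift (fun τ s => (1 - τ) * (s - 1) + 1) (by fun_prop)).comp
        (by fun_prop : Continuous fun q : (Conf D.ωE × ℝ) × ((Fin n → ℝ) × L) =>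
          (q.1.2, q.2))).continuousOn
    · intro p hp y hy h
      have h0 := (p.1.pos hy).trans_le (min_le_right _ _)
      refine h.trans (min_le_min (D.ω_update _ _ _).le ?_)
      rw [hr]
      nlinarith [hp.2.1]
  · intro c _
    refine Conf.map_eq_self (hinj 0 (by simp)) fun y _ => ?_
    simp [r]
  · intro c _
    rw [Conf.eq_empty_iff]
    intro y hy
    obtain ⟨y₀, -, rfl, h⟩ := (Conf.mem_map (hinj 1 (by simp))).1 hy
    have h1 := h.trans_le (min_le_right _ _)
    rw [hr] at h1
    simp at h1

/-- The configurations which lie below the window. -/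
abbrev Low : Type _ := {c : Conf D.ω // ∀ y ∈ c, y.1 D.i < -1 / 2}

/-- The deformation from the identity to the expel map, at the level of labelled points. -/
def lowFun (τ : ℝ) (y : (Fin n → ℝ) × L) : (Fin n → ℝ) × L :=
  (Function.update (D.zoomFun τ y).1 D.i
    ((1 - τ) * y.1 D.i + τ * (2 * squash (y.1 D.i) - 4)), (D.zoomFun τ y).2)

lemma continuous_lowFun : Continuous fun p : ℝ × ((Fin n → ℝ) × L) => D.lowFun p.1 p.2 := by
  have h := D.continuous_zoomFun
  have hs := continuous_squash
  exact (h.fst.update D.i (by fun_prop)).prodMk h.snd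

lemma lowFun_fst (τ : ℝ) (y : (Fin n → ℝ) × L) :
    (D.lowFun τ y).1 D.i = (1 - τ) * y.1 D.i + τ * (2 * squash (y.1 D.i) - 4) := by
  simp [lowFun]

lemma ω_lowFun_le {τ : ℝ} (hτ : 0 ≤ τ) (y : (Fin n → ℝ) × L) : D.ω (D.lowFun τ y) ≤ D.ω y :=
  (D.ω_update _ _ _).trans_le (D.ω_zoomFun_le hτ y)

lemma visInj_lowFun {τ : ℝ} (hτ : τ ∈ Icc (0 : ℝ) 1) (ω' : (Fin n → ℝ) × L → ℝ) :
    Conf.VisInj ω' (D.lowFun τ) := by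
  intro y y' _ _ h
  funext j
  have hj := congr_fun h j
  by_cases hji : j = D.i
  · subst hji
    rw [lowFun_fst, lowFun_fst] at hj
    have hmono : StrictMono fun s : ℝ => (1 - τ) * s + τ * (2 * squash s - 4) := by
      intro s t hst
      have h1 := squash_strictMono hst
      rcases hτ.1.eq_or_lt with h0 | h0
      · simp only [← h0]; linarith
      · have := mul_nonneg (sub_nonneg.2 hτ.2) (sub_nonneg.2 hst.le)
        have := mul_pos h0 (sub_pos.2 h1)
        dsimp only
        nlinarith
    exact hmono.injective hj
  · simp only [lowFun, Function.update_of_ne hji, zoomFun_fst] at hj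
    exact mul_left_cancel₀ (by linarith [hτ.1] : (1 + τ) ≠ 0) hj

lemma lowFun_zero (y : (Fin n → ℝ) × L) : D.lowFun 0 y = y := by
  simp [lowFun, D.zoomFun_zero]

lemma continuousOn_map_lowFun : ContinuousOn
    (fun p : Conf D.ω × ℝ => (Conf.map D.ω (D.lowFun p.2) p.1 : Conf D.ω)) (univ ×ˢ Icc 0 1) := by
  refine Conf.continuousOn_map D.continuous_ω D.continuous_ω continuousOn_fst
    (Φ := fun p => D.lowFun p.2) ?_ (fun p hp => D.visInj_lowFun hp.2 _) fun θ hθ => ⟨θ, hθ, ?_⟩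
  · exact (D.continuous_lowFun.comp (by fun_prop :
      Continuous fun q : (Conf D.ω × ℝ) × ((Fin n → ℝ) × L) => (q.1.2, q.2))).continuousOn
  · exact fun p hp y _ hy => hy.trans (D.ω_lowFun_le hp.2.1 y)

lemma lowFun_lt {τ : ℝ} (hτ : τ ∈ Icc (0 : ℝ) 1) {y : (Fin n → ℝ) × L}
    (hy : τ = 1 ∨ y.1 D.i < -1 / 2) : (D.lowFun τ y).1 D.i < -1 / 2 := by
  have h1 := (abs_lt.1 (abs_squash_lt (y.1 D.i))).2
  rw [lowFun_fst]
  rcases hy with rfl | hy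
  · linarith
  · have h2 := mul_nonneg (sub_nonneg.2 hτ.2) (by linarith : 0 ≤ -1 / 2 - y.1 D.i)
    have h3 := mul_nonneg hτ.1 (by linarith : 0 ≤ 1 - squash (y.1 D.i))
    rcases hτ.1.eq_or_lt with h0 | h0
    · simpa [← h0] using hy
    · nlinarith

/-- The expel map, pushing all configurations below the window. -/
def expel (c : Conf D.ω) : D.Low :=
  ⟨Conf.map D.ω (D.lowFun 1) c, fun y hy => by
    obtain ⟨y₀, -, rfl, -⟩ := (Conf.mem_map (D.visInj_lowFun (by simp) _)).1 hy
    exact D.lowFun_lt (by simp) (Or.inl rfl)⟩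

lemma continuous_expel : Continuous D.expel :=
  (continuous_of_continuousOn_univ_prod D.continuousOn_map_lowFun (by simp)).subtype_mk _

lemma wEq_expel : WEq D.expel := by
  refine WEq.of_comp D.continuous_expel (g := Subtype.val) continuous_subtype_val ?_ ?_
  · exact WEq.of_homotopic_id D.continuousOn_map_lowFun
      (fun c => Conf.map_eq_self (D.visInj_lowFun (by simp) _) fun y _ => D.lowFun_zero y)
      fun _ => rfl
  · have hcl : ∀ t : ℝ, max 0 (min t 1) ∈ Icc (0 : ℝ) 1 := fun t =>
      ⟨le_max_left _ _, max_le zero_le_one (min_le_right _ _)⟩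
    refine WEq.of_homotopic_id (h := fun p => ⟨Conf.map D.ω (D.lowFun (max 0 (min p.2 1))) p.1.1,
      fun y hy => ?_⟩) ?_ ?_ ?_
    · obtain ⟨y₀, h0, rfl, -⟩ := (Conf.mem_map (D.visInj_lowFun (hcl _) _)).1 hy
      exact D.lowFun_lt (hcl _) (Or.inr (p.1.2 _ h0))
    · refine Topology.IsInducing.subtypeVal.continuousOn_iff.2 ?_
      refine D.continuousOn_map_lowFun.comp
        (f := fun p : D.Low × ℝ => (p.1.1, max 0 (min p.2 1))) ?_ fun p hp => ⟨mem_univ _, hcl _⟩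
      exact ((continuous_subtype_val.comp continuous_fst).prodMk (by fun_prop)).continuousOn
    · intro c
      refine Subtype.ext (Conf.map_eq_self (D.visInj_lowFun (hcl _) _) fun y _ => ?_)
      simp [D.lowFun_zero]
    · intro c
      refine Subtype.ext ?_
      simp [expel]

/-- Configurations below the window as configurations in the half space. -/
def lowE (c : D.Low) : Conf D.ωE := Conf.filter D.ωE univ c.1

lemma continuous_lowE : Continuous D.lowE := by
  rw [← continuousOn_univ]
  exact Conf.continuousOn_filter D.continuous_ω D.continuous_ωE
    (f := fun c : D.Low => c.1) continuous_subtype_val.continuousOn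
    (fun _ _ _ _ => Or.inl Filter.univ_mem) fun θ hθ => ⟨θ, hθ, fun y _ h => h.trans (min_le_left _ _)⟩

lemma lowE_expel (c : Conf D.ω) : D.lowE (D.expel c) = D.zoomE (D.escan c 1) := by
  have hfun : ∀ y, D.lowFun 1 y = D.zoomFun 1 (D.scanFun 1 y) := by
    intro y
    refine Prod.ext (funext fun j => ?_) rfl
    by_cases hj : j = D.i
    · subst hj
      rw [lowFun_fst, zoomFun_fst, scanFun_fst]; ring
    · simp [lowFun, scanFun, hj]
  ext y
  simp only [lowE, expel, Conf.mem_filter, Conf.mem_map (D.visInj_lowFun (show (1 : ℝ) ∈ Icc (0 : ℝ) 1 by simp) _),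
    mem_zoomE, mem_escan, hfun]
  constructor
  · rintro ⟨⟨y₀, h0, rfl, -⟩, -, h⟩
    refine ⟨_, ⟨y₀, h0, rfl, ?_⟩, rfl, h⟩
    exact (lt_min h one_pos).trans_le (D.ωE_zoomFun_le zero_le_one _)
  · rintro ⟨_, ⟨y₀, h0, rfl, -⟩, rfl, h⟩
    exact ⟨⟨y₀, h0, rfl, h.trans_le (min_le_left _ _)⟩, mem_univ _, h⟩

lemma zoomEB_lowE (c : D.Low) : D.zoomEB (D.lowE c) = ∅ :=
  D.zoomEB_eq_empty fun y hy => c.2 y hy.1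

/-- The part of a configuration in the half space which lies below the window. -/
def toLow (e : Conf D.ωE) : D.Low :=
  ⟨Conf.filter D.ω {y | y.1 D.i < -1 / 2} e, fun _ hy => hy.2.1⟩

lemma continuousOn_toLow {X : Type*} [TopologicalSpace X] {U : Set X} {f : X → Conf D.ωE}
    (hf : ContinuousOn f U) (h : ∀ x ∈ U, ∀ y ∈ f x, y.1 D.i < -1 / 2) :
    ContinuousOn (fun x => D.toLow (f x)) U := by
  refine Topology.IsInducing.subtypeVal.continuousOn_iff.2 ?_
  refine Conf.continuousOn_filter D.continuous_ωE D.continuous_ω hf (fun x hx y hy => Or.inl ?_)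
    fun θ hθ => ⟨min θ 1, by positivity, fun y hy h => ?_⟩
  · exact (isOpen_lt (by fun_prop) continuous_const).mem_nhds (h x hx y hy)
  · change y.1 D.i < -1 / 2 at hy
    exact min_le_min h (by linarith)

lemma lowE_toLow {e : Conf D.ωE} (h : ∀ y ∈ e, y.1 D.i < -1 / 2) : D.lowE (D.toLow e) = e := by
  ext y
  simp only [lowE, toLow, Conf.mem_filter]
  exact ⟨fun hy => hy.1.1, fun hy => ⟨⟨hy, h y hy, (e.pos hy).trans_le (min_le_left _ _)⟩,
    mem_univ _, e.pos hy⟩⟩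

lemma toLow_lowE {c : D.Low} : D.toLow (D.lowE c) = c := by
  refine Subtype.ext (Conf.ext fun y => ?_)
  simp only [lowE, toLow, Conf.mem_filter]
  refine ⟨fun hy => hy.1.1, fun hy => ⟨⟨hy, mem_univ _, lt_min (c.1.pos hy) ?_⟩, c.2 y hy,
    c.1.pos hy⟩⟩
  linarith [c.2 y hy]

end ScanData

namespace ScanData

variable {n : ℕ} {L : Type*} [TopologicalSpace L] (D : ScanData n L)

/-- Lifting the zoomed window data through the half space and pushing the top below the window. -/
lemma exists_expel {d : ℕ} {a b : Fin d → ℝ} (hab : ∀ j, a j < b j) {c : (Fin d → ℝ) → Conf D.ω}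
    (hc : ContinuousOn c (boxBdry a b)) {g : (Fin d → ℝ) × ℝ → Conf D.ωB}
    (hg : ContinuousOn g (Icc a b ×ˢ Icc 0 1))
    (hgA : ∀ x ∈ boxBdry a b, ∀ t ∈ Icc (0 : ℝ) 1, g (x, t) = D.scan (c x) (2 * t - 1))
    (hg0 : ∀ x ∈ Icc a b, g (x, 0) = ∅) (hg1 : ∀ x ∈ Icc a b, g (x, 1) = ∅) :
    ∃ e : (Fin d → ℝ) × ℝ → Conf D.ωE, ContinuousOn e (Icc a b ×ˢ Icc 0 1) ∧
      (∀ x ∈ Icc a b, e (x, 0) = ∅) ∧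
      (∀ x ∈ boxBdry a b, ∀ t ∈ Icc (0 : ℝ) 1, e (x, t) = D.zoomE (D.escan (c x) (2 * t - 1))) ∧
      (∀ q ∈ Icc a b ×ˢ Icc (0 : ℝ) 1, D.zoomEB (e q) = D.zoomB (D.zoomB (g q))) ∧
      ∀ x ∈ Icc a b, ∀ y ∈ e (x, 1), y.1 D.i < -1 / 2 := by
  have hK := isCell_box hab
  have hemp : ∀ c, D.zoomE (D.escan c (2 * (0 : ℝ) - 1)) = ∅ := by
    intro c
    rw [show (2 : ℝ) * 0 - 1 = -1 by norm_num, D.escan_eq_empty, Conf.eq_empty_iff]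
    intro y hy
    obtain ⟨y₀, h0, -⟩ := D.mem_zoomE.1 hy
    exact Conf.notMem_empty _ h0
  have hempB : D.zoomB ∅ = ∅ := by
    rw [Conf.eq_empty_iff]
    intro y hy
    obtain ⟨y₀, h0, -⟩ := D.mem_zoomB.1 hy
    exact Conf.notMem_empty _ h0
  have hce : ContinuousOn (fun q : (Fin d → ℝ) × ℝ => D.zoomE (D.escan (c q.1) (2 * q.2 - 1)))
      (boxBdry a b ×ˢ Icc 0 1) := by
    refine (D.continuous_zoomE.comp D.continuous_escan).comp_continuousOn
      (f := fun q : (Fin d → ℝ) × ℝ => (c q.1, 2 * q.2 - 1)) ?_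
    exact (hc.comp continuousOn_fst fun q hq => hq.1).prodMk (by fun_prop)
  have hce0 : ContinuousOn (fun q : (Fin d → ℝ) × ℝ => D.zoomE (D.escan (c q.1) (2 * q.2 - 1)))
      (Icc a b ×ˢ {0}) := by
    refine (continuousOn_const (c := (∅ : Conf D.ωE))).congr fun q hq => ?_
    have : q.2 = 0 := hq.2
    rw [this, hemp]
  obtain ⟨e, he, heJ, hel⟩ := D.liftProp d (-3 / 4) (-1 / 2) (by norm_num) (by norm_num)
    (by norm_num) a b hab (fun q => D.zoomB (g q)) (D.continuous_zoomB.comp_continuousOn hg)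
    (D.locallyClear_zoomB hg) (fun q => D.zoomE (D.escan (c q.1) (2 * q.2 - 1)))
    (hce0.union_of_isClosed hce (isClosed_Icc.prod isClosed_singleton)
      (hK.isClosed_bdry.prod isClosed_Icc)) (by
      rintro ⟨x, t⟩ (hq | hq)
      · have ht : t = 0 := hq.2
        subst ht
        simp only [hemp, hg0 x hq.1, hempB]
        exact fun y _ => iff_of_false (Conf.notMem_empty _) (Conf.notMem_empty _)
      · simp only [hgA x hq.1 t hq.2]
        exact D.liftsAbove_zoomE_escan _ _ (by norm_num))
  refine ⟨e, he, fun x hx => ?_, fun x hx t ht => heJ (x, t) (Or.inr ⟨hx, ht⟩),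
    fun q hq => D.zoomEB_eq_zoomB (hel q hq), fun x hx y hy => ?_⟩
  · rw [heJ (x, 0) (Or.inl ⟨hx, rfl⟩)]
    exact hemp _
  · by_contra h
    have := (hel (x, 1) ⟨hx, by simp⟩ y (not_lt.1 h)).1 hy
    simp only [hg1 x hx, hempB] at this
    exact Conf.notMem_empty _ this

lemma exists_scan_hrel_box {d : ℕ} {a b : Fin d → ℝ} (hab : ∀ j, a j < b j)
    {c : (Fin d → ℝ) → Conf D.ω} (hc : ContinuousOn c (boxBdry a b))
    {g : (Fin d → ℝ) × ℝ → Conf D.ωB} (hg : ContinuousOn g (Icc a b ×ˢ Icc 0 1))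
    (hgA : ∀ x ∈ boxBdry a b, ∀ t ∈ Icc (0 : ℝ) 1, g (x, t) = D.scan (c x) (2 * t - 1))
    (hg0 : ∀ x ∈ Icc a b, g (x, 0) = ∅) (hg1 : ∀ x ∈ Icc a b, g (x, 1) = ∅) :
    ∃ c' : (Fin d → ℝ) → Conf D.ω, ContinuousOn c' (Icc a b) ∧ (∀ x ∈ boxBdry a b, c' x = c x) ∧
      HRel univ (Icc a b ×ˢ Icc (0 : ℝ) 1) (boxBdry a b ×ˢ Icc (0 : ℝ) 1 ∪ Icc a b ×ˢ {0, 1})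
        (fun q => D.scan (c' q.1) (2 * q.2 - 1)) g := by
  obtain ⟨e, he, he0, heA, heB, he1⟩ := D.exists_expel hab hc hg hgA hg0 hg1
  have hK := isCell_box hab
  have hK' := hK.prod (isCell_Icc zero_lt_one)
  set K := Icc a b
  set A := boxBdry a b
  set A' := A ×ˢ Icc (0 : ℝ) 1 ∪ K ×ˢ {0, 1} with hA'
  have hA'K : A' ⊆ K ×ˢ Icc (0 : ℝ) 1 := hK'.subset
  have htop : ContinuousOn (fun x => D.toLow (e (x, 1))) K :=
    D.continuousOn_toLow (he.comp (f := fun x => (x, 1)) (by fun_prop) fun x hx => ⟨hx, by simp⟩) he1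
  have h21 : (2 : ℝ) * 1 - 1 = 1 := by norm_num
  obtain ⟨c', hc', hc'A, hc'h⟩ := D.wEq_expel _ K A hK c hc _ htop fun x hx => by
    simp only [heA x hx 1 (by simp), h21, ← D.lowE_expel, D.toLow_lowE]
  obtain ⟨M, hM, hM0, hM1, hMA, -⟩ := hc'h.symm hK.subset
  simp only [Function.comp_apply] at hM1
  have hescan : ContinuousOn (fun q : (Fin d → ℝ) × ℝ => D.zoomE (D.escan (c' q.1) (2 * q.2 - 1)))
      (K ×ˢ Icc 0 1) := by
    refine (D.continuous_zoomE.comp D.continuous_escan).comp_continuousOn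
      (f := fun q : (Fin d → ℝ) × ℝ => (c' q.1, 2 * q.2 - 1)) ?_
    exact (hc'.comp continuousOn_fst fun q hq => hq.1).prodMk (by fun_prop)
  have hscan : ContinuousOn (fun q : (Fin d → ℝ) × ℝ => D.scan (c' q.1) (2 * q.2 - 1))
      (K ×ˢ Icc 0 1) := by
    refine D.continuous_scan.comp_continuousOn
      (f := fun q : (Fin d → ℝ) × ℝ => (c' q.1, 2 * q.2 - 1)) ?_
    exact (hc'.comp continuousOn_fst fun q hq => hq.1).prodMk (by fun_prop)
  let H : ((Fin d → ℝ) × ℝ) × ℝ → Conf D.ωE := fun p =>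
    if p.1.2 = 1 then D.lowE (M (p.1.1, p.2)) else e p.1
  have hHA : ∀ x ∈ A, ∀ t ∈ Icc (0 : ℝ) 1, ∀ s ∈ Icc (0 : ℝ) 1, H ((x, t), s) = e (x, t) := by
    intro x hx t ht s hs
    simp only [H]
    split_ifs with h
    · subst h
      rw [hMA x hx s hs, D.lowE_toLow (he1 x (hK.subset hx))]
    · rfl
  have hH0 : ∀ x ∈ K, ∀ s, H ((x, 0), s) = e (x, 0) := fun x hx s => by simp [H]
  have hHc : ContinuousOn H (A' ×ˢ Icc 0 1) := by
    refine continuousOn_ite_of_isClosed (p := fun p : ((Fin d → ℝ) × ℝ) × ℝ => p.1.2 = 1)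
      (S := {p : ((Fin d → ℝ) × ℝ) × ℝ | p.1.2 = 1}) (T := (A ×ˢ Icc (0 : ℝ) 1 ∪ K ×ˢ {0}) ×ˢ univ)
      (isClosed_eq (by fun_prop) continuous_const)
      (((hK.isClosed_bdry.prod isClosed_Icc).union (hK.isClosed.prod isClosed_singleton)).prod
        isClosed_univ) ?_ ?_ (fun _ _ h => h) ?_ ?_
    · refine D.continuous_lowE.comp_continuousOn (hM.comp (by fun_prop) ?_)
      exact fun p hp => ⟨(hA'K hp.2.1).1, hp.2.2⟩
    · exact he.comp continuousOn_fst fun p hp => hA'K hp.2.1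
    · rintro ⟨⟨x, t⟩, s⟩ ⟨hx, hs⟩ h
      refine ⟨hx.imp id fun h' => ⟨h'.1, ?_⟩, mem_univ _⟩
      exact h'.2.resolve_right h
    · rintro ⟨⟨x, t⟩, s⟩ ⟨hx, hs⟩ h ⟨h', -⟩
      change t = 1 at h
      subst h
      have hxA : x ∈ A := by
        rcases h' with h' | h'
        · exact h'.1
        · exact absurd h'.2 (by simp)
      simpa [H] using hHA x hxA 1 (by simp) s hs
  obtain ⟨E, hE, hE0, hEH, -⟩ := hK'.hep (b := e) (H := H) (S := univ) he hHc (by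
    rintro ⟨x, t⟩ hx
    rcases hx with hx | hx
    · exact hHA x hx.1 t hx.2 0 (by simp)
    · rcases hx.2 with h | h
      · change t = 0 at h
        subst h
        exact hH0 x hx.1 0
      · change t = 1 at h
        subst h
        simp only [H, if_true]
        rw [hM0 x hx.1, D.lowE_toLow (he1 x hx.1)]) (fun _ _ => mem_univ _)
    fun _ _ _ _ => mem_univ _
  have hE1 : HRel univ (K ×ˢ Icc (0 : ℝ) 1) A' (fun q => E (q, 1))
      (fun q => D.zoomE (D.escan (c' q.1) (2 * q.2 - 1))) := by
    refine D.hrel_E hK' (hE.comp (by fun_prop) fun q hq => ⟨hq, by simp⟩) hescan ?_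
    rintro ⟨x, t⟩ hx
    simp only
    rw [hEH _ hx 1 (by simp)]
    rcases hx with hx | hx
    · rw [hHA x hx.1 t hx.2 1 (by simp), heA x hx.1 t hx.2, hc'A x hx.1]
    · rcases hx.2 with h | h
      · change t = 0 at h
        subst h
        rw [hH0 x hx.1, he0 x hx.1, show (2 : ℝ) * 0 - 1 = -1 by norm_num, D.escan_eq_empty]
        refine (Conf.eq_empty_iff.2 fun y hy => ?_).symm
        obtain ⟨y₀, h0, -⟩ := D.mem_zoomE.1 hy
        exact Conf.notMem_empty _ h0
      · change t = 1 at h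
        subst h
        simp only [H, if_true]
        rw [hM1 x hx.1, D.lowE_expel, h21]
  have hE01 : HRel univ (K ×ˢ Icc (0 : ℝ) 1) A' (D.zoomEB ∘ e) (D.zoomEB ∘ fun q => E (q, 1)) := by
    refine ⟨fun p => D.zoomEB (E p), D.continuous_zoomEB.comp_continuousOn hE, fun q hq => ?_,
      fun q _ => rfl, ?_, fun _ _ _ _ => mem_univ _⟩
    · simp only [hE0 q hq, Function.comp_apply]
    · rintro ⟨x, t⟩ hx s hs
      simp only [hEH _ hx s hs, Function.comp_apply]
      rcases hx with hx | hx
      · rw [hHA x hx.1 t hx.2 s hs]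
      · rcases hx.2 with h | h
        · change t = 0 at h
          subst h
          rw [hH0 x hx.1]
        · change t = 1 at h
          subst h
          simp only [H, if_true]
          rw [D.zoomEB_lowE, D.zoomEB_eq_empty (he1 x hx.1)]
  have hzz : HRel univ (K ×ˢ Icc (0 : ℝ) 1) A'
      (D.zoomB ∘ D.zoomB ∘ fun q => D.scan (c' q.1) (2 * q.2 - 1)) (D.zoomB ∘ D.zoomB ∘ g) := by
    refine ((hE01.trans (hE1.map (S' := univ) D.continuous_zoomEB.continuousOn
      fun _ _ => mem_univ _) hA'K).symm hA'K).congr hA'K (fun q _ => ?_) fun q hq => heB q hq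
    exact D.zoomEB_zoomE_escan _ _
  have hbd : ∀ q ∈ A', D.scan (c' q.1) (2 * q.2 - 1) = g q := by
    rintro ⟨x, t⟩ (hx | hx)
    · rw [hgA x hx.1 t hx.2, hc'A x hx.1]
    · rcases hx.2 with h | h
      · change t = 0 at h
        subst h
        rw [hg0 x hx.1, D.scan_eq_empty (by norm_num)]
      · change t = 1 at h
        subst h
        rw [hg1 x hx.1, D.scan_eq_empty (by norm_num)]
  refine ⟨c', hc', hc'A, ?_⟩
  refine D.wEq_zoomB.hrel_of_comp hK' hscan hg hbd ?_
  exact D.wEq_zoomB.hrel_of_comp hK' (D.continuous_zoomB.comp_continuousOn hscan)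
    (D.continuous_zoomB.comp_continuousOn hg) (fun q hq => congrArg _ (hbd q hq)) hzz

lemma exists_scan_hrel {V : Type} [TopologicalSpace V] {K A : Set V} (hK : IsCell K A)
    {c : V → Conf D.ω} (hc : ContinuousOn c A) {g : V × ℝ → Conf D.ωB}
    (hg : ContinuousOn g (K ×ˢ Icc (-1) 1))
    (hgA : ∀ x ∈ A, ∀ t ∈ Icc (-1 : ℝ) 1, g (x, t) = D.scan (c x) t)
    (hg1 : ∀ x ∈ K, ∀ t : ℝ, |t| = 1 → g (x, t) = ∅) :
    ∃ c' : V → Conf D.ω, ContinuousOn c' K ∧ (∀ x ∈ A, c' x = c x) ∧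
      HRel univ (K ×ˢ Icc (-1 : ℝ) 1) (A ×ˢ Icc (-1 : ℝ) 1 ∪ K ×ˢ {-1, 1})
        (fun q => D.scan (c' q.1) q.2) g := by
  obtain ⟨d, h, hK0, hA0⟩ := hK
  have hball : closedBall (0 : Fin d → ℝ) 1 = Icc (-1) 1 := by
    ext x
    rw [mem_closedBall_zero_iff, pi_norm_le_iff_of_nonneg zero_le_one]
    simp only [Real.norm_eq_abs, abs_le, mem_Icc, Pi.le_def, forall_and]
    rfl
  have hsph : sphere (0 : Fin d → ℝ) 1 = boxBdry (-1) 1 := by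
    ext x
    simp only [boxBdry, mem_ofPred_eq, mem_sphere_zero_iff_norm, ← hball, mem_closedBall_zero_iff]
    have e2 : ∀ j, |x j| = 1 ↔ x j = (-1 : Fin d → ℝ) j ∨ x j = (1 : Fin d → ℝ) j := fun j => by
      rw [abs_eq zero_le_one, or_comm]; rfl
    refine ⟨fun hx => ⟨hx.le, ?_⟩, fun ⟨h1, j, hj⟩ => le_antisymm h1 ?_⟩
    · by_contra hcon
      push Not at hcon
      refine hx.not_lt ((pi_norm_lt_iff zero_lt_one).2 fun j => ?_)
      refine lt_of_le_of_ne (hx ▸ norm_le_pi_norm x j) fun h2 => ?_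
      exact ((e2 j).1 h2).elim (hcon j).1 (hcon j).2
    · rw [← (e2 j).2 hj]
      exact norm_le_pi_norm x j
  have hKm : ∀ x, x ∈ K ↔ h x ∈ Icc (-1 : Fin d → ℝ) 1 := fun x => by rw [hK0, ← hball]; rfl
  have hAm : ∀ x, x ∈ A ↔ h x ∈ boxBdry (-1 : Fin d → ℝ) 1 := fun x => by rw [hA0, ← hsph]; rfl
  have hI : ∀ t ∈ Icc (0 : ℝ) 1, 2 * t - 1 ∈ Icc (-1 : ℝ) 1 := fun t ht =>
    ⟨by linarith [ht.1], by linarith [ht.2]⟩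
  have hI' : ∀ t ∈ Icc (-1 : ℝ) 1, (t + 1) / 2 ∈ Icc (0 : ℝ) 1 := fun t ht =>
    ⟨by linarith [ht.1], by linarith [ht.2]⟩
  have hKs : ∀ u ∈ Icc (-1 : Fin d → ℝ) 1, h.symm u ∈ K := fun u hu => by
    rw [hKm, h.apply_symm_apply]; exact hu
  have hAs : ∀ u ∈ boxBdry (-1 : Fin d → ℝ) 1, h.symm u ∈ A := fun u hu => by
    rw [hAm, h.apply_symm_apply]; exact hu
  obtain ⟨c', hc', hc'A, hc'h⟩ := D.exists_scan_hrel_box (a := (-1 : Fin d → ℝ)) (b := 1)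
    (fun j => by norm_num) (c := c ∘ h.symm) (hc.comp h.symm.continuous.continuousOn hAs)
    (g := fun q => g (h.symm q.1, 2 * q.2 - 1))
    (hg.comp (by have := h.symm.continuous; fun_prop) fun q hq => ⟨hKs _ hq.1, hI _ hq.2⟩)
    (fun x hx t ht => hgA _ (hAs x hx) _ (hI t ht))
    (fun x hx => hg1 _ (hKs x hx) _ (by norm_num)) (fun x hx => hg1 _ (hKs x hx) _ (by norm_num))
  refine ⟨c' ∘ h, hc'.comp h.continuous.continuousOn fun x hx => (hKm x).1 hx, fun x hx => ?_, ?_⟩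
  · simp only [Function.comp_apply]
    rw [hc'A _ ((hAm x).1 hx)]
    simp
  · have hcont := h.continuous
    refine (hc'h.precomp (K' := K ×ˢ Icc (-1 : ℝ) 1)
      (A' := A ×ˢ Icc (-1 : ℝ) 1 ∪ K ×ˢ {-1, 1}) (φ := fun q => (h q.1, (q.2 + 1) / 2))
      (by fun_prop) (fun q hq => ⟨(hKm _).1 hq.1, hI' _ hq.2⟩) ?_).congr ?_ ?_ ?_
    · rintro ⟨x, t⟩ (hx | hx)
      · exact Or.inl ⟨(hAm x).1 hx.1, hI' _ hx.2⟩
      · refine Or.inr ⟨(hKm x).1 hx.1, ?_⟩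
        rcases hx.2 with ht | ht
        · change t = -1 at ht
          left; simp [ht]
        · change t = 1 at ht
          right; simp [ht]
    · rintro ⟨x, t⟩ (hx | hx)
      · refine ⟨(hKm x).2 ((hAm x).1 hx.1).1, hx.2⟩
      · refine ⟨hx.1, ?_⟩
        rcases hx.2 with ht | ht
        · change t = -1 at ht
          simp [ht]
        · change t = 1 at ht
          simp [ht]
    · rintro ⟨x, t⟩ _
      simp only [Function.comp_apply]
      congr 1
      ring
    · rintro ⟨x, t⟩ _
      simp only [Function.comp_apply, h.symm_apply_apply]
      congr 2
      ring

end ScanData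

end Scan

/-! ### Labels with a whisker -/

namespace Scan

/-- The space obtained from `X` by attaching a whisker at `x₀`. -/
abbrev Lab (X : Type*) (x₀ : X) : Type _ :=
  {p : X × ℝ // p.2 ∈ Icc (0 : ℝ) 1 ∧ (p.2 = 0 ∨ p.1 = x₀)}

namespace Lab

variable {X : Type*} {x₀ : X}

/-- The projection of the whiskered space to `X`. -/
def pt (l : Lab X x₀) : X := l.1.1

/-- The distance to `X` along the whisker. -/
def ht (l : Lab X x₀) : ℝ := l.1.2

lemma ext {l l' : Lab X x₀} (h : l.pt = l'.pt) (h' : l.ht = l'.ht) : l = l' :=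
  Subtype.ext (Prod.ext h h')

lemma ht_nonneg (l : Lab X x₀) : 0 ≤ l.ht := l.2.1.1

lemma ht_le (l : Lab X x₀) : l.ht ≤ 1 := l.2.1.2

lemma pt_eq (l : Lab X x₀) (h : l.ht ≠ 0) : l.pt = x₀ := l.2.2.resolve_left h

/-- The inclusion of `X` in the whiskered space. -/
def incl (x₀ x : X) : Lab X x₀ := ⟨(x, 0), by simp⟩

/-- Moving labels along the whisker. -/
def stretch (q : ℝ × Lab X x₀) : Lab X x₀ :=
  ⟨(q.2.pt, min 1 ((1 + |q.1|) * q.2.ht)), ⟨le_min zero_le_one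
    (mul_nonneg (by positivity) q.2.ht_nonneg), min_le_left _ _⟩, by
    by_cases h : q.2.ht = 0
    · left; simp [h]
    · right; exact q.2.pt_eq h⟩

@[simp] lemma ht_stretch (t : ℝ) (l : Lab X x₀) : (stretch (t, l)).ht = min 1 ((1 + |t|) * l.ht) :=
  rfl

lemma stretch_zero (l : Lab X x₀) : stretch (0, l) = l :=
  Lab.ext rfl (by simpa using l.ht_le)

variable [TopologicalSpace X]

lemma continuous_pt : Continuous (pt : Lab X x₀ → X) := continuous_fst.comp continuous_subtype_val

lemma continuous_ht : Continuous (ht : Lab X x₀ → ℝ) := continuous_snd.comp continuous_subtype_val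

lemma continuous_stretch : Continuous (stretch : ℝ × Lab X x₀ → Lab X x₀) := by
  have h1 := continuous_pt (X := X) (x₀ := x₀)
  have h2 := continuous_ht (X := X) (x₀ := x₀)
  unfold stretch
  fun_prop

lemma exists_path [PathConnectedSpace X] (l : Lab X x₀) :
    ∃ γ : ℝ → Lab X x₀, Continuous γ ∧ γ 0 = l ∧ (γ 1).ht = 1 := by
  obtain ⟨p, hp, hp0, hp1, hp2⟩ : ∃ p : ℝ → X, Continuous p ∧ p 0 = l.pt ∧
      (∀ t, 1 / 2 < t → p t = x₀) ∧ (l.ht ≠ 0 → ∀ t, p t = x₀) := by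
    by_cases h : l.ht = 0
    · let P := (PathConnectedSpace.somePath l.pt x₀)
      refine ⟨fun t => P.extend (2 * t), P.continuous_extend.comp (by fun_prop), by simp,
        fun t ht => P.extend_of_one_le (by linarith), fun h' => absurd h h'⟩
    · exact ⟨fun _ => x₀, continuous_const, (l.pt_eq h).symm, fun _ _ => rfl, fun _ _ => rfl⟩
  refine ⟨fun t => ⟨(p t, max l.ht (min 1 (max 0 (2 * t - 1)))),
    ⟨l.ht_nonneg.trans (le_max_left _ _), max_le l.ht_le (min_le_left _ _)⟩, ?_⟩, ?_, ?_, ?_⟩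
  · rcases le_or_gt t (1 / 2) with h | h
    · have : min 1 (max 0 (2 * t - 1)) = 0 := by
        rw [max_eq_left (by linarith)]; simp
      simp only [this, max_eq_left l.ht_nonneg]
      by_cases h' : l.ht = 0
      · exact Or.inl h'
      · exact Or.inr (hp2 h' t)
    · exact Or.inr (hp1 t h)
  · fun_prop
  · refine Lab.ext hp0 ?_
    change max l.ht (min 1 (max 0 (2 * 0 - 1))) = l.ht
    norm_num [l.ht_nonneg]
  · change max l.ht (min 1 (max 0 (2 * 1 - 1))) = 1
    norm_num [l.ht_le]

end Lab

/-! ### Scanning in all directions -/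

section Scanning

variable {n : ℕ} [NeZero n] {X : Type*} {x₀ : X}

/-- Visibility of labelled points in the window `|z k| < 1` for `k < j`. -/
def vis : ℕ → (Fin n → ℝ) × Lab X x₀ → ℝ
  | 0, y => 1 - y.2.ht
  | j + 1, y => min (vis j y) (1 - |y.1 (Fin.ofNat n j)|)

lemma vis_congr (j : ℕ) {z z' : Fin n → ℝ} (l : Lab X x₀)
    (h : ∀ k < j, z (Fin.ofNat n k) = z' (Fin.ofNat n k)) : vis j (z, l) = vis j (z', l) := by
  induction j with
  | zero => rfl
  | succ j ih => simp only [vis, ih fun k hk => h k (by omega), h j (by omega)]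

lemma vis_le_of_le (j : ℕ) {y y' : (Fin n → ℝ) × Lab X x₀} (h : y'.2.ht ≤ y.2.ht)
    (h' : ∀ k, |y'.1 k| ≤ |y.1 k|) : vis j y ≤ vis j y' := by
  induction j with
  | zero => simp only [vis]; linarith
  | succ j ih => exact min_le_min ih (by linarith [h' (Fin.ofNat n j)])

lemma vis_zoom_le (j : ℕ) {t : ℝ} (z : Fin n → ℝ) (l : Lab X x₀) (ht : 0 ≤ t) :
    vis j ((1 + t) • z, Lab.stretch (t, l)) ≤ vis j (z, l) := by
  refine vis_le_of_le j ?_ fun k => ?_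
  · rw [Lab.ht_stretch, abs_of_nonneg ht]
    exact le_min l.ht_le (by nlinarith [l.ht_nonneg])
  · simp only [Pi.smul_apply, smul_eq_mul, abs_mul]
    rw [abs_of_nonneg (show 0 ≤ 1 + t by linarith)]
    nlinarith [abs_nonneg (z k)]

lemma half_le_vis (j : ℕ) (z : Fin n → ℝ) (l : Lab X x₀)
    (h : 0 < vis j ((2 : ℝ) • z, Lab.stretch (1, l))) : 1 / 2 ≤ vis j (z, l) := by
  induction j with
  | zero =>
    simp only [vis, Lab.ht_stretch] at h ⊢
    rcases min_lt_iff.1 (sub_pos.1 h) with h | h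
    · exact absurd h (lt_irrefl _)
    · norm_num at h; linarith
  | succ j ih =>
    obtain ⟨h1, h2⟩ := lt_min_iff.1 h
    refine le_min (ih h1) ?_
    simp only [Pi.smul_apply, smul_eq_mul, abs_mul, abs_two] at h2
    linarith

lemma vis_le (j : ℕ) (y : (Fin n → ℝ) × Lab X x₀) : vis j y ≤ 1 - y.2.ht := by
  induction j with
  | zero => exact le_rfl
  | succ j ih => exact (min_le_left _ _).trans ih

lemma vis_le_abs {j k : ℕ} (hk : k < j) (y : (Fin n → ℝ) × Lab X x₀) :
    vis j y ≤ 1 - |y.1 (Fin.ofNat n k)| := by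
  induction j with
  | zero => omega
  | succ j ih =>
    rcases Nat.lt_succ_iff_lt_or_eq.1 hk with h | rfl
    · exact (min_le_left _ _).trans (ih h)
    · exact min_le_right _ _

lemma le_vis {j : ℕ} {y : (Fin n → ℝ) × Lab X x₀} {θ : ℝ} (h : y.2.ht ≤ 1 - θ)
    (h' : ∀ k, |y.1 k| ≤ 1 - θ) : θ ≤ vis j y := by
  induction j with
  | zero => simp only [vis]; linarith
  | succ j ih => exact le_min ih (by linarith [h' (Fin.ofNat n j)])

/-- Scanning in the direction `j`. -/
def scanStep (j : ℕ) (c : Conf (vis j : (Fin n → ℝ) × Lab X x₀ → ℝ)) (t : ℝ) :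
    Conf (vis (j + 1) : (Fin n → ℝ) × Lab X x₀ → ℝ) :=
  Conf.map _ (fun y => (Function.update y.1 (Fin.ofNat n j)
    (squash (y.1 (Fin.ofNat n j)) - 2 * t), y.2)) c

/-- Scanning in the first `j` directions. -/
def scanMany : (j : ℕ) → Conf (vis 0 : (Fin n → ℝ) × Lab X x₀ → ℝ) → (Fin j → ℝ) →
    Conf (vis j : (Fin n → ℝ) × Lab X x₀ → ℝ)
  | 0, c, _ => c
  | j + 1, c, t => scanStep j (scanMany j c (Fin.init t)) (t (Fin.last j))

lemma scanStep_empty (j : ℕ) (t : ℝ) :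
    scanStep j (∅ : Conf (vis j : (Fin n → ℝ) × Lab X x₀ → ℝ)) t = ∅ := by
  refine Conf.eq_empty_iff.2 fun y hy => ?_
  obtain ⟨y₀, h0, -⟩ := (Conf.mem_map fun _ _ _ _ h => update_injective
    (r := fun s => squash s - 2 * t)
    (fun _ _ h => squash_strictMono.injective (sub_left_injective h)) h).1 hy
  exact Conf.notMem_empty _ h0

variable [TopologicalSpace X]

lemma continuous_vis (j : ℕ) : Continuous (vis j : (Fin n → ℝ) × Lab X x₀ → ℝ) := by
  induction j with
  | zero => exact continuous_const.sub (Lab.continuous_ht.comp continuous_snd)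
  | succ j ih => simp only [vis]; fun_prop

variable (X x₀) in
/-- The data for scanning in the direction `j`. -/
def scanData [PathConnectedSpace X] (j : ℕ) (hj : j < n) : ScanData n (Lab X x₀) where
  i := Fin.ofNat n j
  ω := vis j
  q := Lab.stretch
  continuous_ω := continuous_vis j
  continuous_q := Lab.continuous_stretch
  q_zero := Lab.stretch_zero
  ω_congr z z' l h := vis_congr j l fun k hk => h _ fun he => by
    have := congrArg Fin.val he
    simp only [Fin.ofNat, Nat.mod_eq_of_lt hj, Nat.mod_eq_of_lt (hk.trans hj)] at this
    omega
  ω_le t z l ht := vis_zoom_le j z l ht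
  ω_pos := half_le_vis j
  exists_path z l := by
    obtain ⟨γ, h1, h2, h3⟩ := l.exists_path
    exact ⟨γ, h1, h2, (vis_le j _).trans (by simp [h3])⟩

variable [PathConnectedSpace X]

lemma continuous_scanStep {j : ℕ} (hj : j < n) :
    Continuous fun p : Conf (vis j : (Fin n → ℝ) × Lab X x₀ → ℝ) × ℝ => scanStep j p.1 p.2 :=
  (scanData X x₀ j hj).continuous_scan

lemma scanStep_eq_empty {j : ℕ} (hj : j < n) {c : Conf (vis j : (Fin n → ℝ) × Lab X x₀ → ℝ)} {t : ℝ}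
    (ht : 1 ≤ |t|) : scanStep j c t = ∅ :=
  (scanData X x₀ j hj).scan_eq_empty ht

lemma exists_scanStep_hrel {j : ℕ} (hj : j < n) {V : Type} [TopologicalSpace V] {K A : Set V}
    (hK : IsCell K A) {c : V → Conf (vis j : (Fin n → ℝ) × Lab X x₀ → ℝ)} (hc : ContinuousOn c A)
    {g : V × ℝ → Conf (vis (j + 1) : (Fin n → ℝ) × Lab X x₀ → ℝ)}
    (hg : ContinuousOn g (K ×ˢ Icc (-1) 1))
    (hgA : ∀ x ∈ A, ∀ t ∈ Icc (-1 : ℝ) 1, g (x, t) = scanStep j (c x) t)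
    (hg1 : ∀ x ∈ K, ∀ t : ℝ, |t| = 1 → g (x, t) = ∅) :
    ∃ c' : V → Conf (vis j : (Fin n → ℝ) × Lab X x₀ → ℝ), ContinuousOn c' K ∧
      (∀ x ∈ A, c' x = c x) ∧
      HRel univ (K ×ˢ Icc (-1 : ℝ) 1) (A ×ˢ Icc (-1 : ℝ) 1 ∪ K ×ˢ {-1, 1})
        (fun q => scanStep j (c' q.1) q.2) g :=
  (scanData X x₀ j hj).exists_scan_hrel hK hc hg hgA hg1

lemma continuous_scanMany {j : ℕ} (hj : j ≤ n) :
    Continuous fun p : Conf (vis 0 : (Fin n → ℝ) × Lab X x₀ → ℝ) × (Fin j → ℝ) =>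
      scanMany j p.1 p.2 := by
  induction j with
  | zero => exact continuous_fst
  | succ j ih =>
    have hi : Continuous fun p : Conf (vis 0 : (Fin n → ℝ) × Lab X x₀ → ℝ) × (Fin (j + 1) → ℝ) =>
        (p.1, Fin.init p.2) :=
      continuous_fst.prodMk (continuous_pi fun k => (continuous_apply k.castSucc).comp continuous_snd)
    exact (continuous_scanStep (by omega)).comp (((ih (by omega)).comp hi).prodMk (by fun_prop))

lemma scanMany_eq_empty {j : ℕ} (hj : j ≤ n) (c : Conf (vis 0 : (Fin n → ℝ) × Lab X x₀ → ℝ))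
    {t : Fin j → ℝ} (ht : ∃ k, 1 ≤ |t k|) : scanMany j c t = ∅ := by
  induction j with
  | zero => exact ht.choose.elim0
  | succ j ih =>
    obtain ⟨k, hk⟩ := ht
    simp only [scanMany]
    rcases Fin.eq_castSucc_or_eq_last k with ⟨k', rfl⟩ | rfl
    · rw [ih (by omega) ⟨k', hk⟩, scanStep_empty]
    · exact scanStep_eq_empty (by omega) hk

end Scanning

lemma closedBall_pi_eq (j : ℕ) {t : Fin j → ℝ} : t ∈ closedBall (0 : Fin j → ℝ) 1 ↔ ∀ k, |t k| ≤ 1 := by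
  rw [mem_closedBall_zero_iff, pi_norm_le_iff_of_nonneg zero_le_one]; rfl

lemma sphere_pi_eq (j : ℕ) {t : Fin j → ℝ} :
    t ∈ sphere (0 : Fin j → ℝ) 1 ↔ (∀ k, |t k| ≤ 1) ∧ ∃ k, |t k| = 1 := by
  rw [mem_sphere_zero_iff_norm]
  refine ⟨fun h => ⟨fun k => h ▸ norm_le_pi_norm t k, ?_⟩, fun ⟨h1, k, hk⟩ => le_antisymm ?_ ?_⟩
  · by_contra hcon
    push Not at hcon
    exact h.not_lt ((pi_norm_lt_iff zero_lt_one).2 fun k =>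
      lt_of_le_of_ne (h ▸ norm_le_pi_norm t k) (hcon k))
  · exact (pi_norm_le_iff_of_nonneg zero_le_one).2 h1
  · rw [← hk]; exact norm_le_pi_norm t k

/-- The data of a family on `A` and of the constant family agree along the boundary of a cell. -/
lemma continuousOn_ite_bdry {V V' Z : Type*} [TopologicalSpace V] [TopologicalSpace V']
    [TopologicalSpace Z] {K A : Set V} {B S : Set V'} (hK : IsClosed K) (hA : IsClosed A)
    (hB : IsClosed B) (hS : IsClosed S) {f : V × V' → Z} {z : Z}
    (hf : ContinuousOn f (A ×ˢ B)) (h : ∀ x ∈ A, ∀ t ∈ S, f (x, t) = z)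
    [DecidablePred fun q : V × V' => q.1 ∈ A] :
    ContinuousOn (fun q : V × V' => if q.1 ∈ A then f q else z) (A ×ˢ B ∪ K ×ˢ S) := by
  refine ContinuousOn.union_of_isClosed (hf.congr fun q hq => if_pos hq.1) ?_ (hA.prod hB)
    (hK.prod hS)
  refine (continuousOn_const (c := z)).congr fun q hq => ?_
  simp only
  split_ifs with hq'
  · exact h _ hq' _ hq.2
  · rfl

section

variable {n : ℕ} [NeZero n] {X : Type*} [TopologicalSpace X] {x₀ : X} [PathConnectedSpace X]

lemma scanMany_sphere {j : ℕ} (hj : j ≤ n) (c : Conf (vis 0 : (Fin n → ℝ) × Lab X x₀ → ℝ))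
    {t : Fin j → ℝ} (ht : t ∈ sphere (0 : Fin j → ℝ) 1) : scanMany j c t = ∅ :=
  scanMany_eq_empty hj c (((sphere_pi_eq j).1 ht).2.imp fun _ h => h.ge)

lemma exists_scanMany_hrel {j : ℕ} (hj : j ≤ n) {V : Type} [TopologicalSpace V] {K A : Set V}
    (hK : IsCell K A) {c : V → Conf (vis 0 : (Fin n → ℝ) × Lab X x₀ → ℝ)} (hc : ContinuousOn c A)
    {g : V × (Fin j → ℝ) → Conf (vis j : (Fin n → ℝ) × Lab X x₀ → ℝ)}
    (hg : ContinuousOn g (K ×ˢ closedBall 0 1))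
    (hgA : ∀ x ∈ A, ∀ t ∈ closedBall (0 : Fin j → ℝ) 1, g (x, t) = scanMany j (c x) t)
    (hg1 : ∀ x ∈ K, ∀ t ∈ sphere (0 : Fin j → ℝ) 1, g (x, t) = ∅) :
    ∃ c' : V → Conf (vis 0 : (Fin n → ℝ) × Lab X x₀ → ℝ), ContinuousOn c' K ∧
      (∀ x ∈ A, c' x = c x) ∧
      HRel univ (K ×ˢ closedBall (0 : Fin j → ℝ) 1) (A ×ˢ closedBall 0 1 ∪ K ×ˢ sphere 0 1)
        (fun q => scanMany j (c' q.1) q.2) g := by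
  classical
  induction j with
  | zero =>
    have h0 : (0 : Fin 0 → ℝ) ∈ closedBall (0 : Fin 0 → ℝ) 1 := by simp
    have hgc : ContinuousOn (fun x => g (x, 0)) K :=
      hg.comp (by fun_prop) fun x hx => ⟨hx, h0⟩
    refine ⟨fun x => g (x, 0), hgc, fun x hx => hgA x hx 0 h0,
      HRel.refl_of (hgc.comp continuousOn_fst fun q hq => hq.1) (fun _ _ => mem_univ _) ?_⟩
    rintro ⟨x, t⟩ -
    rw [Subsingleton.elim t 0]
    rfl
  | succ j ih =>
    have hj' : j < n := by omega
    have hKj := hK.prod (isCell_ball j)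
    set A' := A ×ˢ closedBall (0 : Fin j → ℝ) 1 ∪ K ×ˢ sphere 0 1 with hA'
    have hfirst : ∀ t ∈ closedBall (0 : Fin (j + 1) → ℝ) 1, Fin.init t ∈ closedBall (0 : Fin j → ℝ) 1 :=
      fun t ht => (closedBall_pi_eq j).2 fun k => (closedBall_pi_eq (j + 1)).1 ht k.castSucc
    have hlast : ∀ t ∈ closedBall (0 : Fin (j + 1) → ℝ) 1, t (Fin.last j) ∈ Icc (-1 : ℝ) 1 :=
      fun t ht => abs_le.1 ((closedBall_pi_eq (j + 1)).1 ht (Fin.last j))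
    have hsnoc : ∀ u ∈ closedBall (0 : Fin j → ℝ) 1, ∀ s ∈ Icc (-1 : ℝ) 1,
        (Fin.snoc u s : Fin (j + 1) → ℝ) ∈ closedBall (0 : Fin (j + 1) → ℝ) 1 := fun u hu s hs =>
      (closedBall_pi_eq (j + 1)).2 fun k => by
        rcases Fin.eq_castSucc_or_eq_last k with ⟨k', rfl⟩ | rfl
        · simpa using (closedBall_pi_eq j).1 hu k'
        · simpa using abs_le.2 hs
    have hsnocS : ∀ u ∈ closedBall (0 : Fin j → ℝ) 1, ∀ s ∈ Icc (-1 : ℝ) 1,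
        (u ∈ sphere (0 : Fin j → ℝ) 1 ∨ |s| = 1) →
        (Fin.snoc u s : Fin (j + 1) → ℝ) ∈ sphere (0 : Fin (j + 1) → ℝ) 1 := by
      intro u hu s hs h
      refine (sphere_pi_eq (j + 1)).2 ⟨(closedBall_pi_eq (j + 1)).1 (hsnoc u hu s hs), ?_⟩
      rcases h with h | h
      · obtain ⟨k, hk⟩ := ((sphere_pi_eq j).1 h).2
        exact ⟨k.castSucc, by simpa using hk⟩
      · exact ⟨Fin.last j, by simpa using h⟩
    have hcsnoc : Continuous fun p : (V × (Fin j → ℝ)) × ℝ =>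
        (p.1.1, (Fin.snoc p.1.2 p.2 : Fin (j + 1) → ℝ)) := by
      refine (by fun_prop : Continuous fun p : (V × (Fin j → ℝ)) × ℝ => p.1.1).prodMk
        (continuous_pi fun k => ?_)
      rcases Fin.eq_castSucc_or_eq_last k with ⟨k', rfl⟩ | rfl
      · simp only [Fin.snoc_castSucc]; fun_prop
      · simp only [Fin.snoc_last]; fun_prop
    let e : V × (Fin j → ℝ) → Conf (vis j : (Fin n → ℝ) × Lab X x₀ → ℝ) := fun q =>
      if q.1 ∈ A then scanMany j (c q.1) q.2 else ∅
    have he : ContinuousOn e A' := by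
      refine continuousOn_ite_bdry hK.isClosed hK.isClosed_bdry isClosed_closedBall isClosed_sphere
        ?_ fun x _ t ht => scanMany_sphere hj'.le _ ht
      exact (continuous_scanMany hj'.le).comp_continuousOn
        ((hc.comp continuousOn_fst fun q hq => hq.1).prodMk continuousOn_snd)
    obtain ⟨w, hw, hwA, hwh⟩ := exists_scanStep_hrel hj' hKj he
      (g := fun p => g (p.1.1, Fin.snoc p.1.2 p.2))
      (hg.comp hcsnoc.continuousOn fun p hp => ⟨hp.1.1, hsnoc _ hp.1.2 _ hp.2⟩)
      (by
        rintro ⟨x, u⟩ hx s hs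
        simp only [e]
        split_ifs with hxA
        · have hu : u ∈ closedBall (0 : Fin j → ℝ) 1 :=
            hx.elim (fun h => h.2) fun h => sphere_subset_closedBall h.2
          rw [hgA x hxA _ (hsnoc u hu s hs), scanMany]
          simp
        · obtain ⟨hxK, hu⟩ := hx.resolve_left fun h => hxA h.1
          rw [hg1 x hxK _ (hsnocS u (sphere_subset_closedBall hu) s hs (Or.inl hu)), scanStep_empty])
      (by
        rintro ⟨x, u⟩ ⟨hx, hu⟩ s hs
        exact hg1 x hx _ (hsnocS u hu s (abs_le.1 hs.le) (Or.inr hs)))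
    obtain ⟨c', hc', hc'A, M, hM, hM0, hM1, hMA, -⟩ := ih hj'.le hw
      (fun x hx t ht => by rw [hwA _ (Or.inl ⟨hx, ht⟩)]; exact if_pos hx)
      (fun x hx t ht => by
        rw [hwA _ (Or.inr ⟨hx, ht⟩)]
        simp only [e]
        split_ifs
        · exact scanMany_sphere hj'.le _ ht
        · rfl)
    refine ⟨c', hc', hc'A, ?_⟩
    have hstep : HRel univ ((K ×ˢ closedBall (0 : Fin j → ℝ) 1) ×ˢ Icc (-1 : ℝ) 1)
        (A' ×ˢ Icc (-1 : ℝ) 1 ∪ (K ×ˢ closedBall (0 : Fin j → ℝ) 1) ×ˢ {-1, 1})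
        (fun p => scanStep j (scanMany j (c' p.1.1) p.1.2) p.2) (fun p => scanStep j (w p.1) p.2) := by
      refine ⟨fun p => scanStep j (M (p.1.1, p.2)) p.1.2, ?_, ?_, ?_, ?_, fun _ _ _ _ => mem_univ _⟩
      · refine (continuous_scanStep hj').comp_continuousOn
          (f := fun p : ((V × (Fin j → ℝ)) × ℝ) × ℝ => (M (p.1.1, p.2), p.1.2)) ?_
        exact (hM.comp (by fun_prop) fun p hp => ⟨hp.1.1, hp.2⟩).prodMk (by fun_prop)
      · exact fun p hp => by simp only [hM0 _ hp.1]
      · exact fun p hp => by simp only [hM1 _ hp.1]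
      · rintro p (hp | hp) s hs
        · simp only [hMA _ hp.1 s hs]
        · have : 1 ≤ |p.2| := by
            rcases hp.2 with h | h <;> simp [show p.2 = _ from h]
          simp only [scanStep_eq_empty hj' this]
    have hsub : A' ×ˢ Icc (-1 : ℝ) 1 ∪ (K ×ˢ closedBall (0 : Fin j → ℝ) 1) ×ˢ {-1, 1} ⊆
        (K ×ˢ closedBall (0 : Fin j → ℝ) 1) ×ˢ Icc (-1 : ℝ) 1 :=
      (hKj.prod (isCell_Icc (by norm_num : (-1 : ℝ) < 1))).subset
    have hc2 : Continuous fun q : V × (Fin (j + 1) → ℝ) => ((q.1, Fin.init q.2), q.2 (Fin.last j)) := by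
      refine (continuous_fst.prodMk (continuous_pi fun k => ?_)).prodMk (by fun_prop)
      exact (continuous_apply k.castSucc).comp continuous_snd
    have hA2 : A ×ˢ closedBall (0 : Fin (j + 1) → ℝ) 1 ∪ K ×ˢ sphere 0 1 ⊆
        K ×ˢ closedBall 0 1 := (hK.prod (isCell_ball (j + 1))).subset
    refine ((hstep.trans hwh hsub).precomp (K' := K ×ˢ closedBall (0 : Fin (j + 1) → ℝ) 1)
      (A' := A ×ˢ closedBall 0 1 ∪ K ×ˢ sphere 0 1) hc2.continuousOn
      (fun q hq => ⟨⟨hq.1, hfirst _ hq.2⟩, hlast _ hq.2⟩) ?_).congr hA2 ?_ ?_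
    · rintro ⟨x, t⟩ (hx | hx)
      · exact Or.inl ⟨Or.inl ⟨hx.1, hfirst _ hx.2⟩, hlast _ hx.2⟩
      · have ht := sphere_subset_closedBall hx.2
        obtain ⟨k, hk⟩ := ((sphere_pi_eq (j + 1)).1 hx.2).2
        rcases Fin.eq_castSucc_or_eq_last k with ⟨k', rfl⟩ | rfl
        · exact Or.inl ⟨Or.inr ⟨hx.1, (sphere_pi_eq j).2
            ⟨(closedBall_pi_eq j).1 (hfirst _ ht), k', hk⟩⟩, hlast _ ht⟩
        · refine Or.inr ⟨⟨hx.1, hfirst _ ht⟩, ?_⟩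
          rcases (abs_eq zero_le_one).1 hk with h | h
          · exact Or.inr h
          · exact Or.inl h
    · rintro ⟨x, t⟩ _
      rfl
    · rintro ⟨x, t⟩ _
      simp only [Function.comp_apply, Fin.snoc_init_self]

end

end Scan

/-! ### Labelled configurations and configurations with whiskered labels -/

namespace Scan

open Filter

/-- A homotopy pushing the base point of `X` along the whisker. -/
structure Whisker (X : Type*) [TopologicalSpace X] (x₀ : X) where
  /-- the homotopy -/
  G : ℝ × X → Lab X x₀
  continuous_G : Continuous G
  G_zero : ∀ x, G (0, x) = Lab.incl x₀ x
  pt_G : ∀ t, (G (t, x₀)).pt = x₀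
  ht_G : (G (1, x₀)).ht = 1

lemma _root_.IsWellPointed.exists_whisker {X : Type*} [TopologicalSpace X] {x₀ : X}
    (h : IsWellPointed X x₀) : Nonempty (Whisker X x₀) := by
  obtain ⟨G, h0, h1⟩ := h (Lab X x₀) inferInstance
    ⟨Lab.incl x₀, by unfold Lab.incl; fun_prop⟩
    ⟨fun t => ⟨(x₀, (t : ℝ)), t.2, Or.inr rfl⟩, by fun_prop⟩ rfl
  refine ⟨⟨fun q => G (projIcc 0 1 zero_le_one q.1, q.2), ?_, fun x => ?_, fun t => ?_, ?_⟩⟩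
  · exact G.continuous.comp ((continuous_projIcc.comp continuous_fst).prodMk continuous_snd)
  · simp only [projIcc_left]
    exact h0 x
  · simp only [h1]; rfl
  · simp only [projIcc_right, h1]; rfl

namespace Whisker

variable {X : Type*} [TopologicalSpace X] {x₀ : X} (W : Whisker X x₀)

/-- The homotopy of the whiskered space extending the motion of `X`. -/
def push (q : ℝ × Lab X x₀) : Lab X x₀ :=
  ⟨((W.G (q.1, q.2.pt)).pt, max q.2.ht (W.G (q.1, q.2.pt)).ht),
    ⟨q.2.ht_nonneg.trans (le_max_left _ _), max_le q.2.ht_le (Lab.ht_le _)⟩, by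
    by_cases h : q.2.ht = 0
    · by_cases h' : (W.G (q.1, q.2.pt)).ht = 0
      · left; simp [h, h']
      · right; exact Lab.pt_eq _ h'
    · right; simp only [Lab.pt_eq _ h, W.pt_G]⟩

lemma continuous_push : Continuous W.push := by
  have h1 := Lab.continuous_pt (X := X) (x₀ := x₀)
  have h2 := Lab.continuous_ht (X := X) (x₀ := x₀)
  have h3 := W.continuous_G
  unfold push
  fun_prop

lemma ht_le_push (q : ℝ × Lab X x₀) : q.2.ht ≤ (W.push q).ht := le_max_left _ _

lemma push_zero (l : Lab X x₀) : W.push (0, l) = l := by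
  refine Lab.ext ?_ ?_
  · change (W.G (0, l.pt)).pt = l.pt
    rw [W.G_zero]; rfl
  · change max l.ht (W.G (0, l.pt)).ht = l.ht
    rw [W.G_zero]; exact max_eq_left l.ht_nonneg

lemma push_one (l : Lab X x₀) : W.push (1, l) = W.G (1, l.pt) := by
  refine Lab.ext rfl ?_
  change max l.ht (W.G (1, l.pt)).ht = _
  by_cases h : l.ht = 0
  · rw [h]; exact max_eq_right (Lab.ht_nonneg _)
  · rw [Lab.pt_eq _ h, W.ht_G]; exact max_eq_right l.ht_le

end Whisker

section Support

variable {M X : Type*} [TopologicalSpace M] [TopologicalSpace X] {x₀ : X}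

variable (x₀) in
/-- The points with a nontrivial label. -/
def support (a : LabelPre M X) : Set (M × X) := {y | ∃ i, (a.2.1.1 i, a.2.2 i) = y ∧ y.2 ≠ x₀}

lemma exists_reduced (a : LabelPre M X) : ∃ b : LabelPre M X,
    (Quot.mk _ a : LabeledConfig M X x₀) = Quot.mk _ b ∧ support x₀ a = support x₀ b ∧
      ∀ i, b.2.2 i ≠ x₀ := by
  obtain ⟨k, p, l⟩ := a
  induction k with
  | zero => exact ⟨_, rfl, rfl, fun i => i.elim0⟩
  | succ k ih =>
    by_cases h : ∃ i, l i = x₀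
    · obtain ⟨i, hi⟩ := h
      obtain ⟨b, h1, h2, h3⟩ := ih ⟨p.1 ∘ i.succAbove, p.2.comp Fin.succAbove_right_injective⟩
        (l ∘ i.succAbove)
      refine ⟨b, (Quot.sound (LabelRel.delete p l i hi)).trans h1, h2 ▸ ?_, h3⟩
      ext y
      constructor
      · rintro ⟨j, rfl, hj⟩
        obtain ⟨j', rfl⟩ := Fin.exists_succAbove_eq (show j ≠ i from fun h => hj (h ▸ hi))
        exact ⟨j', rfl, hj⟩
      · rintro ⟨j, rfl, hj⟩
        exact ⟨i.succAbove j, rfl, hj⟩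
    · exact ⟨_, rfl, rfl, fun i hi => h ⟨i, hi⟩⟩

lemma mk_eq_mk_of_support_eq {a b : LabelPre M X} (h : support x₀ a = support x₀ b) :
    (Quot.mk _ a : LabeledConfig M X x₀) = Quot.mk _ b := by
  obtain ⟨a', ha, ha', ha0⟩ := exists_reduced (x₀ := x₀) a
  obtain ⟨b', hb, hb', hb0⟩ := exists_reduced (x₀ := x₀) b
  rw [ha, hb]
  rw [ha', hb'] at h
  obtain ⟨k, p, l⟩ := a'
  obtain ⟨k', p', l'⟩ := b'
  have h1 : ∀ i, ∃ j, (p'.1 j, l' j) = (p.1 i, l i) := fun i => by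
    have : (p.1 i, l i) ∈ support x₀ (⟨k', p', l'⟩ : LabelPre M X) := h ▸ ⟨i, rfl, ha0 i⟩
    exact this.imp fun j hj => hj.1
  have h2 : ∀ j, ∃ i, (p.1 i, l i) = (p'.1 j, l' j) := fun j => by
    have : (p'.1 j, l' j) ∈ support x₀ (⟨k, p, l⟩ : LabelPre M X) := h ▸ ⟨j, rfl, hb0 j⟩
    exact this.imp fun i hi => hi.1
  choose e he using h1
  choose e' he' using h2
  have hee : ∀ i, e' (e i) = i := fun i => p.2 (by
    have := (he' (e i)).trans (he i); exact congrArg Prod.fst this)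
  have hee' : ∀ j, e (e' j) = j := fun j => p'.2 (by
    have := (he (e' j)).trans (he' j); exact congrArg Prod.fst this)
  let E : Fin k ≃ Fin k' := ⟨e, e', hee, hee'⟩
  obtain rfl : k = k' := by simpa using Fintype.card_congr E
  refine ((Quot.sound (LabelRel.perm p' l' E)).trans (congrArg _ ?_)).symm
  refine congrArg (Sigma.mk k) (Prod.ext (Subtype.ext ?_) ?_)
  · exact funext fun i => congrArg Prod.fst (he i)
  · exact funext fun i => congrArg Prod.snd (he i)

/-- Moving the labels of a labelled configuration. -/
def relabelPre (f : X → X) (a : LabelPre M X) : LabelPre M X :=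
  ⟨a.1, a.2.1, f ∘ a.2.2⟩

lemma support_relabelPre {f : X → X} {a : LabelPre M X} {y : M × X} :
    y ∈ support x₀ (relabelPre f a) ↔ ∃ i, (a.2.1.1 i, f (a.2.2 i)) = y ∧ y.2 ≠ x₀ := Iff.rfl

end Support

section Compare

variable {n : ℕ} [NeZero n] {X : Type*} [TopologicalSpace X] {x₀ : X} (W : Whisker X x₀)

/-- The visible part of a labelled configuration after pushing the labels along the whisker. -/
def preToConf (a : LabelPre (Fin n → ℝ) X) : Conf (vis 0 : (Fin n → ℝ) × Lab X x₀ → ℝ) :=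
  Conf.mk {y | ∃ i, (a.2.1.1 i, W.G (1, a.2.2 i)) = y ∧ 0 < vis 0 y}
    ((finite_range fun i => (a.2.1.1 i, W.G (1, a.2.2 i))).subset
      (by rintro _ ⟨i, rfl, -⟩; exact ⟨i, rfl⟩))
    (by
      rintro _ ⟨i, rfl, -⟩ _ ⟨j, rfl, -⟩ h
      rw [a.2.1.2 h])
    (by rintro _ ⟨i, rfl, h⟩; exact h)

lemma mem_preToConf {a : LabelPre (Fin n → ℝ) X} {y : (Fin n → ℝ) × Lab X x₀} :
    y ∈ preToConf W a ↔ ∃ i, (a.2.1.1 i, W.G (1, a.2.2 i)) = y ∧ 0 < vis 0 y := Iff.rfl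

lemma continuous_preToConf :
    Continuous (preToConf W : LabelPre (Fin n → ℝ) X → Conf (vis 0)) := by
  refine continuous_sigma fun k => continuous_iff_continuousAt.2 fun a => ?_
  have hG := W.continuous_G
  have ht : ∀ i, Tendsto (fun b : OrdConfig (Fin n → ℝ) k × (Fin k → X) =>
      (b.1.1 i, W.G (1, b.2 i))) (𝓝 a) (𝓝 (a.1.1 i, W.G (1, a.2 i))) := fun i => by
    refine Continuous.tendsto (Continuous.prodMk ?_ (by fun_prop)) a
    exact (continuous_apply i).comp (continuous_subtype_val.comp continuous_fst)
  refine Conf.tendsto_list (continuous_vis 0)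
    (y := fun i (b : OrdConfig (Fin n → ℝ) k × (Fin k → X)) => (b.1.1 i, W.G (1, b.2 i)))
    (y₀ := fun i => (a.1.1 i, W.G (1, a.2 i))) (fun i _ => ht i) (fun i h θ hθ => ?_)
    (fun i j _ _ h => a.1.2 (congrArg Prod.fst h)) (Eventually.of_forall fun b z => Iff.rfl)
    fun z => Iff.rfl
  exact (((continuous_vis 0).tendsto _).comp (ht i)).eventually (gt_mem_nhds (h.trans_lt hθ))

/-- The comparison from labelled configurations to configurations with whiskered labels. -/
def toConf : LabeledConfig (Fin n → ℝ) X x₀ → Conf (vis 0 : (Fin n → ℝ) × Lab X x₀ → ℝ) :=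
  Quot.lift (preToConf W) (by
    intro a b h
    refine Conf.ext fun y => ?_
    rw [mem_preToConf, mem_preToConf]
    cases h with
    | perm p l e => exact (e.exists_congr_left.trans (by simp [OrdConfig.perm])).symm
    | delete p l i hi =>
      constructor
      · rintro ⟨j, rfl, hj⟩
        obtain ⟨j', rfl⟩ := Fin.exists_succAbove_eq (show j ≠ i from fun h => by
          subst h
          simp [vis, hi, W.ht_G] at hj)
        exact ⟨j', rfl, hj⟩
      · rintro ⟨j, rfl, hj⟩
        exact ⟨i.succAbove j, rfl, hj⟩)

lemma continuous_toConf : Continuous (toConf W : LabeledConfig (Fin n → ℝ) X x₀ → _) :=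
  continuous_quot_lift _ (continuous_preToConf W)

/-- An enumeration of the points of a configuration. -/
def enum (c : Conf (vis 0 : (Fin n → ℝ) × Lab X x₀ → ℝ)) :
    Fin (Nat.card (c : Set ((Fin n → ℝ) × Lab X x₀))) ≃ (c : Set ((Fin n → ℝ) × Lab X x₀)) :=
  haveI := c.finite.to_subtype
  (Finite.equivFin _).symm

/-- The labelled configuration underlying a configuration with whiskered labels. -/
def ofConfPre (c : Conf (vis 0 : (Fin n → ℝ) × Lab X x₀ → ℝ)) : LabelPre (Fin n → ℝ) X :=
  ⟨_, ⟨fun i => (enum c i).1.1, fun i j h => (enum c).injective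
    (Subtype.ext (c.eq_of_fst (enum c i).2 (enum c j).2 h))⟩, fun i => (enum c i).1.2.pt⟩

lemma mem_support_ofConfPre {c : Conf (vis 0 : (Fin n → ℝ) × Lab X x₀ → ℝ)} {y : (Fin n → ℝ) × X} :
    y ∈ support x₀ (ofConfPre c) ↔ ∃ z ∈ c, (z.1, z.2.pt) = y ∧ y.2 ≠ x₀ := by
  constructor
  · rintro ⟨i, hi, h⟩
    exact ⟨_, (enum c i).2, hi, h⟩
  · rintro ⟨z, hz, hi, h⟩
    refine ⟨(enum c).symm ⟨z, hz⟩, ?_, h⟩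
    simp only [ofConfPre, Equiv.apply_symm_apply, hi]

/-- The comparison from configurations with whiskered labels to labelled configurations. -/
def ofConf (c : Conf (vis 0 : (Fin n → ℝ) × Lab X x₀ → ℝ)) : LabeledConfig (Fin n → ℝ) X x₀ :=
  Quot.mk _ (ofConfPre c)

lemma continuous_ofConf : Continuous
    (ofConf : Conf (vis 0 : (Fin n → ℝ) × Lab X x₀ → ℝ) → LabeledConfig (Fin n → ℝ) X x₀) := by
  classical
  refine continuous_iff_continuousAt.2 fun c => ?_
  obtain ⟨η, h1, h2⟩ := Conf.exists_sections (continuous_vis 0) (tendsto_id (x := 𝓝 c))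
  have hη := fun i => h1 (enum c i) (enum c i).2
  let k := Nat.card (c : Set ((Fin n → ℝ) × Lab X x₀))
  let p : Conf (vis 0) → Fin k → (Fin n → ℝ) := fun c' i => (η (enum c i).1 c').1
  let u₁ : Conf (vis 0) → OrdConfig (Fin n → ℝ) k := fun c' =>
    if h : Function.Injective (p c') then ⟨p c', h⟩ else (ofConfPre c).2.1
  let u₂ : Conf (vis 0) → Fin k → X := fun c' i => (η (enum c i).1 c').2.pt
  have hinj : ∀ᶠ c' in 𝓝 c, Function.Injective (p c') := by
    have : ∀ᶠ c' in 𝓝 c, ∀ i j, i ≠ j → p c' i ≠ p c' j := by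
      refine eventually_all.2 fun i => eventually_all.2 fun j => ?_
      by_cases hij : i = j
      · exact Eventually.of_forall fun _ h => absurd hij h
      · have hne : (enum c i).1.1 ≠ (enum c j).1.1 := fun h => hij ((ofConfPre c).2.1.2 h)
        have hi := (continuous_fst.tendsto _).comp (hη i).1
        have hj := (continuous_fst.tendsto _).comp (hη j).1
        have hev := (hi.prodMk_nhds hj).eventually
          ((isOpen_ne_fun continuous_fst continuous_snd).mem_nhds hne)
        filter_upwards [hev] with c' hc' _ using hc'
    filter_upwards [this] with c' hc' i j hij
    by_contra h
    exact hc' i j h hij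
  have hval : ∀ c', Function.Injective (p c') → (u₁ c').1 = p c' := fun c' hc' =>
    congrArg Subtype.val (dif_pos hc')
  have hu₁ : Tendsto u₁ (𝓝 c) (𝓝 (ofConfPre c).2.1) := by
    refine Topology.IsInducing.subtypeVal.tendsto_nhds_iff.2 ?_
    refine Tendsto.congr' (f₁ := p) ?_
      (tendsto_pi_nhds.2 fun i => (continuous_fst.tendsto _).comp (hη i).1)
    filter_upwards [hinj] with c' hc'
    exact (hval c' hc').symm
  have hu₂ : Tendsto u₂ (𝓝 c) (𝓝 (ofConfPre c).2.2) :=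
    tendsto_pi_nhds.2 fun i =>
      ((Lab.continuous_pt.comp continuous_snd).tendsto _).comp (hη i).1
  have hu : Tendsto (fun c' => (Quot.mk _ ⟨k, u₁ c', u₂ c'⟩ : LabeledConfig (Fin n → ℝ) X x₀)) (𝓝 c)
      (𝓝 (ofConf c)) := by
    have hq : Continuous fun b : OrdConfig (Fin n → ℝ) k × (Fin k → X) =>
        (Quot.mk _ ⟨k, b⟩ : LabeledConfig (Fin n → ℝ) X x₀) :=
      continuous_quot_mk.comp continuous_sigmaMk
    exact (hq.tendsto _).comp (hu₁.prodMk_nhds hu₂)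
  refine hu.congr' ?_
  filter_upwards [hinj, eventually_all.2 fun i => (hη i).2, h2 1 one_pos] with c' hc' hmem hall
  refine mk_eq_mk_of_support_eq (Set.ext fun y => ?_)
  rw [mem_support_ofConfPre]
  constructor
  · rintro ⟨i, hi, h⟩
    change ((u₁ c').1 i, u₂ c' i) = y at hi
    rw [hval c' hc'] at hi
    exact ⟨_, hmem i, hi, h⟩
  · rintro ⟨z, hz, rfl, h⟩
    have hz0 : z.2.ht = 0 := by
      by_contra h0
      exact h (z.2.pt_eq h0)
    obtain ⟨z₀, hz₀, rfl⟩ := hall z hz (by simp [vis, hz0])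
    refine ⟨(enum c).symm ⟨z₀, hz₀⟩, ?_, h⟩
    change ((u₁ c').1 _, u₂ c' _) = _
    rw [hval c' hc']
    simp [p, u₂]

lemma ofConf_toConf_mk (a : LabelPre (Fin n → ℝ) X) :
    ofConf (toConf W (Quot.mk _ a)) = Quot.mk _ (relabelPre (fun x => (W.G (1, x)).pt) a) := by
  refine mk_eq_mk_of_support_eq (Set.ext fun y => ?_)
  rw [mem_support_ofConfPre, support_relabelPre]
  constructor
  · rintro ⟨z, ⟨i, rfl, -⟩, h⟩
    exact ⟨i, h⟩
  · rintro ⟨i, rfl, h⟩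
    refine ⟨_, ⟨i, rfl, ?_⟩, rfl, h⟩
    have : (W.G (1, a.2.2 i)).ht = 0 := by
      by_contra h0
      exact h (Lab.pt_eq _ h0)
    simp [vis, this]

lemma wEq_ofConf_toConf : WEq (ofConf ∘ toConf W : LabeledConfig (Fin n → ℝ) X x₀ → _) := by
  have hG := W.continuous_G
  let h : LabeledConfig (Fin n → ℝ) X x₀ × ℝ → LabeledConfig (Fin n → ℝ) X x₀ := fun q =>
    Quot.map (relabelPre fun x => (W.G (q.2, x)).pt) (by
      intro a b hab
      cases hab with
      | perm p l e => exact LabelRel.perm p _ e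
      | delete p l i hi =>
        exact LabelRel.delete p _ i (by simp only [Function.comp_apply, hi, W.pt_G])) q.1
  have hc : Continuous h := by
    have hq : Topology.IsQuotientMap (Quot.mk (LabelRel (Fin n → ℝ) X x₀)) := isQuotientMap_quot_mk
    refine hq.continuous_lift_prod_left ?_
    change Continuous fun q : LabelPre (Fin n → ℝ) X × ℝ =>
      (Quot.mk _ (relabelPre (fun x => (W.G (q.2, x)).pt) q.1) : LabeledConfig (Fin n → ℝ) X x₀)
    refine continuous_quot_mk.comp ?_
    refine (Homeomorph.sigmaProdDistrib (X := fun k => OrdConfig (Fin n → ℝ) k × (Fin k → X))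
      (Y := ℝ)).symm.isQuotientMap.continuous_iff.2 (continuous_sigma fun k => ?_)
    have hp : Continuous fun q : (OrdConfig (Fin n → ℝ) k × (Fin k → X)) × ℝ =>
        (q.1.1, fun i => (W.G (q.2, q.1.2 i)).pt) := by
      have := Lab.continuous_pt (X := X) (x₀ := x₀)
      fun_prop
    exact continuous_sigmaMk.comp hp
  refine WEq.of_homotopic_id (h := h) hc.continuousOn ?_ ?_
  · rintro ⟨a⟩
    refine congrArg (Quot.mk _) ?_
    simp only [relabelPre, W.G_zero]
    rfl
  · rintro ⟨a⟩
    exact (ofConf_toConf_mk W a).symm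

lemma wEq_toConf_ofConf :
    WEq (toConf W ∘ ofConf : Conf (vis 0 : (Fin n → ℝ) × Lab X x₀ → ℝ) → _) := by
  have hinj : ∀ t, Conf.VisInj (vis 0)
      (fun y : (Fin n → ℝ) × Lab X x₀ => (y.1, W.push (t, y.2))) := fun t _ _ _ _ h => h
  refine WEq.of_homotopic_id (h := fun q =>
    Conf.map (vis 0) (fun y => (y.1, W.push (q.2, y.2))) q.1) ?_ ?_ ?_
  · refine Conf.continuousOn_map (continuous_vis 0) (continuous_vis 0) continuousOn_fst
      (Φ := fun q y => (y.1, W.push (q.2, y.2))) ?_ (fun q _ => hinj q.2) ?_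
    · have := W.continuous_push
      fun_prop
    · refine fun θ hθ => ⟨θ, hθ, fun q _ y _ h => h.trans (vis_le_of_le 0 ?_ fun k => le_rfl)⟩
      exact W.ht_le_push (q.2, y.2)
  · exact fun c => Conf.map_eq_self (hinj 0) fun y _ => by simp [W.push_zero]
  · intro c
    refine Conf.ext fun y => ?_
    rw [Conf.mem_map (hinj 1)]
    simp only [W.push_one]
    constructor
    · rintro ⟨z, hz, rfl, h⟩
      exact ⟨(enum c).symm ⟨z, hz⟩, by simp [ofConfPre], h⟩
    · rintro ⟨i, rfl, h⟩
      exact ⟨_, (enum c i).2, rfl, h⟩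

lemma wEq_toConf : WEq (toConf W : LabeledConfig (Fin n → ℝ) X x₀ → _) :=
  WEq.of_comp (continuous_toConf W) continuous_ofConf (wEq_ofConf_toConf W) (wEq_toConf_ofConf W)

end Compare

end Scan

/-! ### Configurations in a window and the suspension -/

namespace Scan

open Filter

section Spacing

variable {n : ℕ} {X : Type*} {x₀ : X}

/-- The distance of a labelled point from the centre, counting the height of the label. -/
def cost (y : (Fin n → ℝ) × Lab X x₀) : ℝ := max ‖y.1‖ (2 * y.2.ht)

lemma cost_pos_of_ne {y y' : (Fin n → ℝ) × Lab X x₀} (h : y.1 ≠ y'.1) :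
    0 < max (cost y) (cost y') := by
  by_contra! h0
  have h1 : y.1 = 0 := norm_le_zero_iff.1
    ((le_max_left _ _).trans ((le_max_left _ _).trans h0))
  have h2 : y'.1 = 0 := norm_le_zero_iff.1
    ((le_max_left _ _).trans ((le_max_right _ _).trans h0))
  exact h (h1.trans h2.symm)

lemma continuous_cost [TopologicalSpace X] : Continuous (cost : (Fin n → ℝ) × Lab X x₀ → ℝ) := by
  have := Lab.continuous_ht (X := X) (x₀ := x₀)
  unfold cost
  fun_prop

variable [NeZero n]

lemma vis_pos_iff {y : (Fin n → ℝ) × Lab X x₀} :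
    0 < vis n y ↔ y.2.ht < 1 ∧ ∀ k, |y.1 k| < 1 := by
  constructor
  · intro h
    refine ⟨by linarith [vis_le n y], fun k => ?_⟩
    have := vis_le_abs k.2 y
    rw [Fin.ofNat_eq_cast, Fin.cast_val_eq_self] at this
    linarith
  · rintro ⟨h, h'⟩
    obtain ⟨m, hm⟩ : ∃ m < 1, ∀ k, |y.1 k| ≤ m := by
      refine ⟨‖y.1‖, (pi_norm_lt_iff one_pos).2 h', fun k => norm_le_pi_norm y.1 k⟩
    have := le_vis (n := n) (j := n) (y := y) (θ := 1 - max y.2.ht m)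
      (by rw [sub_sub_cancel]; exact le_max_left _ _)
      (fun k => by rw [sub_sub_cancel]; exact (hm.2 k).trans (le_max_right _ _))
    exact (sub_pos.2 (max_lt h hm.1)).trans_le this

lemma lt_cost_of_vis_lt {y : (Fin n → ℝ) × Lab X x₀} {θ : ℝ} (hθ : θ ≤ 1) (h : vis n y < θ) :
    1 - θ < cost y := by
  by_contra! h0
  refine h.not_ge (le_vis ?_ fun k => ?_)
  · have := (le_max_right _ _).trans h0
    linarith [y.2.ht_nonneg]
  · exact (norm_le_pi_norm y.1 k).trans ((le_max_left _ _).trans h0)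

variable (c : Conf (vis n : (Fin n → ℝ) × Lab X x₀ → ℝ))

/-- The competing bounds for the scale of a configuration. -/
def scaleSet : Set ℝ :=
  insert 1 {r | ∃ y ∈ c, ∃ y' ∈ c, y ≠ y' ∧ r = max (cost y) (cost y')}

lemma finite_scaleSet : (scaleSet c).Finite := by
  refine Finite.insert _ (((c.finite.prod c.finite).image
    fun p => max (cost p.1) (cost p.2)).subset ?_)
  rintro _ ⟨y, hy, y', hy', -, rfl⟩
  exact ⟨(y, y'), ⟨hy, hy'⟩, rfl⟩

/-- The scale at which at most one point of the configuration is close to the centre. -/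
def scale : ℝ := sInf (scaleSet c)

lemma scale_mem : scale c ∈ scaleSet c :=
  Set.Nonempty.csInf_mem (insert_nonempty _ _) (finite_scaleSet c)

lemma scale_le {r : ℝ} (h : r ∈ scaleSet c) : scale c ≤ r := csInf_le (finite_scaleSet c).bddBelow h

lemma scale_le_one : scale c ≤ 1 := scale_le c (mem_insert _ _)

lemma scale_le_max {y y' : (Fin n → ℝ) × Lab X x₀} (hy : y ∈ c) (hy' : y' ∈ c) (h : y ≠ y') :
    scale c ≤ max (cost y) (cost y') := scale_le c (Or.inr ⟨y, hy, y', hy', h, rfl⟩)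

lemma scale_pos : 0 < scale c := by
  rcases scale_mem c with h | ⟨y, hy, y', hy', hne, h⟩
  · rw [h]; exact one_pos
  · rw [h]; exact cost_pos_of_ne fun he => hne (c.eq_of_fst hy hy' he)

lemma scale_le_cost {y y' : (Fin n → ℝ) × Lab X x₀} (hy : y ∈ c) (hy' : y' ∈ c) (h : y ≠ y')
    (hlt : cost y < scale c) : scale c ≤ cost y' :=
  (le_max_iff.1 (scale_le_max c hy hy' h)).resolve_left hlt.not_ge

lemma scale_single (h : ∀ y ∈ c, ∀ y' ∈ c, y = y') : scale c = 1 := by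
  rcases scale_mem c with h' | ⟨y, hy, y', hy', hne, -⟩
  · exact h'
  · exact absurd (h y hy y' hy') hne

lemma continuous_scale [TopologicalSpace X] : Continuous (scale : Conf (vis n : (Fin n → ℝ) × Lab X x₀ → ℝ) → ℝ) := by
  refine continuous_iff_continuousAt.2 fun c => ?_
  obtain ⟨η, h1, h2⟩ := Conf.exists_sections (continuous_vis n) (tendsto_id (x := 𝓝 c))
  have hcost : ∀ y ∈ c, Tendsto (fun k => cost (η y k)) (𝓝 c) (𝓝 (cost y)) := fun y hy =>
    (continuous_cost.tendsto y).comp (h1 y hy).1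
  refine tendsto_order.2 ⟨fun a ha => ?_, fun a ha => ?_⟩
  · obtain ⟨b, hab, hb⟩ := exists_between ha
    have hpair : ∀ᶠ k in 𝓝 c, ∀ y ∈ c, ∀ y' ∈ c, y ≠ y' →
        a < max (cost (η y k)) (cost (η y' k)) := by
      refine (eventually_all_finite c.finite).2 fun y hy =>
        (eventually_all_finite c.finite).2 fun y' hy' => ?_
      by_cases hne : y = y'
      · exact Eventually.of_forall fun k h => absurd hne h
      · filter_upwards [((hcost y hy).max (hcost y' hy')).eventually
          (lt_mem_nhds (ha.trans_le (scale_le_max c hy hy' hne)))] with k hk _ using hk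
    have hb1 : b < 1 := hb.trans_le (scale_le_one c)
    rcases lt_or_ge a 0 with ha0 | ha0
    · exact Eventually.of_forall fun k => ha0.trans (scale_pos k)
    filter_upwards [hpair, h2 (1 - b) (by linarith)] with k hk hall
    have hall' : ∀ z ∈ k, (∃ y ∈ c, z = η y k) ∨ a < cost z := fun z hz => by
      rcases le_or_gt (1 - b) (vis n z) with h | h
      · exact Or.inl (hall z hz h)
      · have := lt_cost_of_vis_lt (by linarith) h
        exact Or.inr (by linarith)
    rcases scale_mem k with h | ⟨z, hz, z', hz', hne, h⟩
    · rw [h]; linarith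
    · rw [h]
      rcases hall' z hz with ⟨y, hy, rfl⟩ | h'
      · rcases hall' z' hz' with ⟨y', hy', rfl⟩ | h'
        · exact hk y hy y' hy' fun he => hne (by rw [he])
        · exact lt_max_of_lt_right h'
      · exact lt_max_of_lt_left h'
  · rcases scale_mem c with h | ⟨y, hy, y', hy', hne, h⟩
    · exact Eventually.of_forall fun k => (scale_le_one k).trans_lt (h ▸ ha)
    · have hfst : y.1 ≠ y'.1 := fun he => hne (c.eq_of_fst hy hy' he)
      filter_upwards [((hcost y hy).max (hcost y' hy')).eventually (gt_mem_nhds (h ▸ ha)),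
        (h1 y hy).2, (h1 y' hy').2,
        (((continuous_fst.tendsto _).comp (h1 y hy).1).prodMk_nhds
          ((continuous_fst.tendsto _).comp (h1 y' hy').1)).eventually
          ((isOpen_ne_fun continuous_fst continuous_snd).mem_nhds hfst)] with k hk hm hm' hd
      exact (scale_le_max k hm hm' fun he => hd (congrArg Prod.fst he)).trans_lt hk

/-- The configuration consisting of one point, if it is visible. -/
def single (y : (Fin n → ℝ) × Lab X x₀) : Conf (vis n : (Fin n → ℝ) × Lab X x₀ → ℝ) :=
  Conf.mk {z | y = z ∧ 0 < vis n z} ((finite_singleton y).subset (by rintro _ ⟨rfl, -⟩; rfl))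
    (by rintro _ ⟨rfl, -⟩ _ ⟨rfl, -⟩ _; rfl) (by rintro _ ⟨-, h⟩; exact h)

lemma mem_single {y z : (Fin n → ℝ) × Lab X x₀} : z ∈ single y ↔ y = z ∧ 0 < vis n z := Iff.rfl

lemma single_eq_empty {y : (Fin n → ℝ) × Lab X x₀} (h : vis n y ≤ 0) : single y = ∅ :=
  Conf.eq_empty_iff.2 fun z hz => by
    obtain ⟨rfl, h'⟩ := mem_single.1 hz
    exact h.not_gt h'

end Spacing

section Collapse

variable {n : ℕ} {X : Type*} [TopologicalSpace X] {x₀ : X}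

/-- The point of the suspension with coordinates in `[-1, 1]`, clipped. -/
def toSusp (q : (Fin n → ℝ) × X) : Susp n X x₀ :=
  Quot.mk _ (fun k => projIcc 0 1 zero_le_one ((q.1 k + 1) / 2), q.2)

lemma continuous_toSusp : Continuous (toSusp : (Fin n → ℝ) × X → Susp n X x₀) := by
  refine continuous_quot_mk.comp (Continuous.prodMk ?_ continuous_snd)
  exact continuous_pi fun k => continuous_projIcc.comp (by fun_prop)

lemma abs_two_mul_sub_one {r : I} (h : r = 0 ∨ r = 1) : |2 * (r : ℝ) - 1| = 1 := by
  rcases h with rfl | rfl <;> norm_num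

lemma suspMk_eq_base {q : NCube n × X} (h : q ∈ SuspCollapse n X x₀) :
    (Quot.mk _ q : Susp n X x₀) = Susp.base n X x₀ :=
  Quot.sound ⟨h, Or.inr ⟨trivial, rfl⟩⟩

lemma toSusp_eq_base_of_abs {z : Fin n → ℝ} {x : X} (h : ∃ k, 1 ≤ |z k|) :
    (toSusp (z, x) : Susp n X x₀) = Susp.base n X x₀ := by
  obtain ⟨k, hk⟩ := h
  refine suspMk_eq_base (Or.inl ⟨⟨k, ?_⟩, trivial⟩)
  rcases le_abs.1 hk with h | h
  · exact Or.inr (projIcc_of_right_le zero_le_one (by linarith))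
  · exact Or.inl (projIcc_of_le_left zero_le_one (by linarith))

lemma toSusp_eq_base_of_eq {z : Fin n → ℝ} : (toSusp (z, x₀) : Susp n X x₀) = Susp.base n X x₀ :=
  suspMk_eq_base (Or.inr ⟨trivial, rfl⟩)

lemma toSusp_of_cube (s : NCube n) (x : X) :
    (toSusp (fun k => 2 * (s k : ℝ) - 1, x) : Susp n X x₀) = Quot.mk _ (s, x) := by
  refine congrArg (Quot.mk _) (Prod.ext (funext fun k => ?_) rfl)
  change projIcc 0 1 zero_le_one ((2 * (s k : ℝ) - 1 + 1) / 2) = s k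
  rw [show (2 * (s k : ℝ) - 1 + 1) / 2 = (s k : ℝ) by ring, projIcc_val]

lemma toSusp_zoom_eq_base {r : ℝ} (hr : 0 < r) {y : (Fin n → ℝ) × Lab X x₀}
    (h : r / 2 ≤ cost y) : (toSusp ((2 / r) • y.1, y.2.pt) : Susp n X x₀) = Susp.base n X x₀ := by
  rcases le_max_iff.1 h with h | h
  · obtain ⟨k, hk⟩ : ∃ k, r / 2 ≤ |y.1 k| := by
      by_contra! h'
      exact h.not_gt ((pi_norm_lt_iff (by positivity)).2 h')
    refine toSusp_eq_base_of_abs ⟨k, ?_⟩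
    rw [Pi.smul_apply, smul_eq_mul, abs_mul, abs_of_pos (by positivity)]
    calc (1 : ℝ) = 2 / r * (r / 2) := by field_simp
      _ ≤ _ := by gcongr
  · rw [y.2.pt_eq (by linarith)]
    exact toSusp_eq_base_of_eq

variable [NeZero n]

open Classical in
/-- Collapsing all but the central point of a configuration. -/
def collapse (c : Conf (vis n : (Fin n → ℝ) × Lab X x₀ → ℝ)) : Susp n X x₀ :=
  if h : ∃ y ∈ c, cost y < scale c then
    toSusp ((2 / scale c) • h.choose.1, h.choose.2.pt)
  else Susp.base n X x₀

lemma collapse_of_mem {c : Conf (vis n : (Fin n → ℝ) × Lab X x₀ → ℝ)}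
    {y : (Fin n → ℝ) × Lab X x₀} (hy : y ∈ c) (h : cost y < scale c) :
    collapse c = toSusp ((2 / scale c) • y.1, y.2.pt) := by
  have hex : ∃ y ∈ c, cost y < scale c := ⟨y, hy, h⟩
  have hs := hex.choose_spec
  have : hex.choose = y := by
    by_contra hne
    exact (scale_le_cost c hs.1 hy hne hs.2).not_gt h
  rw [collapse, dif_pos hex, this]

lemma collapse_of_le {c : Conf (vis n : (Fin n → ℝ) × Lab X x₀ → ℝ)}
    (h : ∀ y ∈ c, scale c / 2 ≤ cost y) : collapse c = Susp.base n X x₀ := by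
  by_cases hex : ∃ y ∈ c, cost y < scale c
  · obtain ⟨y, hy, hlt⟩ := hex
    rw [collapse_of_mem hy hlt, toSusp_zoom_eq_base (scale_pos c) (h y hy)]
  · rw [collapse, dif_neg hex]

lemma continuous_collapse :
    Continuous (collapse : Conf (vis n : (Fin n → ℝ) × Lab X x₀ → ℝ) → Susp n X x₀) := by
  refine continuous_iff_continuousAt.2 fun c => ?_
  obtain ⟨η, h1, h2⟩ := Conf.exists_sections (continuous_vis n) (tendsto_id (x := 𝓝 c))
  have hcost : ∀ y ∈ c, Tendsto (fun k => cost (η y k)) (𝓝 c) (𝓝 (cost y)) := fun y hy =>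
    (continuous_cost.tendsto y).comp (h1 y hy).1
  have hscale : Tendsto scale (𝓝 c) (𝓝 (scale c)) := continuous_scale.tendsto c
  have hpos := scale_pos c
  by_cases hex : ∃ y ∈ c, cost y < scale c
  · obtain ⟨y, hy, hlt⟩ := hex
    rw [ContinuousAt, collapse_of_mem hy hlt]
    have hT : Tendsto (fun k => (toSusp ((2 / scale k) • (η y k).1, (η y k).2.pt) : Susp n X x₀))
        (𝓝 c) (𝓝 (toSusp ((2 / scale c) • y.1, y.2.pt))) := by
      refine (continuous_toSusp.tendsto _).comp (Tendsto.prodMk_nhds ?_ ?_)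
      · exact (tendsto_const_nhds.div hscale hpos.ne').smul
          ((continuous_fst.tendsto _).comp (h1 y hy).1)
      · exact ((Lab.continuous_pt.comp continuous_snd).tendsto _).comp (h1 y hy).1
    refine hT.congr' ?_
    filter_upwards [(hcost y hy).eventually_lt hscale hlt, (h1 y hy).2] with k hk hm
    exact (collapse_of_mem hm hk).symm
  · push Not at hex
    rw [ContinuousAt, collapse_of_le fun y hy => (half_le_self hpos.le).trans (hex y hy)]
    refine tendsto_const_nhds.congr' ?_
    have hlow : ∀ᶠ k in 𝓝 c, ∀ y ∈ c, 3 / 4 * scale c < cost (η y k) :=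
      (eventually_all_finite c.finite).2 fun y hy =>
        (hcost y hy).eventually (lt_mem_nhds (by linarith [hex y hy]))
    filter_upwards [hlow, h2 (1 / 4) (by norm_num),
      hscale.eventually (gt_mem_nhds (show scale c < 5 / 4 * scale c by linarith))] with k hk hall hs
    refine (collapse_of_le fun z hz => ?_).symm
    rcases le_or_gt (1 / 4) (vis n z) with h | h
    · obtain ⟨y, hy, rfl⟩ := hall z hz h
      linarith [hk y hy]
    · have := lt_cost_of_vis_lt (by norm_num) h
      linarith [scale_le_one k]

lemma collapse_empty : collapse (∅ : Conf (vis n : (Fin n → ℝ) × Lab X x₀ → ℝ)) =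
    Susp.base n X x₀ :=
  collapse_of_le fun y hy => absurd hy (Conf.notMem_empty y)

lemma continuous_single : Continuous (single : (Fin n → ℝ) × Lab X x₀ → Conf (vis n)) := by
  refine continuous_iff_continuousAt.2 fun y => ?_
  refine Conf.tendsto_list (continuous_vis n) (ι := Unit) (y := fun _ z => z) (y₀ := fun _ => y)
    (fun _ _ => tendsto_id) (fun _ h θ hθ => ?_) (fun _ _ _ _ _ => rfl)
    (Eventually.of_forall fun z w => ?_) fun w => ?_
  · exact (continuous_vis n).tendsto y |>.eventually (gt_mem_nhds (h.trans_lt hθ))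
  · rw [mem_single]; simp
  · rw [mem_single]; simp

lemma collapse_single (y : (Fin n → ℝ) × Lab X x₀) :
    collapse (single y) = toSusp ((2 : ℝ) • y.1, y.2.pt) := by
  have h1 : scale (single y) = 1 := scale_single _ fun z hz w hw =>
    (mem_single.1 hz).1.symm.trans (mem_single.1 hw).1
  by_cases hv : cost y < 1
  · have hmem : y ∈ single y := by
      refine mem_single.2 ⟨rfl, vis_pos_iff.2 ⟨?_, fun k => ?_⟩⟩
      · have := (le_max_right _ _).trans_lt hv
        linarith [y.2.ht_nonneg]
      · exact (norm_le_pi_norm y.1 k).trans_lt ((le_max_left _ _).trans_lt hv)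
    rw [collapse_of_mem hmem (by rw [h1]; exact hv), h1, div_one]
  · have hb := toSusp_zoom_eq_base one_pos (y := y) (by linarith)
    rw [div_one] at hb
    rw [hb, collapse_of_le]
    intro z hz
    obtain ⟨rfl, -⟩ := mem_single.1 hz
    rw [h1]; linarith

variable (W : Whisker X x₀)

/-- The one-point configuration given by a point of the suspension. -/
def ofSusp : Susp n X x₀ → Conf (vis n : (Fin n → ℝ) × Lab X x₀ → ℝ) :=
  Quot.lift (fun q => single (fun k => 2 * (q.1 k : ℝ) - 1, W.G (1, q.2))) (by
    have key : ∀ q ∈ SuspCollapse n X x₀,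
        single (fun k => 2 * (q.1 k : ℝ) - 1, W.G (1, q.2)) = ∅ := by
      rintro ⟨s, x⟩ h
      refine single_eq_empty (not_lt.1 fun hv => ?_)
      obtain ⟨hv1, hv2⟩ := vis_pos_iff.1 hv
      rcases h with ⟨⟨k, hk⟩, -⟩ | ⟨-, rfl⟩
      · exact (hv2 k).ne (abs_two_mul_sub_one hk)
      · exact hv1.ne W.ht_G
    rintro a b ⟨ha, hb⟩
    rw [key a ha, key b hb])

lemma continuous_ofSusp :
    Continuous (ofSusp W : Susp n X x₀ → Conf (vis n : (Fin n → ℝ) × Lab X x₀ → ℝ)) := by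
  refine continuous_quot_lift _ (continuous_single.comp (Continuous.prodMk ?_ ?_))
  · have : ∀ k : Fin n, Continuous fun q : NCube n × X => q.1 k := fun k =>
      (continuous_apply (A := fun _ : Fin n => I) k).comp continuous_fst
    fun_prop
  · have := W.continuous_G
    fun_prop

lemma ofSusp_toSusp (z : Fin n → ℝ) (x : X) :
    ofSusp W (toSusp (z, x)) = single (z, W.G (1, x)) := by
  by_cases h : ∃ k, 1 ≤ |z k|
  · rw [toSusp_eq_base_of_abs h, single_eq_empty (y := (z, W.G (1, x)))]
    · refine single_eq_empty (not_lt.1 fun hv => ?_)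
      exact (vis_pos_iff.1 hv).1.ne W.ht_G
    · obtain ⟨k, hk⟩ := h
      exact not_lt.1 fun hv => ((vis_pos_iff.1 hv).2 k).not_ge hk
  · push Not at h
    refine congrArg single (Prod.ext (funext fun k => ?_) rfl)
    change 2 * ((projIcc 0 1 zero_le_one ((z k + 1) / 2) : I) : ℝ) - 1 = z k
    have := abs_lt.1 (h k)
    rw [projIcc_of_mem _ (show (z k + 1) / 2 ∈ Icc (0 : ℝ) 1 from ⟨by linarith, by linarith⟩)]
    change 2 * ((z k + 1) / 2) - 1 = z k
    ring

lemma wEq_collapse_ofSusp : WEq (collapse ∘ ofSusp W : Susp n X x₀ → _) := by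
  let h : Susp n X x₀ × ℝ → Susp n X x₀ := fun q =>
    Quot.lift (fun p : NCube n × X => (toSusp
      ((1 + q.2 ^ 2) • fun k => 2 * (p.1 k : ℝ) - 1, (W.G (q.2, p.2)).pt) : Susp n X x₀)) (by
      have key : ∀ p ∈ SuspCollapse n X x₀, (toSusp
          ((1 + q.2 ^ 2) • fun k => 2 * (p.1 k : ℝ) - 1, (W.G (q.2, p.2)).pt) : Susp n X x₀) =
          Susp.base n X x₀ := by
        rintro ⟨s, x⟩ (⟨⟨k, hk⟩, -⟩ | ⟨-, rfl⟩)
        · refine toSusp_eq_base_of_abs ⟨k, ?_⟩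
          have habs : |2 * (s k : ℝ) - 1| = 1 := abs_two_mul_sub_one hk
          rw [Pi.smul_apply, smul_eq_mul, abs_mul, habs, mul_one]
          exact le_abs.2 (Or.inl (by nlinarith [sq_nonneg q.2]))
        · simp only [W.pt_G]
          exact toSusp_eq_base_of_eq
      rintro a b ⟨ha, hb⟩
      rw [key a ha, key b hb]) q.1
  have hc : Continuous h := by
    have hq : Topology.IsQuotientMap (Quot.mk (fun a b : NCube n × X =>
      a ∈ SuspCollapse n X x₀ ∧ b ∈ SuspCollapse n X x₀)) := isQuotientMap_quot_mk
    refine hq.continuous_lift_prod_left ?_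
    have h1 : ∀ k : Fin n, Continuous fun q : (NCube n × X) × ℝ => q.1.1 k := fun k =>
      (continuous_apply (A := fun _ : Fin n => I) k).comp (continuous_fst.comp continuous_fst)
    have h2 := W.continuous_G
    have h3 := Lab.continuous_pt (X := X) (x₀ := x₀)
    refine continuous_toSusp.comp (f := fun q : (NCube n × X) × ℝ =>
      ((1 + q.2 ^ 2) • fun k => 2 * (q.1.1 k : ℝ) - 1, (W.G (q.2, q.1.2)).pt)) ?_
    fun_prop
  refine WEq.of_homotopic_id (h := h) hc.continuousOn ?_ ?_
  · rintro ⟨s, x⟩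
    refine Eq.trans ?_ (toSusp_of_cube s x)
    simp only [h, W.G_zero]
    norm_num
    rfl
  · rintro ⟨s, x⟩
    refine Eq.trans ?_ (collapse_single _).symm
    simp only [h]
    norm_num

lemma wEq_ofSusp_collapse :
    WEq (ofSusp W ∘ collapse : Conf (vis n : (Fin n → ℝ) × Lab X x₀ → ℝ) → _) := by
  let C := Conf (vis n : (Fin n → ℝ) × Lab X x₀ → ℝ)
  let φ : C × ℝ → ℝ := fun q => (1 - q.2) + q.2 * (2 / scale q.1)
  have hφ : ∀ q : C × ℝ, q.2 ∈ Icc (0 : ℝ) 1 → 1 ≤ φ q := fun q hq => by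
    have : 1 ≤ 2 / scale q.1 := by
      rw [le_div_iff₀ (scale_pos q.1)]; linarith [scale_le_one q.1]
    simp only [φ]
    nlinarith [hq.1]
  have hφc : Continuous φ := by
    have h1 : Continuous fun q : C × ℝ => 2 / scale q.1 :=
      continuous_const.div (continuous_scale.comp continuous_fst) fun q => (scale_pos q.1).ne'
    fun_prop
  let Φ : C × ℝ → (Fin n → ℝ) × Lab X x₀ → (Fin n → ℝ) × Lab X x₀ := fun q y =>
    (φ q • y.1, W.push (q.2, y.2))
  have hinj : ∀ q : C × ℝ, q.2 ∈ Icc (0 : ℝ) 1 → Conf.VisInj (vis n) (Φ q) :=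
    fun q hq y y' _ _ h => smul_right_injective _ (by linarith [hφ q hq]) h
  have h0 : (0 : ℝ) ∈ Icc (0 : ℝ) 1 := by simp
  have h1 : (1 : ℝ) ∈ Icc (0 : ℝ) 1 := by simp
  refine WEq.of_homotopic_id (h := fun q => Conf.map (vis n) (Φ q) q.1) ?_ ?_ ?_
  · refine Conf.continuousOn_map (continuous_vis n) (continuous_vis n) continuousOn_fst
      (Φ := Φ) ?_ (fun q hq => hinj q hq.2) ?_
    · have := W.continuous_push
      exact Continuous.continuousOn (by fun_prop)
    · refine fun θ hθ => ⟨θ, hθ, fun q hq y _ h => h.trans (vis_le_of_le n ?_ fun k => ?_)⟩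
      · exact W.ht_le_push (q.2, y.2)
      · simp only [Φ, Pi.smul_apply, smul_eq_mul, abs_mul]
        exact le_mul_of_one_le_left (abs_nonneg _) ((hφ q hq.2).trans (le_abs_self _))
  · refine fun c => Conf.map_eq_self (hinj (c, 0) h0) fun y _ => ?_
    simp [Φ, φ, W.push_zero]
  · intro c
    have hΦ : ∀ y, Φ (c, 1) y = ((2 / scale c) • y.1, W.G (1, y.2.pt)) := fun y => by
      simp [Φ, φ, W.push_one]
    have hinv : ∀ y, scale c ≤ cost y → vis n (Φ (c, 1) y) ≤ 0 := fun y hy => by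
      have hpos := scale_pos c
      refine not_lt.1 fun hv => ?_
      rw [hΦ] at hv
      obtain ⟨hv1, hv2⟩ := vis_pos_iff.1 hv
      rcases le_max_iff.1 hy with h | h
      · refine h.not_gt ((pi_norm_lt_iff hpos).2 fun k => ?_)
        have : |((2 / scale c) • y.1) k| < 1 := hv2 k
        rw [Pi.smul_apply, smul_eq_mul, abs_mul, abs_of_pos (by positivity), div_mul_eq_mul_div,
          div_lt_one hpos] at this
        rw [Real.norm_eq_abs]
        linarith [abs_nonneg (y.1 k)]
      · refine hv1.ne ?_
        simp only [y.2.pt_eq (show y.2.ht ≠ 0 by linarith), W.ht_G]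
    refine Conf.ext fun z => ?_
    rw [Conf.mem_map (hinj (c, 1) h1), Function.comp_apply]
    by_cases hex : ∃ y ∈ c, cost y < scale c
    · obtain ⟨y, hy, hlt⟩ := hex
      rw [collapse_of_mem hy hlt, ofSusp_toSusp, mem_single, ← hΦ y]
      constructor
      · rintro ⟨y', hy', rfl, h⟩
        obtain rfl : y = y' := by
          by_contra hne
          exact (hinv y' (scale_le_cost c hy hy' hne hlt)).not_gt h
        exact ⟨rfl, h⟩
      · rintro ⟨rfl, h⟩
        exact ⟨y, hy, rfl, h⟩
    · push Not at hex
      rw [collapse_of_le fun y hy => (half_le_self (scale_pos c).le).trans (hex y hy),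
        ← toSusp_eq_base_of_eq (z := 0), ofSusp_toSusp, mem_single]
      constructor
      · rintro ⟨y, hy, rfl, h⟩
        exact absurd h (hinv y (hex y hy)).not_gt
      · rintro ⟨rfl, h⟩
        exact absurd W.ht_G (vis_pos_iff.1 h).1.ne

lemma wEq_collapse (W : Whisker X x₀) :
    WEq (collapse : Conf (vis n : (Fin n → ℝ) × Lab X x₀ → ℝ) → Susp n X x₀) :=
  WEq.of_comp continuous_collapse (continuous_ofSusp W) (wEq_ofSusp_collapse W)
    (wEq_collapse_ofSusp W)

end Collapse

end Scan

/-! ### Cellular criterion for weak homotopy equivalences -/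

namespace Scan

section Weak

variable {Z Z' : Type*} [TopologicalSpace Z] [TopologicalSpace Z'] {m : ℕ}

/-- The retraction of Euclidean space to the cube. -/
def toCube (t : Fin m → ℝ) : Fin m → I := fun k => projIcc 0 1 zero_le_one (t k)

lemma continuous_toCube : Continuous (toCube : (Fin m → ℝ) → Fin m → I) :=
  continuous_pi fun k => continuous_projIcc.comp (continuous_apply k)

/-- The inclusion of the cube in Euclidean space. -/
def ofCube (s : Fin m → I) : Fin m → ℝ := fun k => s k

lemma continuous_ofCube : Continuous (ofCube : (Fin m → I) → Fin m → ℝ) := by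
  unfold ofCube
  fun_prop

lemma toCube_ofCube (s : Fin m → I) : toCube (ofCube s) = s :=
  funext fun k => projIcc_val zero_le_one (s k)

lemma ofCube_mem (s : Fin m → I) : ofCube s ∈ Icc (0 : Fin m → ℝ) 1 :=
  ⟨fun k => (s k).2.1, fun k => (s k).2.2⟩

lemma ofCube_mem_bdry {s : Fin m → I} (h : s ∈ Cube.boundary (Fin m)) :
    ofCube s ∈ boxBdry (0 : Fin m → ℝ) 1 := by
  obtain ⟨k, hk⟩ := h
  exact ⟨ofCube_mem s, k, hk.imp (fun h => congrArg Subtype.val h) fun h => congrArg Subtype.val h⟩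

lemma toCube_mem_boundary {t : Fin m → ℝ} (h : t ∈ boxBdry (0 : Fin m → ℝ) 1) :
    toCube t ∈ Cube.boundary (Fin m) := by
  obtain ⟨-, k, hk⟩ := h
  exact ⟨k, hk.imp (fun h => projIcc_of_le_left zero_le_one h.le)
    fun h => projIcc_of_right_le zero_le_one h.ge⟩

lemma isCell_cube : IsCell (Icc (0 : Fin m → ℝ) 1) (boxBdry 0 1) := isCell_box fun _ => one_pos

lemma homotopicRel_of_hrel {a b : (Fin m → ℝ) → Z}
    (h : HRel univ (Icc 0 1) (boxBdry 0 1) a b) {p p' : C(Fin m → I, Z)}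
    (hp : ∀ s, a (ofCube s) = p s) (hp' : ∀ s, b (ofCube s) = p' s) :
    p.HomotopicRel p' (Cube.boundary (Fin m)) := by
  obtain ⟨H, hH, h0, h1, hA, -⟩ := h
  refine ⟨⟨⟨⟨fun q => H (ofCube q.2, q.1), ?_⟩, fun s => ?_, fun s => ?_⟩, fun t s hs => ?_⟩⟩
  · exact hH.comp_continuous ((continuous_ofCube.comp continuous_snd).prodMk
      (continuous_subtype_val.comp continuous_fst)) fun q => ⟨ofCube_mem q.2, q.1.2⟩
  · exact (h0 _ (ofCube_mem s)).trans (hp s)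
  · exact (h1 _ (ofCube_mem s)).trans (hp' s)
  · exact (hA _ (ofCube_mem_bdry hs) _ t.2).trans (hp s)

lemma hrel_of_homotopicRel {p p' : C(Fin m → I, Z)}
    (h : p.HomotopicRel p' (Cube.boundary (Fin m))) :
    HRel univ (Icc 0 1) (boxBdry 0 1) (p ∘ toCube) (p' ∘ toCube) := by
  obtain ⟨H⟩ := h
  refine ⟨fun q => H (projIcc 0 1 zero_le_one q.2, toCube q.1), ?_, fun t _ => ?_, fun t _ => ?_,
    fun t ht u _ => ?_, fun _ _ _ _ => trivial⟩
  · exact (H.continuous.comp ((continuous_projIcc.comp continuous_snd).prodMk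
      (continuous_toCube.comp continuous_fst))).continuousOn
  · simp
  · simp
  · exact H.eq_fst _ (toCube_mem_boundary ht)

lemma WEq.bijective_homotopyGroup (f : C(Z, Z')) (hf : WEq f) (m : ℕ) (x : Z) :
    Function.Bijective (HomotopyGroup.inducedMap (Fin m) x f) := by
  constructor
  · rintro ⟨p⟩ ⟨p'⟩ h
    have h' := hrel_of_homotopicRel (Quotient.exact h)
    refine Quotient.sound (homotopicRel_of_hrel (hf.hrel_of_comp isCell_cube
      (a := p.1 ∘ toCube) (b := p'.1 ∘ toCube) (p.1.continuous.comp continuous_toCube).continuousOn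
      (p'.1.continuous.comp continuous_toCube).continuousOn (fun t ht => ?_) h')
      (fun s => ?_) fun s => ?_)
    · exact (p.2 _ (toCube_mem_boundary ht)).trans (p'.2 _ (toCube_mem_boundary ht)).symm
    · exact congrArg p.1 (toCube_ofCube s)
    · exact congrArg p'.1 (toCube_ofCube s)
  · rintro ⟨q⟩
    obtain ⟨c, hc, hcA, h⟩ := hf (Fin m → ℝ) (Icc 0 1) (boxBdry 0 1) isCell_cube (fun _ => x)
      continuousOn_const (q.1 ∘ toCube) (q.1.continuous.comp continuous_toCube).continuousOn
      fun t ht => (q.2 _ (toCube_mem_boundary ht)).symm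
    let p : GenLoop (Fin m) Z x := ⟨⟨c ∘ ofCube, hc.comp_continuous continuous_ofCube ofCube_mem⟩,
      fun s hs => hcA _ (ofCube_mem_bdry hs)⟩
    exact ⟨Quotient.mk _ p, Quotient.sound (homotopicRel_of_hrel h (fun s => rfl)
      fun s => congrArg q.1 (toCube_ofCube s))⟩

lemma HRel.joined {V : Type} [TopologicalSpace V] {K A : Set V} {a b : V → Z}
    (h : HRel univ K A a b) {x : V} (hx : x ∈ K) : Joined (a x) (b x) := by
  obtain ⟨H, hH, h0, h1, -⟩ := h
  exact ⟨⟨⟨fun t => H (x, t), hH.comp_continuous (by fun_prop) fun t => ⟨hx, t.2⟩⟩, h0 x hx, h1 x hx⟩⟩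

lemma WEq.bijective_zerothHomotopy [Nonempty Z] (f : C(Z, Z')) (hf : WEq f) :
    Function.Bijective (ZerothHomotopy.inducedMap f) := by
  have hemp : ∀ t : Fin 0 → ℝ, t ∉ boxBdry (0 : Fin 0 → ℝ) 1 := fun t ht => ht.2.choose.elim0
  have hmem : (0 : Fin 0 → ℝ) ∈ Icc (0 : Fin 0 → ℝ) 1 := ⟨le_rfl, zero_le_one⟩
  constructor
  · rintro ⟨a⟩ ⟨b⟩ h
    obtain ⟨γ⟩ : Joined (f a) (f b) := Quotient.exact h
    have h' : HRel univ (Icc (0 : Fin 0 → ℝ) 1) (boxBdry 0 1) (f ∘ fun _ => a) (f ∘ fun _ => b) :=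
      ⟨fun q => γ.extend q.2, (γ.continuous_extend.comp continuous_snd).continuousOn,
        fun _ _ => γ.extend_zero, fun _ _ => γ.extend_one, fun t ht => absurd ht (hemp t),
        fun _ _ _ _ => trivial⟩
    exact Quotient.sound ((hf.hrel_of_comp isCell_cube continuousOn_const continuousOn_const
      (fun t ht => absurd ht (hemp t)) h').joined hmem)
  · rintro ⟨b⟩
    obtain ⟨c, -, -, h⟩ := hf (Fin 0 → ℝ) (Icc 0 1) (boxBdry 0 1) isCell_cube
      (fun _ => Classical.arbitrary Z) continuousOn_const (fun _ => b) continuousOn_const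
      fun t ht => absurd ht (hemp t)
    exact ⟨Quotient.mk _ (c 0), Quotient.sound (h.joined hmem)⟩

lemma WEq.isWeakHomotopyEquiv [Nonempty Z] (f : C(Z, Z')) (hf : WEq f) : IsWeakHomotopyEquiv f :=
  ⟨hf.bijective_zerothHomotopy f, hf.bijective_homotopyGroup f⟩

end Weak

end Scan

/-! ### The scanning map -/

namespace Scan

section Loops

variable {n : ℕ} {X : Type*} [TopologicalSpace X] {x₀ : X}

instance : LocallyCompactSpace (NCube n) := inferInstanceAs (LocallyCompactSpace (Fin n → I))

/-- The coordinates in `[-1, 1]` of a point of the cube. -/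
def spread (s : NCube n) (k : Fin n) : ℝ := 2 * (s k : ℝ) - 1

/-- The point of the cube with given coordinates in `[-1, 1]`, clipped. -/
def unspread (t : Fin n → ℝ) : NCube n := fun k => projIcc 0 1 zero_le_one ((t k + 1) / 2)

lemma continuous_spread : Continuous (spread : NCube n → Fin n → ℝ) :=
  continuous_pi fun k => by
    have : Continuous fun s : NCube n => s k := continuous_apply (A := fun _ : Fin n => I) k
    unfold spread
    fun_prop

lemma continuous_unspread : Continuous (unspread : (Fin n → ℝ) → NCube n) :=
  continuous_pi fun k => continuous_projIcc.comp (by fun_prop)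

lemma unspread_spread (s : NCube n) : unspread (spread s) = s :=
  funext fun k => by
    change projIcc 0 1 zero_le_one ((2 * (s k : ℝ) - 1 + 1) / 2) = s k
    rw [show (2 * (s k : ℝ) - 1 + 1) / 2 = (s k : ℝ) by ring, projIcc_val]

lemma abs_spread_le (s : NCube n) (k : Fin n) : |spread s k| ≤ 1 := by
  have := (s k).2
  exact abs_le.2 ⟨by simp only [spread]; linarith [this.1], by simp only [spread]; linarith [this.2]⟩

lemma spread_mem_closedBall (s : NCube n) : spread s ∈ closedBall (0 : Fin n → ℝ) 1 :=
  (closedBall_pi_eq n).2 (abs_spread_le s)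

lemma spread_mem_sphere {s : NCube n} (h : s ∈ NCube.boundary n) :
    spread s ∈ sphere (0 : Fin n → ℝ) 1 :=
  (sphere_pi_eq n).2 ⟨abs_spread_le s, h.imp fun _ hk => abs_two_mul_sub_one hk⟩

lemma unspread_mem_boundary {t : Fin n → ℝ} (h : t ∈ sphere (0 : Fin n → ℝ) 1) :
    unspread t ∈ NCube.boundary n := by
  obtain ⟨-, k, hk⟩ := (sphere_pi_eq n).1 h
  refine ⟨k, ?_⟩
  rcases le_abs.1 hk.ge with h | h
  · exact Or.inr (projIcc_of_right_le zero_le_one (by linarith))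
  · exact Or.inl (projIcc_of_le_left zero_le_one (by linarith))

end Loops

section CurryLoops

variable {n : ℕ} {Y : Type*} [TopologicalSpace Y] {y₀ : Y}

lemma exists_curry_loop {V : Type*} [TopologicalSpace V] {D : Set V} {f : V × (Fin n → ℝ) → Y}
    (hf : ContinuousOn f (D ×ˢ closedBall 0 1))
    (h : ∀ x ∈ D, ∀ t ∈ sphere (0 : Fin n → ℝ) 1, f (x, t) = y₀) :
    ∃ F : V → NLoop n Y y₀, ContinuousOn F D ∧ ∀ x ∈ D, ∀ s, (F x).1 s = f (x, spread s) := by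
  classical
  have hc : Continuous fun q : D × NCube n => f (q.1, spread q.2) :=
    hf.comp_continuous ((continuous_subtype_val.comp continuous_fst).prodMk
      (continuous_spread.comp continuous_snd)) fun q => ⟨q.1.2, spread_mem_closedBall q.2⟩
  let G : D → NLoop n Y y₀ := fun x => ⟨(ContinuousMap.curry ⟨_, hc⟩) x,
    fun s hs => h x x.2 _ (spread_mem_sphere hs)⟩
  have hG : Continuous G := Continuous.subtype_mk (ContinuousMap.continuous _) _
  refine ⟨fun x => if hx : x ∈ D then G ⟨x, hx⟩ else ⟨ContinuousMap.const _ y₀, fun _ _ => rfl⟩,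
    ?_, fun x hx s => ?_⟩
  · rw [continuousOn_iff_continuous_domRestrict]
    convert hG using 1
    exact funext fun x => dif_pos x.2
  · exact congrArg (fun F : NLoop n Y y₀ => F.1 s) (dif_pos hx)

lemma continuousOn_uncurry_loop {V : Type*} [TopologicalSpace V] {D : Set V}
    {g : V → NLoop n Y y₀} (hg : ContinuousOn g D) (S : Set (Fin n → ℝ)) :
    ContinuousOn (fun q : V × (Fin n → ℝ) => (g q.1).1 (unspread q.2)) (D ×ˢ S) := by
  have he : Continuous fun q : NLoop n Y y₀ × NCube n => q.1.1 q.2 :=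
    continuous_eval.comp ((continuous_subtype_val.comp continuous_fst).prodMk continuous_snd)
  exact he.comp_continuousOn ((hg.comp continuousOn_fst fun q hq => hq.1).prodMk
    (continuous_unspread.comp continuous_snd).continuousOn)

end CurryLoops

section Scanning

variable {n : ℕ} [NeZero n] {X : Type*} [TopologicalSpace X] {x₀ : X}

/-- The scanning map, before currying. -/
def field (q : Conf (vis 0 : (Fin n → ℝ) × Lab X x₀ → ℝ) × (Fin n → ℝ)) : Susp n X x₀ :=
  collapse (scanMany n q.1 q.2)

variable [PathConnectedSpace X]

lemma continuous_scanMany_self : Continuous fun q :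
    Conf (vis 0 : (Fin n → ℝ) × Lab X x₀ → ℝ) × (Fin n → ℝ) => scanMany n q.1 q.2 :=
  continuous_scanMany le_rfl

lemma continuous_field :
    Continuous (field : Conf (vis 0 : (Fin n → ℝ) × Lab X x₀ → ℝ) × (Fin n → ℝ) → Susp n X x₀) :=
  continuous_collapse.comp continuous_scanMany_self

lemma field_sphere (c : Conf (vis 0 : (Fin n → ℝ) × Lab X x₀ → ℝ)) {t : Fin n → ℝ}
    (ht : t ∈ sphere (0 : Fin n → ℝ) 1) : field (c, t) = Susp.base n X x₀ := by
  rw [field, scanMany_sphere le_rfl c ht, collapse_empty]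

lemma HRel.field {V : Type} [TopologicalSpace V] {K A : Set V}
    {a b : V → Conf (vis 0 : (Fin n → ℝ) × Lab X x₀ → ℝ)} (h : HRel univ K A a b) :
    HRel univ (K ×ˢ closedBall (0 : Fin n → ℝ) 1) (A ×ˢ closedBall 0 1 ∪ K ×ˢ sphere 0 1)
      (fun q => Scan.field (a q.1, q.2)) (fun q => Scan.field (b q.1, q.2)) := by
  obtain ⟨H, hH, h0, h1, hA, -⟩ := h
  refine ⟨fun q => Scan.field (H (q.1.1, q.2), q.1.2), ?_, fun q hq => ?_, fun q hq => ?_, ?_,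
    fun _ _ _ _ => trivial⟩
  · refine continuous_field.comp_continuousOn (ContinuousOn.prodMk ?_ (by fun_prop))
    exact hH.comp (by fun_prop) fun q hq => ⟨hq.1.1, hq.2⟩
  · simp only [h0 _ hq.1]
  · simp only [h1 _ hq.1]
  · rintro q (hq | hq) t ht
    · simp only [hA _ hq.1 _ ht]
    · simp only [field_sphere _ hq.2]

lemma wEq_of_field (W : Whisker X x₀)
    {F : LabeledConfig (Fin n → ℝ) X x₀ → NLoop n (Susp n X x₀) (Susp.base n X x₀)}
    (hF : ∀ c s, (F c).1 s = field (toConf W c, spread s)) : WEq F := by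
  classical
  intro V _ K A hK c hc g hg hcg
  have hAK := hK.subset
  have hbox := hK.prod (isCell_ball n)
  let gh : V × (Fin n → ℝ) → Susp n X x₀ := fun q => (g q.1).1 (unspread q.2)
  have hgh : ContinuousOn gh (K ×ˢ closedBall 0 1) := continuousOn_uncurry_loop hg _
  have hghS : ∀ x, ∀ t ∈ sphere (0 : Fin n → ℝ) 1, gh (x, t) = Susp.base n X x₀ := fun x t ht =>
    (g x).2 _ (unspread_mem_boundary ht)
  have hspread : ∀ t ∈ closedBall (0 : Fin n → ℝ) 1, spread (unspread t) = t := fun t ht => by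
    refine funext fun k => ?_
    have := abs_le.1 ((closedBall_pi_eq n).1 ht k)
    change 2 * ((projIcc 0 1 zero_le_one ((t k + 1) / 2) : I) : ℝ) - 1 = t k
    rw [projIcc_of_mem _ (show (t k + 1) / 2 ∈ Icc (0 : ℝ) 1 from ⟨by linarith, by linarith⟩)]
    change 2 * ((t k + 1) / 2) - 1 = t k
    ring
  have hghA : ∀ x ∈ A, ∀ t ∈ closedBall (0 : Fin n → ℝ) 1,
      field (toConf W (c x), t) = gh (x, t) := fun x hx t ht => by
    have := hF (c x) (unspread t)
    rw [hspread t ht, hcg x hx] at this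
    exact this.symm
  have hcA : ContinuousOn (fun x => toConf W (c x)) A := (continuous_toConf W).comp_continuousOn hc
  obtain ⟨G, hG, hGb, hGg⟩ := wEq_collapse W _ _ _ hbox
    (fun q => if q.1 ∈ A then scanMany n (toConf W (c q.1)) q.2 else ∅)
    (continuousOn_ite_bdry hK.isClosed hK.isClosed_bdry isClosed_closedBall isClosed_sphere
      (f := fun q : V × (Fin n → ℝ) => scanMany n (toConf W (c q.1)) q.2)
      (continuous_scanMany_self.comp_continuousOn
        ((hcA.comp continuousOn_fst fun q hq => hq.1).prodMk continuousOn_snd))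
      fun x _ t ht => scanMany_sphere le_rfl _ ht) gh hgh (by
        rintro ⟨x, t⟩ hq
        by_cases hx : x ∈ A
        · simp only [if_pos hx]
          refine hghA x hx t ?_
          rcases hq with hq | hq
          · exact hq.2
          · exact sphere_subset_closedBall hq.2
        · simp only [if_neg hx]
          have ht := (hq.resolve_left fun hq => hx hq.1).2
          rw [collapse_empty, hghS x t ht])
  obtain ⟨c₁, hc₁, hc₁A, h₁⟩ := exists_scanMany_hrel le_rfl hK hcA hG
    (fun x hx t ht => (hGb (x, t) (Or.inl ⟨hx, ht⟩)).trans (if_pos hx))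
    (fun x hx t ht => (hGb (x, t) (Or.inr ⟨hx, ht⟩)).trans (by
      simp only [scanMany_sphere le_rfl _ ht, ite_self]))
  obtain ⟨c₂, hc₂, hc₂A, h₂⟩ := wEq_toConf W V K A hK c hc c₁ hc₁ fun x hx => (hc₁A x hx).symm
  refine ⟨c₂, hc₂, hc₂A, ?_⟩
  obtain ⟨H, hH, h0, h1, hHA, -⟩ :=
    (h₂.field.trans (h₁.map (S' := univ) continuous_collapse.continuousOn fun _ _ => trivial)
      hbox.subset).trans hGg hbox.subset
  obtain ⟨E, hE, hEH⟩ := exists_curry_loop (y₀ := Susp.base n X x₀) (D := K ×ˢ Icc (0 : ℝ) 1)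
    (f := fun q : (V × ℝ) × (Fin n → ℝ) => H ((q.1.1, q.2), q.1.2))
    (hH.comp (by fun_prop) fun q hq => ⟨⟨hq.1.1, hq.2⟩, hq.1.2⟩)
    (fun q hq t ht => (hHA (q.1, t) (Or.inr ⟨hq.1, ht⟩) _ hq.2).trans (field_sphere _ ht))
  have h01 : (0 : ℝ) ∈ Icc (0 : ℝ) 1 := by simp
  have h11 : (1 : ℝ) ∈ Icc (0 : ℝ) 1 := by simp
  refine ⟨E, hE, fun x hx => ?_, fun x hx => ?_, fun x hx t ht => ?_, fun _ _ _ _ => trivial⟩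
  · refine Subtype.ext (ContinuousMap.ext fun s => ?_)
    rw [hEH _ ⟨hx, h01⟩, h0 _ ⟨hx, spread_mem_closedBall s⟩]
    exact (hF _ _).symm
  · refine Subtype.ext (ContinuousMap.ext fun s => ?_)
    rw [hEH _ ⟨hx, h11⟩, h1 _ ⟨hx, spread_mem_closedBall s⟩]
    simp only [gh, unspread_spread]
  · refine Subtype.ext (ContinuousMap.ext fun s => ?_)
    rw [hEH _ ⟨hAK hx, ht⟩, hHA _ (Or.inl ⟨hx, spread_mem_closedBall s⟩) _ ht]
    exact (hF _ _).symm

variable (n) in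
lemma exists_wEq_loop (W : Whisker X x₀) :
    ∃ F : C(LabeledConfig (Fin n → ℝ) X x₀, NLoop n (Susp n X x₀) (Susp.base n X x₀)), WEq F := by
  obtain ⟨F, hF, hFf⟩ := exists_curry_loop (D := univ)
    (f := fun q : LabeledConfig (Fin n → ℝ) X x₀ × (Fin n → ℝ) => field (toConf W q.1, q.2))
    (continuous_field.comp (((continuous_toConf W).comp continuous_fst).prodMk
      continuous_snd)).continuousOn fun c _ t ht => field_sphere _ ht
  exact ⟨⟨F, continuousOn_univ.1 hF⟩, wEq_of_field W fun c s => hFf c trivial s⟩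

end Scanning

end Scan

/-- For `n ≥ 1` and a well-pointed path-connected space `(X,x₀)`, there is a
weak homotopy equivalence (the scanning / electric field map) from the labelled configuration
space `C⁰(ℝ^n;X)` to the `n`-fold loop space `Ωⁿ Σⁿ X`. -/
theorem labeledConfig_euclidean_weakEquiv_loopSusp (n : ℕ) (hn : 1 ≤ n)
    (X : Type*) [TopologicalSpace X] (x₀ : X) (hwp : IsWellPointed X x₀)
    [PathConnectedSpace X] :
    ∃ f : C(LabeledConfig (Fin n → ℝ) X x₀, NLoop n (Susp n X x₀) (Susp.base n X x₀)),
      IsWeakHomotopyEquiv f := by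
  have : NeZero n := ⟨by omega⟩
  obtain ⟨W⟩ := hwp.exists_whisker
  obtain ⟨F, hF⟩ := Scan.exists_wEq_loop n W
  have : Nonempty (LabeledConfig (Fin n → ℝ) X x₀) := ⟨LabeledConfig.empty _ _ _⟩
  exact ⟨F, Scan.WEq.isWeakHomotopyEquiv F hF⟩

end
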